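/- arXiv:2305.04057 — 6 statements merged into one kernel-verified Lean document; each statement's English description precedes it below -/
import Mathlib

section
/- Let (X,d) be a compact metric space, T : X → X a continuous map, α, δ > 0 and N_δ ∈ ℕ. Then the set FKPO_{α,δ}(X,T,N_δ) of FK-α-pseudo-orbits of density 1−δ controlled by N_δ is a closed subset of X^ℕ with respect to the metric d̃(x,y) = Σ_{i=0}^∞ d(x_i,y_i)/2^i. -/
open Filter Metric Set Topology

variable {X : Type*}

def FKChain [MetricSpace X] (T : X → X) (α δ : ℝ) (n : ℕ) (x : ℕ → X) : Prop :=
  ∃ k : ℕ, (1 - δ) * (n : ℝ) < (k : ℝ) ∧ k ≤ n ∧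
    ∃ i j : ℕ → ℕ,
      StrictMonoOn i (Set.Iio k) ∧ StrictMonoOn j (Set.Iio k) ∧
      (∀ t < k, i t < n ∧ j t < n) ∧
      (∀ t, t + 1 < k → dist (T^[j (t + 1) - j t] (x (i t))) (x (i (t + 1))) ≤ α)

def FKPO [MetricSpace X] (T : X → X) (α δ : ℝ) (N : ℕ) : Set (ℕ → X) :=
  { x | ∃ s : ℕ → ℕ, StrictMono s ∧ s 0 ≤ N ∧ (∀ i, s (i + 1) - s i ≤ N) ∧
      ∀ m n : ℕ, n < m → FKChain T α δ (s m - s n) (fun t => x (s n + t)) }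

noncomputable def dTilde [MetricSpace X] (x y : ℕ → X) : ℝ :=
  ∑' i : ℕ, dist (x i) (y i) / 2 ^ i

/-- A bounded sequence of natural numbers is constant along an ultrafilter. -/
theorem Ultrafilter.exists_eventually_eq_of_le {ι : Type*} (f : Ultrafilter ι) {g : ι → ℕ} {n : ℕ}
    (hg : ∀ᶠ h in f, g h ≤ n) : ∃ c, ∀ᶠ h in f, g h = c := by
  have hmem : (⋃ c ∈ Set.Iic n, {h | g h = c}) ∈ f := by
    filter_upwards [hg] with h hh
    simpa using hh
  obtain ⟨c, -, hc⟩ := (Ultrafilter.finite_biUnion_mem_iff (Set.finite_Iic n)).1 hmem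
  exact ⟨c, hc⟩

/-- Being a chain of a fixed length is preserved by pointwise limits along an ultrafilter. -/
theorem FKChain.of_tendsto [MetricSpace X] {T : X → X} (hT : Continuous T) {α δ : ℝ} {n : ℕ}
    {ι : Type*} (f : Ultrafilter ι) {v : ι → ℕ → X} {x : ℕ → X}
    (hv : ∀ t, Tendsto (fun h => v h t) f (𝓝 (x t)))
    (hchain : ∀ᶠ h in f, FKChain T α δ n (v h)) : FKChain T α δ n x := by
  obtain ⟨k', hk'⟩ := hchain.choice
  obtain ⟨k, hk⟩ := f.exists_eventually_eq_of_le (hk'.mono fun h hh => hh.2.1)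
  have hchain' : ∀ᶠ h in f, ∃ i j : ℕ → ℕ, (1 - δ) * (n : ℝ) < (k : ℝ) ∧ k ≤ n ∧
      StrictMonoOn i (Set.Iio k) ∧ StrictMonoOn j (Set.Iio k) ∧
      (∀ t < k, i t < n ∧ j t < n) ∧
      (∀ t, t + 1 < k → dist (T^[j (t + 1) - j t] (v h (i t))) (v h (i (t + 1))) ≤ α) := by
    filter_upwards [hk', hk] with h ⟨h₁, h₂, i, j, h₃⟩ rfl
    exact ⟨i, j, h₁, h₂, h₃⟩
  obtain ⟨i', hi'⟩ := hchain'.choice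
  obtain ⟨j', hj'⟩ := hi'.choice
  have hi : ∀ t, ∃ c, t < k → ∀ᶠ h in f, i' h t = c := fun t => by
    by_cases ht : t < k
    · obtain ⟨c, hc⟩ := f.exists_eventually_eq_of_le (g := fun h => i' h t) (n := n)
        (hj'.mono fun h hh => (hh.2.2.2.2.1 t ht).1.le)
      exact ⟨c, fun _ => hc⟩
    · exact ⟨0, fun h => absurd h ht⟩
  have hj : ∀ t, ∃ c, t < k → ∀ᶠ h in f, j' h t = c := fun t => by
    by_cases ht : t < k
    · obtain ⟨c, hc⟩ := f.exists_eventually_eq_of_le (g := fun h => j' h t) (n := n)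
        (hj'.mono fun h hh => (hh.2.2.2.2.1 t ht).2.le)
      exact ⟨c, fun _ => hc⟩
    · exact ⟨0, fun h => absurd h ht⟩
  choose i hi using hi
  choose j hj using hj
  obtain ⟨_, hkδ, hkn, -⟩ := hj'.exists
  refine ⟨k, hkδ, hkn, i, j, fun a ha b hb hab => ?_, fun a ha b hb hab => ?_,
    fun t ht => ?_, fun t ht => ?_⟩
  · obtain ⟨h, hh, hia, hib⟩ := (hj'.and ((hi a ha).and (hi b hb))).exists
    exact hia ▸ hib ▸ hh.2.2.1 ha hb hab
  · obtain ⟨h, hh, hja, hjb⟩ := (hj'.and ((hj a ha).and (hj b hb))).exists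
    exact hja ▸ hjb ▸ hh.2.2.2.1 ha hb hab
  · obtain ⟨h, hh, hit, hjt⟩ := (hj'.and ((hi t ht).and (hj t ht))).exists
    exact hit ▸ hjt ▸ hh.2.2.2.2.1 t ht
  · have ht' : t < k := by omega
    refine le_of_tendsto ((((hT.iterate (j (t + 1) - j t)).tendsto _).comp (hv (i t))).dist
      (hv (i (t + 1)))) ?_
    filter_upwards [hj', hi t ht', hi _ ht, hj t ht', hj _ ht] with h hh h₁ h₂ h₃ h₄
    have := hh.2.2.2.2.2 t ht
    rwa [h₁, h₂, h₃, h₄] at this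

/-- Convergence with respect to `dTilde` implies pointwise convergence. -/
theorem tendsto_apply_of_tendsto_dTilde [MetricSpace X] [CompactSpace X] {ι : Type*}
    {l : Filter ι} {u : ι → ℕ → X} {x : ℕ → X}
    (hconv : Tendsto (fun h => dTilde (u h) x) l (𝓝 0)) (t : ℕ) :
    Tendsto (fun h => u h t) l (𝓝 (x t)) := by
  have hsum (y : ℕ → X) : Summable fun i => dist (y i) (x i) / 2 ^ i := by
    refine Summable.of_nonneg_of_le (fun i => by positivity) (fun i => ?_)
      (summable_geometric_two.mul_left (Metric.diam (Set.univ : Set X)))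
    rw [one_div, inv_pow, ← div_eq_mul_inv]
    gcongr
    exact Metric.dist_le_diam_of_mem isCompact_univ.isBounded (Set.mem_univ _) (Set.mem_univ _)
  rw [tendsto_iff_dist_tendsto_zero]
  refine squeeze_zero (fun _ => dist_nonneg) (fun h => ?_)
    (by simpa using hconv.const_mul (2 ^ t : ℝ))
  have hle : dist (u h t) (x t) / 2 ^ t ≤ dTilde (u h) x :=
    (hsum (u h)).le_tsum t fun i _ => by positivity
  rwa [div_le_iff₀' (by positivity)] at hle

/-- `FKPO T α δ N` is closed in `X^ℕ` with respect to the metric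
`d̃(x,y) = Σ_i d(x_i,y_i)/2^i` (stated via sequential closedness for `d̃`). -/
theorem FKPO_isClosed [MetricSpace X] [CompactSpace X] (T : X → X) (hT : Continuous T)
    (α δ : ℝ) (hα : 0 < α) (hδ : 0 < δ) (N : ℕ)
    (u : ℕ → ℕ → X) (x : ℕ → X)
    (hu : ∀ h, u h ∈ FKPO T α δ N)
    (hconv : Tendsto (fun h => dTilde (u h) x) atTop (nhds 0)) :
    x ∈ FKPO T α δ N := by
  choose s hs hs₀ hsN hchain using hu
  let f : Ultrafilter ℕ := Filter.hyperfilter ℕ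
  have hx (t : ℕ) : Tendsto (fun h => u h t) f (𝓝 (x t)) :=
    (tendsto_apply_of_tendsto_dTilde hconv t).mono_left Nat.hyperfilter_le_atTop
  have hbound (i h : ℕ) : s h i ≤ (i + 1) * N := by
    induction i with
    | zero => simpa using hs₀ h
    | succ i ih =>
      have := hsN h i
      rw [add_mul (i + 1), one_mul]
      omega
  choose S hS using fun i =>
    f.exists_eventually_eq_of_le (g := fun h => s h i) (Eventually.of_forall (hbound i))
  refine ⟨S, strictMono_nat_of_lt_succ fun i => ?_, ?_, fun i => ?_, fun m n hnm => ?_⟩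
  · obtain ⟨h, h₁, h₂⟩ := ((hS i).and (hS (i + 1))).exists
    exact h₁ ▸ h₂ ▸ hs h i.lt_succ_self
  · obtain ⟨h, h₁⟩ := (hS 0).exists
    exact h₁ ▸ hs₀ h
  · obtain ⟨h, h₁, h₂⟩ := ((hS i).and (hS (i + 1))).exists
    exact h₁ ▸ h₂ ▸ hsN h i
  · refine FKChain.of_tendsto hT f (v := fun h t => u h (S n + t)) (fun t => hx _) ?_
    filter_upwards [hS m, hS n] with h h₁ h₂
    have := hchain h m n hnm
    rwa [h₁, h₂] at this
end

section
/- Let (X,d) be a compact metric space, T : X → X a continuous map, α, δ > 0 and N_δ ∈ ℕ. Then the set FKPO_{α,δ}(X,T,N_δ) of FK-α-pseudo-orbits of density 1−δ controlled by N_δ is invariant under the shift map σ on X^ℕ, i.e., σ(FKPO_{α,δ}(X,T,N_δ)) ⊆ FKPO_{α,δ}(X,T,N_δ). -/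
open Filter Metric Set Topology

variable {X : Type*}

/-- `FKPO T α δ N` is invariant under the shift map `σ(x)_i = x_{i+1}`. -/
theorem FKPO_shift_invariant [MetricSpace X] [CompactSpace X] (T : X → X)
    (hT : Continuous T) (α δ : ℝ) (hα : 0 < α) (hδ : 0 < δ) (N : ℕ) :
    (fun x : ℕ → X => fun i => x (i + 1)) '' FKPO T α δ N ⊆ FKPO T α δ N := by
  rintro _ ⟨x, ⟨s, hs, hs0, hgap, hchain⟩, rfl⟩
  obtain ⟨c, hc, hcN⟩ : ∃ c, 1 ≤ s c ∧ s c ≤ N + 1 := by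
    rcases Nat.eq_zero_or_pos (s 0) with h | h
    · have h1 := hs (Nat.zero_lt_one)
      have h2 := hgap 0
      exact ⟨1, by omega, by simp only [zero_add] at h2; omega⟩
    · exact ⟨0, h, by omega⟩
  have hpos : ∀ i, 1 ≤ s (i + c) := fun i => hc.trans (hs.monotone (Nat.le_add_left c i))
  refine ⟨fun i => s (i + c) - 1, fun a b hab => ?_, ?_, fun i => ?_, fun m n hmn => ?_⟩
  · have h1 := hs (Nat.add_lt_add_right hab c)
    have h2 := hpos a
    change s (a + c) - 1 < s (b + c) - 1
    omega
  · simp only [zero_add]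
    omega
  · have h1 := hgap (i + c)
    have h2 := hpos i
    rw [show i + c + 1 = i + 1 + c by ring] at h1
    change s (i + 1 + c) - 1 - (s (i + c) - 1) ≤ N
    omega
  · have h1 := hpos n
    convert hchain (m + c) (n + c) (Nat.add_lt_add_right hmn c) using 1
    · have h2 := hpos m
      dsimp only
      omega
    · funext t
      exact congrArg x (by dsimp only; omega)
end

section
/- Let (X,d) be a compact metric space, T : X → X a continuous map, f : X → ℝ continuous, and fix a family {N_δ : δ > 0} ⊂ ℕ. Then PFKPO(X,T,f) = lim_{ε→0} limsup_{δ→0} inf_{α>0} limsup_{n→∞} (1/n) log FKPOsr_{n,ε;α,δ}(f); that is, the topological pressure with respect to Feldman-Katok pseudo-orbits defined via spanning sets coincides with the corresponding quantity defined via separated sets. -/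
open Filter Metric Set Topology

variable {X : Type*}

noncomputable def FKPOsp [MetricSpace X] (T : X → X) (f : X → ℝ) (n : ℕ) (ε α δ : ℝ)
    (N : ℕ) : ℝ :=
  sInf { r : ℝ | ∃ F : Finset (ℕ → X), ↑F ⊆ FKPO T α δ N ∧
      (∀ x ∈ FKPO T α δ N, ∃ y ∈ F, ∀ i < n, dist (x i) (y i) < ε) ∧
      r = ∑ y ∈ F, Real.exp (∑ i ∈ Finset.range n, f (y i)) }

noncomputable def FKPOsr [MetricSpace X] (T : X → X) (f : X → ℝ) (n : ℕ) (ε α δ : ℝ)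
    (N : ℕ) : ℝ :=
  sSup { r : ℝ | ∃ E : Finset (ℕ → X), ↑E ⊆ FKPO T α δ N ∧
      (∀ x ∈ E, ∀ y ∈ E, x ≠ y → ∃ i < n, ε < dist (x i) (y i)) ∧
      r = ∑ x ∈ E, Real.exp (∑ i ∈ Finset.range n, f (x i)) }

noncomputable def PFKPO [MetricSpace X] (T : X → X) (f : X → ℝ) (N : ℝ → ℕ) : ℝ :=
  limsup (fun ε : ℝ =>
      limsup (fun δ : ℝ =>
          sInf { r : ℝ | ∃ α : ℝ, 0 < α ∧
              r = limsup (fun n : ℕ => Real.log (FKPOsp T f n ε α δ (N δ)) / n) atTop })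
        (nhdsWithin 0 (Set.Ioi 0)))
    (nhdsWithin 0 (Set.Ioi 0))

/-- `E` is a finite `(n, ε)`-separated subset of `S`. -/
def IsSeparatedIn [MetricSpace X] (S : Set (ℕ → X)) (n : ℕ) (ε : ℝ) (E : Finset (ℕ → X)) : Prop :=
  ↑E ⊆ S ∧ ∀ x ∈ E, ∀ y ∈ E, x ≠ y → ∃ i < n, ε < dist (x i) (y i)

/-- `F` is a finite `(n, ε)`-spanning subset of `S`. -/
def IsSpanningIn [MetricSpace X] (S : Set (ℕ → X)) (n : ℕ) (ε : ℝ) (F : Finset (ℕ → X)) : Prop :=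
  ↑F ⊆ S ∧ ∀ x ∈ S, ∃ y ∈ F, ∀ i < n, dist (x i) (y i) < ε

/-- The partition sum of `f` over a finite set of sequences. -/
noncomputable def partitionSum (f : X → ℝ) (n : ℕ) (E : Finset (ℕ → X)) : ℝ :=
  ∑ x ∈ E, Real.exp (∑ i ∈ Finset.range n, f (x i))

/-- The infimum of partition sums over finite spanning sets. -/
noncomputable def spanSum [MetricSpace X] (S : Set (ℕ → X)) (f : X → ℝ) (n : ℕ) (ε : ℝ) : ℝ :=
  sInf {r | ∃ F, IsSpanningIn S n ε F ∧ r = partitionSum f n F}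

/-- The supremum of partition sums over finite separated sets. -/
noncomputable def sepSum [MetricSpace X] (S : Set (ℕ → X)) (f : X → ℝ) (n : ℕ) (ε : ℝ) : ℝ :=
  sSup {r | ∃ E, IsSeparatedIn S n ε E ∧ r = partitionSum f n E}

theorem FKPOsp_eq_spanSum [MetricSpace X] (T : X → X) (f : X → ℝ) (n : ℕ) (ε α δ : ℝ) (N : ℕ) :
    FKPOsp T f n ε α δ N = spanSum (FKPO T α δ N) f n ε := by
  simp only [FKPOsp, spanSum, IsSpanningIn, partitionSum, and_assoc]

theorem FKPOsr_eq_sepSum [MetricSpace X] (T : X → X) (f : X → ℝ) (n : ℕ) (ε α δ : ℝ) (N : ℕ) :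
    FKPOsr T f n ε α δ N = sepSum (FKPO T α δ N) f n ε := by
  simp only [FKPOsr, sepSum, IsSeparatedIn, partitionSum, and_assoc]

theorem partitionSum_nonneg (f : X → ℝ) (n : ℕ) (E : Finset (ℕ → X)) :
    0 ≤ partitionSum f n E :=
  Finset.sum_nonneg fun _ _ => (Real.exp_pos _).le

theorem spanSum_empty [MetricSpace X] (f : X → ℝ) (n : ℕ) (ε : ℝ) :
    spanSum (∅ : Set (ℕ → X)) f n ε = 0 := by
  have : {r | ∃ F, IsSpanningIn (∅ : Set (ℕ → X)) n ε F ∧ r = partitionSum f n F} = {0} := by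
    ext r
    simp [IsSpanningIn, partitionSum, Set.subset_empty_iff]
  simp [spanSum, this]

theorem sepSum_empty [MetricSpace X] (f : X → ℝ) (n : ℕ) (ε : ℝ) :
    sepSum (∅ : Set (ℕ → X)) f n ε = 0 := by
  have : {r | ∃ E, IsSeparatedIn (∅ : Set (ℕ → X)) n ε E ∧ r = partitionSum f n E} = {0} := by
    ext r
    constructor
    · rintro ⟨E, ⟨hE, -⟩, rfl⟩
      simp only [Set.subset_empty_iff, Finset.coe_eq_empty] at hE
      simp [hE, partitionSum]
    · rintro rfl
      exact ⟨∅, by simp [IsSeparatedIn], by simp [partitionSum]⟩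
  simp [sepSum, this]

theorem exists_card_separated_le [MetricSpace X] [CompactSpace X] {ε : ℝ} (hε : 0 < ε) :
    ∃ M : ℕ, ∀ (S : Set (ℕ → X)) (n : ℕ) (E : Finset (ℕ → X)),
      IsSeparatedIn S n ε E → E.card ≤ M ^ n := by
  obtain ⟨t, -, htf, ht⟩ :=
    Metric.finite_approx_of_totallyBounded (isCompact_univ (X := X)).totallyBounded (ε / 2)
      (half_pos hε)
  have hc : ∀ x : X, ∃ y : htf.toFinset, dist x y < ε / 2 := fun x => by
    obtain ⟨y, hy, hxy⟩ := Set.mem_iUnion₂.1 (ht (Set.mem_univ x))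
    exact ⟨⟨y, by simpa using hy⟩, hxy⟩
  choose c hc using hc
  refine ⟨htf.toFinset.card, fun S n E hE => ?_⟩
  have hinj : Set.InjOn (fun (x : ℕ → X) (i : Fin n) => c (x i)) E := by
    intro x hx y hy hxy
    by_contra hne
    obtain ⟨i, hi, hd⟩ := hE.2 x hx y hy hne
    have hi' : c (x i) = c (y i) := congrFun hxy ⟨i, hi⟩
    have h1 := hc (x i)
    have h2 := hc (y i)
    rw [← hi', dist_comm] at h2
    linarith [dist_triangle (x i) (c (x i)) (y i)]
  calc E.card ≤ (Finset.univ : Finset (Fin n → htf.toFinset)).card :=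
        Finset.card_le_card_of_injOn _ (fun _ _ => Finset.mem_coe.2 (Finset.mem_univ _)) hinj
    _ = htf.toFinset.card ^ n := by simp

theorem partitionSum_le {f : X → ℝ} {B : ℝ} (hB : ∀ x, |f x| ≤ B) (n : ℕ)
    (E : Finset (ℕ → X)) : partitionSum f n E ≤ E.card * Real.exp (n * B) := by
  rw [← nsmul_eq_mul]
  refine Finset.sum_le_card_nsmul _ _ _ fun x _ => Real.exp_le_exp.2 ?_
  calc ∑ i ∈ Finset.range n, f (x i) ≤ ∑ _i ∈ Finset.range n, B :=
        Finset.sum_le_sum fun i _ => (le_abs_self _).trans (hB _)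
    _ = n * B := by simp

theorem exp_neg_le_partitionSum {f : X → ℝ} {B : ℝ} (hB : ∀ x, |f x| ≤ B) (n : ℕ)
    {E : Finset (ℕ → X)} (hE : E.Nonempty) : Real.exp (-(n * B)) ≤ partitionSum f n E := by
  obtain ⟨x, hx⟩ := hE
  refine le_trans (Real.exp_le_exp.2 ?_)
    (Finset.single_le_sum (f := fun x : ℕ → X => Real.exp (∑ i ∈ Finset.range n, f (x i)))
      (fun _ _ => (Real.exp_pos _).le) hx)
  calc -(n * B) = ∑ _i ∈ Finset.range n, -B := by simp
    _ ≤ ∑ i ∈ Finset.range n, f (x i) := Finset.sum_le_sum fun i _ => (abs_le.1 (hB _)).1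

theorem exists_separated_spanning [MetricSpace X] [CompactSpace X] (S : Set (ℕ → X)) (n : ℕ)
    {ε ε' : ℝ} (hε : 0 < ε) (h : ε < ε') :
    ∃ E, IsSeparatedIn S n ε E ∧ IsSpanningIn S n ε' E := by
  classical
  obtain ⟨M, hM⟩ := exists_card_separated_le (X := X) hε
  have hne : {k | ∃ E, IsSeparatedIn S n ε E ∧ E.card = k}.Nonempty :=
    ⟨0, ∅, by simp [IsSeparatedIn], by simp⟩
  have hbdd : BddAbove {k | ∃ E, IsSeparatedIn S n ε E ∧ E.card = k} :=
    ⟨M ^ n, by rintro _ ⟨E, hE, rfl⟩; exact hM S n E hE⟩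
  obtain ⟨E, hE, hcard⟩ := Nat.sSup_mem hne hbdd
  refine ⟨E, hE, hE.1, fun x hx => ?_⟩
  by_contra! hcon
  have hfar : ∀ y ∈ E, ∃ i < n, ε < dist (x i) (y i) := fun y hy => by
    obtain ⟨i, hi, hd⟩ := hcon y hy
    exact ⟨i, hi, h.trans_le hd⟩
  have hxE : x ∉ E := fun hxE => by
    obtain ⟨i, -, hd⟩ := hfar x hxE
    rw [dist_self] at hd
    exact lt_asymm hε hd
  have hins : IsSeparatedIn S n ε (insert x E) := by
    refine ⟨by rw [Finset.coe_insert]; exact Set.insert_subset hx hE.1, fun y hy z hz hyz => ?_⟩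
    rcases Finset.mem_insert.1 hy with rfl | hyE
    · rcases Finset.mem_insert.1 hz with rfl | hzE
      · exact absurd rfl hyz
      · exact hfar z hzE
    · rcases Finset.mem_insert.1 hz with rfl | hzE
      · simpa only [dist_comm] using hfar y hyE
      · exact hE.2 y hyE z hzE hyz
  have hle := le_csSup hbdd ⟨_, hins, rfl⟩
  rw [← hcard, Finset.card_insert_of_notMem hxE] at hle
  omega

theorem bddAbove_sep [MetricSpace X] [CompactSpace X] (S : Set (ℕ → X)) {f : X → ℝ} {B : ℝ}
    (hB : ∀ x, |f x| ≤ B) (n : ℕ) {ε : ℝ} (hε : 0 < ε) :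
    BddAbove {r | ∃ E, IsSeparatedIn S n ε E ∧ r = partitionSum f n E} := by
  obtain ⟨M, hM⟩ := exists_card_separated_le (X := X) hε
  refine ⟨(M ^ n : ℕ) * Real.exp (n * B), ?_⟩
  rintro _ ⟨E, hE, rfl⟩
  refine (partitionSum_le hB n E).trans ?_
  gcongr
  exact hM S n E hE

theorem spanSum_le [MetricSpace X] {S : Set (ℕ → X)} (f : X → ℝ) {n : ℕ} {ε : ℝ}
    {F : Finset (ℕ → X)} (hF : IsSpanningIn S n ε F) : spanSum S f n ε ≤ partitionSum f n F :=
  csInf_le ⟨0, by rintro _ ⟨F, -, rfl⟩; exact partitionSum_nonneg f n F⟩ ⟨F, hF, rfl⟩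

theorem spanSum_le_sepSum [MetricSpace X] [CompactSpace X] (S : Set (ℕ → X)) {f : X → ℝ} {B : ℝ}
    (hB : ∀ x, |f x| ≤ B) (n : ℕ) {ε ε' : ℝ} (hε : 0 < ε) (h : ε < ε') :
    spanSum S f n ε' ≤ sepSum S f n ε := by
  obtain ⟨E, hsep, hspan⟩ := exists_separated_spanning S n hε h
  exact (spanSum_le f hspan).trans (le_csSup (bddAbove_sep S hB n hε) ⟨E, hsep, rfl⟩)

theorem nonempty_span [MetricSpace X] [CompactSpace X] (S : Set (ℕ → X)) (f : X → ℝ)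
    (n : ℕ) {ε : ℝ} (hε : 0 < ε) :
    {r | ∃ F, IsSpanningIn S n ε F ∧ r = partitionSum f n F}.Nonempty := by
  obtain ⟨E, -, hspan⟩ := exists_separated_spanning S n (half_pos hε) (half_lt_self hε)
  exact ⟨_, E, hspan, rfl⟩

theorem exp_neg_le_spanSum [MetricSpace X] [CompactSpace X] {S : Set (ℕ → X)} (hS : S.Nonempty)
    {f : X → ℝ} {B : ℝ} (hB : ∀ x, |f x| ≤ B) (n : ℕ) {ε : ℝ} (hε : 0 < ε) :
    Real.exp (-(n * B)) ≤ spanSum S f n ε := by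
  refine le_csInf (nonempty_span S f n hε) ?_
  rintro _ ⟨F, hF, rfl⟩
  obtain ⟨x, hx⟩ := hS
  obtain ⟨y, hy, -⟩ := hF.2 x hx
  exact exp_neg_le_partitionSum hB n ⟨y, hy⟩

theorem partitionSum_sep_le_span [MetricSpace X] {S : Set (ℕ → X)} {f : X → ℝ} {n : ℕ} {ε γ : ℝ}
    (hγ : ∀ x y, dist x y < ε / 2 → |f x - f y| ≤ γ) {E F : Finset (ℕ → X)}
    (hE : IsSeparatedIn S n ε E) (hF : IsSpanningIn S n (ε / 2) F) :
    partitionSum f n E ≤ Real.exp (n * γ) * partitionSum f n F := by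
  classical
  choose! p hpF hp using hF.2
  have hinj : Set.InjOn p E := by
    intro x hx y hy hxy
    by_contra hne
    obtain ⟨i, hi, hd⟩ := hE.2 x hx y hy hne
    have h1 := hp x (hE.1 hx) i hi
    have h2 := hp y (hE.1 hy) i hi
    rw [← hxy, dist_comm] at h2
    linarith [dist_triangle (x i) (p x i) (y i)]
  calc partitionSum f n E
      ≤ ∑ x ∈ E, Real.exp (n * γ) * Real.exp (∑ i ∈ Finset.range n, f (p x i)) := by
        refine Finset.sum_le_sum fun x hx => ?_
        rw [← Real.exp_add, Real.exp_le_exp]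
        calc ∑ i ∈ Finset.range n, f (x i) ≤ ∑ i ∈ Finset.range n, (γ + f (p x i)) := by
              refine Finset.sum_le_sum fun i hi => ?_
              have := (abs_le.1 (hγ _ _ (hp x (hE.1 hx) i (Finset.mem_range.1 hi)))).2
              linarith
          _ = n * γ + ∑ i ∈ Finset.range n, f (p x i) := by simp [Finset.sum_add_distrib]
    _ = Real.exp (n * γ) * partitionSum f n (E.image p) := by
        rw [← Finset.mul_sum, partitionSum, Finset.sum_image hinj]
    _ ≤ Real.exp (n * γ) * partitionSum f n F := by
        refine mul_le_mul_of_nonneg_left ?_ (Real.exp_pos _).le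
        refine Finset.sum_le_sum_of_subset_of_nonneg ?_ fun _ _ _ => (Real.exp_pos _).le
        exact Finset.image_subset_iff.2 fun x hx => hpF x (hE.1 hx)

theorem sepSum_le_spanSum [MetricSpace X] [CompactSpace X] (S : Set (ℕ → X)) {f : X → ℝ} (n : ℕ)
    {ε γ : ℝ} (hε : 0 < ε) (hγ : ∀ x y, dist x y < ε / 2 → |f x - f y| ≤ γ) :
    sepSum S f n ε ≤ Real.exp (n * γ) * spanSum S f n (ε / 2) := by
  refine csSup_le ⟨_, ∅, by simp [IsSeparatedIn], rfl⟩ ?_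
  rintro _ ⟨E, hE, rfl⟩
  rw [← div_le_iff₀' (Real.exp_pos _)]
  refine le_csInf (nonempty_span S f n (half_pos hε)) ?_
  rintro _ ⟨F, hF, rfl⟩
  rw [div_le_iff₀' (Real.exp_pos _)]
  exact partitionSum_sep_le_span hγ hE hF

theorem log_spanSum_div_le [MetricSpace X] [CompactSpace X] (S : Set (ℕ → X)) {f : X → ℝ} {B : ℝ}
    (hB : ∀ x, |f x| ≤ B) (n : ℕ) {ε ε' : ℝ} (hε : 0 < ε) (h : ε < ε') :
    Real.log (spanSum S f n ε') / n ≤ Real.log (sepSum S f n ε) / n := by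
  rcases S.eq_empty_or_nonempty with rfl | hS
  · rw [spanSum_empty, sepSum_empty]
  · have h0 := (Real.exp_pos _).trans_le (exp_neg_le_spanSum hS hB n (hε.trans h))
    have := Real.log_le_log h0 (spanSum_le_sepSum S hB n hε h)
    gcongr

theorem log_sepSum_div_le [MetricSpace X] [CompactSpace X] (S : Set (ℕ → X)) {f : X → ℝ} {B : ℝ}
    (hB : ∀ x, |f x| ≤ B) (n : ℕ) {ε γ : ℝ} (hε : 0 < ε) (hγ0 : 0 ≤ γ)
    (hγ : ∀ x y, dist x y < ε / 2 → |f x - f y| ≤ γ) :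
    Real.log (sepSum S f n ε) / n ≤ Real.log (spanSum S f n (ε / 2)) / n + γ := by
  rcases S.eq_empty_or_nonempty with rfl | hS
  · simpa [spanSum_empty, sepSum_empty] using hγ0
  rcases n.eq_zero_or_pos with rfl | hn
  · simpa using hγ0
  have hspan := (Real.exp_pos _).trans_le (exp_neg_le_spanSum hS hB n (half_pos hε))
  have hsep : 0 < sepSum S f n ε :=
    ((Real.exp_pos _).trans_le (exp_neg_le_spanSum hS hB n (hε.trans (lt_add_one ε)))).trans_le
      (spanSum_le_sepSum S hB n hε (lt_add_one ε))
  have hlog := Real.log_le_log hsep (sepSum_le_spanSum S n hε hγ)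
  rw [Real.log_mul (Real.exp_pos _).ne' hspan.ne', Real.log_exp] at hlog
  have hn' : (0 : ℝ) < n := by exact_mod_cast hn
  rw [div_add' _ _ _ hn'.ne']
  gcongr
  linarith

theorem neg_le_log_spanSum_div [MetricSpace X] [CompactSpace X] (S : Set (ℕ → X)) {f : X → ℝ}
    {B : ℝ} (hB0 : 0 ≤ B) (hB : ∀ x, |f x| ≤ B) (n : ℕ) {ε : ℝ} (hε : 0 < ε) :
    -B ≤ Real.log (spanSum S f n ε) / n := by
  rcases S.eq_empty_or_nonempty with rfl | hS
  · simpa [spanSum_empty] using hB0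
  rcases n.eq_zero_or_pos with rfl | hn
  · simpa using hB0
  have hn' : (0 : ℝ) < n := by exact_mod_cast hn
  have := Real.log_le_log (Real.exp_pos _) (exp_neg_le_spanSum hS hB n hε)
  rw [Real.log_exp] at this
  rw [le_div_iff₀ hn']
  linarith

theorem exists_log_sepSum_div_le [MetricSpace X] [CompactSpace X] {f : X → ℝ}
    {B : ℝ} (hB0 : 0 ≤ B) (hB : ∀ x, |f x| ≤ B) {ε : ℝ} (hε : 0 < ε) :
    ∃ C, ∀ (S : Set (ℕ → X)) (n : ℕ), Real.log (sepSum S f n ε) / n ≤ C := by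
  obtain ⟨M, hM⟩ := exists_card_separated_le (X := X) hε
  refine ⟨Real.log (M + 1 : ℕ) + B, fun S n => ?_⟩
  have hC : 0 ≤ Real.log (M + 1 : ℕ) + B := add_nonneg (Real.log_natCast_nonneg _) hB0
  rcases S.eq_empty_or_nonempty with rfl | hS
  · simpa [sepSum_empty] using hC
  rcases n.eq_zero_or_pos with rfl | hn
  · simpa using hC
  have hn' : (0 : ℝ) < n := by exact_mod_cast hn
  have hsep : 0 < sepSum S f n ε :=
    ((Real.exp_pos _).trans_le (exp_neg_le_spanSum hS hB n (hε.trans (lt_add_one ε)))).trans_le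
      (spanSum_le_sepSum S hB n hε (lt_add_one ε))
  have hle : sepSum S f n ε ≤ ((M + 1 : ℕ) : ℝ) ^ n * Real.exp (n * B) := by
    refine csSup_le ⟨_, ∅, by simp [IsSeparatedIn], rfl⟩ ?_
    rintro _ ⟨E, hE, rfl⟩
    refine (partitionSum_le hB n E).trans ?_
    gcongr
    exact_mod_cast (hM S n E hE).trans (Nat.pow_le_pow_left (Nat.le_succ M) n)
  have hlog := Real.log_le_log hsep hle
  rw [Real.log_mul (by positivity) (Real.exp_pos _).ne', Real.log_exp, Real.log_pow] at hlog
  rw [div_le_iff₀ hn']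
  linarith

theorem limsup_mem_Icc_of_forall {ι : Type*} {l : Filter ι} [l.NeBot] {u : ι → ℝ} {a b : ℝ}
    (h : ∀ i, u i ∈ Set.Icc a b) : limsup u l ∈ Set.Icc a b := by
  have hb : l.IsBoundedUnder (· ≤ ·) u := isBoundedUnder_of ⟨b, fun i => (h i).2⟩
  have ha : l.IsBoundedUnder (· ≥ ·) u := isBoundedUnder_of ⟨a, fun i => (h i).1⟩
  exact ⟨le_limsup_of_frequently_le (Frequently.of_forall fun i => (h i).1) hb,
    limsup_le_of_le ha.isCoboundedUnder_le (Eventually.of_forall fun i => (h i).2)⟩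

theorem limsup_le_limsup_add_of_forall {ι : Type*} {l : Filter ι} [l.NeBot] {u v : ι → ℝ}
    {a b a' b' c : ℝ} (hu : ∀ i, u i ∈ Set.Icc a b) (hv : ∀ i, v i ∈ Set.Icc a' b')
    (h : ∀ i, u i ≤ v i + c) : limsup u l ≤ limsup v l + c := by
  have hva : l.IsBoundedUnder (· ≥ ·) v := isBoundedUnder_of ⟨a', fun i => (hv i).1⟩
  have hvb : l.IsBoundedUnder (· ≤ ·) v := isBoundedUnder_of ⟨b', fun i => (hv i).2⟩
  have hua : l.IsBoundedUnder (· ≥ ·) u := isBoundedUnder_of ⟨a, fun i => (hu i).1⟩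
  rw [← limsup_add_const l v c hvb hva.isCoboundedUnder_le]
  refine limsup_le_limsup (Eventually.of_forall h) hua.isCoboundedUnder_le ?_
  exact isBoundedUnder_of ⟨b' + c, fun i => by linarith [(hv i).2]⟩

theorem sInf_pos_mem_Icc {u : ℝ → ℝ} {a b : ℝ} (h : ∀ α, u α ∈ Set.Icc a b) :
    sInf {r | ∃ α : ℝ, 0 < α ∧ r = u α} ∈ Set.Icc a b := by
  constructor
  · refine le_csInf ⟨_, 1, one_pos, rfl⟩ ?_
    rintro _ ⟨α, -, rfl⟩
    exact (h α).1
  · have hbdd : BddBelow {r | ∃ α : ℝ, 0 < α ∧ r = u α} :=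
      ⟨a, by rintro _ ⟨α, -, rfl⟩; exact (h α).1⟩
    exact (csInf_le hbdd ⟨1, one_pos, rfl⟩).trans (h 1).2

theorem sInf_pos_le_add {u v : ℝ → ℝ} {a b c : ℝ} (hu : ∀ α, u α ∈ Set.Icc a b)
    (h : ∀ α, u α ≤ v α + c) :
    sInf {r | ∃ α : ℝ, 0 < α ∧ r = u α} ≤ sInf {r | ∃ α : ℝ, 0 < α ∧ r = v α} + c := by
  have hbdd : BddBelow {r | ∃ α : ℝ, 0 < α ∧ r = u α} :=
    ⟨a, by rintro _ ⟨α, -, rfl⟩; exact (hu α).1⟩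
  rw [← sub_le_iff_le_add]
  refine le_csInf ⟨_, 1, one_pos, rfl⟩ ?_
  rintro _ ⟨α, hα, rfl⟩
  rw [sub_le_iff_le_add]
  exact (csInf_le hbdd ⟨α, hα, rfl⟩).trans (h α)

/-- The iterated limit in `n`, `α` and `δ` of a family of growth rates. -/
noncomputable def iteratedRate (u : ℝ → ℝ → ℕ → ℝ) : ℝ :=
  limsup (fun δ : ℝ => sInf {r : ℝ | ∃ α : ℝ, 0 < α ∧ r = limsup (fun n => u δ α n) atTop})
    (nhdsWithin 0 (Set.Ioi 0))

theorem iteratedRate_mem_Icc {u : ℝ → ℝ → ℕ → ℝ} {a b : ℝ} (h : ∀ δ α n, u δ α n ∈ Set.Icc a b) :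
    iteratedRate u ∈ Set.Icc a b :=
  limsup_mem_Icc_of_forall fun δ => sInf_pos_mem_Icc fun α => limsup_mem_Icc_of_forall (h δ α)

theorem iteratedRate_le_add {u v : ℝ → ℝ → ℕ → ℝ} {a b a' b' c : ℝ}
    (hu : ∀ δ α n, u δ α n ∈ Set.Icc a b) (hv : ∀ δ α n, v δ α n ∈ Set.Icc a' b')
    (h : ∀ δ α n, u δ α n ≤ v δ α n + c) : iteratedRate u ≤ iteratedRate v + c :=
  limsup_le_limsup_add_of_forall
    (fun δ => sInf_pos_mem_Icc fun α => limsup_mem_Icc_of_forall (hu δ α))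
    (fun δ => sInf_pos_mem_Icc fun α => limsup_mem_Icc_of_forall (hv δ α))
    (fun δ => sInf_pos_le_add (fun α => limsup_mem_Icc_of_forall (hu δ α))
      fun α => limsup_le_limsup_add_of_forall (hu δ α) (hv δ α) (h δ α))

/-- Two functions that dominate each other up to rescaling the argument and a vanishing error have
the same (real-valued) upper limit at `0⁺`, including when that upper limit is infinite. -/
theorem limsup_nhdsGT_zero_eq {P Q : ℝ → ℝ} {b : ℝ} (hPb : ∀ ε > 0, b ≤ P ε)
    (hQb : ∀ ε > 0, b ≤ Q ε) (hPQ : ∀ ε > 0, P ε ≤ Q (ε / 2))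
    (hQP : ∀ η > 0, ∀ᶠ ε in nhdsWithin (0 : ℝ) (Set.Ioi 0), Q ε ≤ P (ε / 2) + η) :
    limsup P (nhdsWithin 0 (Set.Ioi 0)) = limsup Q (nhdsWithin 0 (Set.Ioi 0)) := by
  have hhalf : Tendsto (fun ε : ℝ => ε / 2) (nhdsWithin 0 (Set.Ioi 0))
      (nhdsWithin 0 (Set.Ioi 0)) := by
    refine tendsto_nhdsWithin_iff.2 ⟨?_, ?_⟩
    · exact ((continuous_id.div_const (2 : ℝ)).tendsto' 0 0 (by simp)).mono_left nhdsWithin_le_nhds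
    · filter_upwards [self_mem_nhdsWithin] with ε hε using half_pos (Set.mem_Ioi.1 hε)
  have bdd : ∀ R : ℝ → ℝ, (∀ ε > 0, b ≤ R ε) →
      BddBelow {a | ∀ᶠ ε in nhdsWithin (0 : ℝ) (Set.Ioi 0), R ε ≤ a} := by
    refine fun R hR => ⟨b, fun a ha => ?_⟩
    have ha' : ∀ᶠ ε in nhdsWithin (0 : ℝ) (Set.Ioi 0), R ε ≤ a := ha
    obtain ⟨ε, h1, h2⟩ := (ha'.and self_mem_nhdsWithin).exists
    exact (hR ε h2).trans h1
  have hsub : {a | ∀ᶠ ε in nhdsWithin (0 : ℝ) (Set.Ioi 0), Q ε ≤ a} ⊆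
      {a | ∀ᶠ ε in nhdsWithin (0 : ℝ) (Set.Ioi 0), P ε ≤ a} := by
    intro a ha
    filter_upwards [hhalf.eventually ha, self_mem_nhdsWithin] with ε h1 h2
    exact (hPQ ε h2).trans h1
  have hadd : ∀ a ∈ {a | ∀ᶠ ε in nhdsWithin (0 : ℝ) (Set.Ioi 0), P ε ≤ a}, ∀ η > 0,
      a + η ∈ {a | ∀ᶠ ε in nhdsWithin (0 : ℝ) (Set.Ioi 0), Q ε ≤ a} := by
    intro a ha η hη
    filter_upwards [hhalf.eventually ha, hQP η hη] with ε h1 h2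
    linarith
  rw [limsup_eq, limsup_eq]
  rcases Set.eq_empty_or_nonempty {a | ∀ᶠ ε in nhdsWithin (0 : ℝ) (Set.Ioi 0), P ε ≤ a} with h | h
  · rw [Set.subset_empty_iff.1 (hsub.trans h.subset), h]
  · have hQne : {a | ∀ᶠ ε in nhdsWithin (0 : ℝ) (Set.Ioi 0), Q ε ≤ a}.Nonempty :=
      h.elim fun a ha => ⟨_, hadd a ha 1 one_pos⟩
    refine le_antisymm (csInf_le_csInf (bdd P hPb) hQne hsub) ?_
    refine le_csInf h fun a ha => le_of_forall_pos_le_add fun η hη => ?_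
    exact csInf_le (bdd Q hQb) (hadd a ha η hη)

/-- the FK-pseudo-orbit pressure defined via spanning sets coincides with
the corresponding quantity defined via separated sets. -/
theorem PFKPO_eq_separated_version [MetricSpace X] [CompactSpace X] (T : X → X)
    (hT : Continuous T) (f : X → ℝ) (hf : Continuous f) (N : ℝ → ℕ) :
    PFKPO T f N =
      limsup (fun ε : ℝ =>
          limsup (fun δ : ℝ =>
              sInf { r : ℝ | ∃ α : ℝ, 0 < α ∧
                  r = limsup (fun n : ℕ =>
                        Real.log (FKPOsr T f n ε α δ (N δ)) / n) atTop })
            (nhdsWithin 0 (Set.Ioi 0)))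
        (nhdsWithin 0 (Set.Ioi 0)) := by
  obtain ⟨B, hB0, hB⟩ : ∃ B, 0 ≤ B ∧ ∀ x, |f x| ≤ B := by
    obtain ⟨B, hB⟩ := isCompact_univ.exists_bound_of_continuousOn (f := f) hf.continuousOn
    exact ⟨max B 0, le_max_right _ _, fun x => (hB x (Set.mem_univ x)).trans (le_max_left _ _)⟩
  have hsep : ∀ ε > 0, ∃ C, ∀ δ α n,
      Real.log (sepSum (FKPO T α δ (N δ)) f n ε) / n ∈ Set.Icc (-B) C := fun ε hε => by
    obtain ⟨C, hC⟩ := exists_log_sepSum_div_le hB0 hB hε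
    exact ⟨C, fun δ α n => ⟨(neg_le_log_spanSum_div _ hB0 hB n (hε.trans (lt_add_one ε))).trans
      (log_spanSum_div_le _ hB n hε (lt_add_one ε)), hC _ n⟩⟩
  have hspan : ∀ ε > 0, ∃ C, ∀ δ α n,
      Real.log (spanSum (FKPO T α δ (N δ)) f n ε) / n ∈ Set.Icc (-B) C := fun ε hε => by
    obtain ⟨C, hC⟩ := hsep (ε / 2) (half_pos hε)
    exact ⟨C, fun δ α n => ⟨neg_le_log_spanSum_div _ hB0 hB n hε,
      (log_spanSum_div_le _ hB n (half_pos hε) (half_lt_self hε)).trans (hC δ α n).2⟩⟩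
  simp only [PFKPO, FKPOsp_eq_spanSum, FKPOsr_eq_sepSum]
  refine limsup_nhdsGT_zero_eq
    (P := fun ε => iteratedRate fun δ α n => Real.log (spanSum (FKPO T α δ (N δ)) f n ε) / n)
    (Q := fun ε => iteratedRate fun δ α n => Real.log (sepSum (FKPO T α δ (N δ)) f n ε) / n)
    (b := -B) (fun ε hε => ?_) (fun ε hε => ?_) (fun ε hε => ?_) (fun η hη => ?_)
  · obtain ⟨C, hC⟩ := hspan ε hε
    exact (iteratedRate_mem_Icc hC).1
  · obtain ⟨C, hC⟩ := hsep ε hε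
    exact (iteratedRate_mem_Icc hC).1
  · obtain ⟨C, hC⟩ := hspan ε hε
    obtain ⟨C', hC'⟩ := hsep (ε / 2) (half_pos hε)
    refine (iteratedRate_le_add hC hC' (c := 0) fun δ α n => ?_).trans_eq (add_zero _)
    rw [add_zero]
    exact log_spanSum_div_le _ hB n (half_pos hε) (half_lt_self hε)
  · obtain ⟨ρ, hρ, hfρ⟩ := Metric.uniformContinuous_iff.1
      (CompactSpace.uniformContinuous_of_continuous hf) η hη
    filter_upwards [Ioo_mem_nhdsGT hρ] with ε hε
    obtain ⟨C, hC⟩ := hsep ε hε.1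
    obtain ⟨C', hC'⟩ := hspan (ε / 2) (half_pos hε.1)
    refine iteratedRate_le_add hC hC' fun δ α n => log_sepSum_div_le _ hB n hε.1 hη.le ?_
    intro x y hxy
    exact (hfρ (hxy.trans ((half_lt_self hε.1).trans hε.2))).le
end

section
/- Let (X,d) be a compact metric space, T : X → X a continuous map, f : X → ℝ continuous, and fix a family {N_δ : δ > 0} ⊂ ℕ. Then the topological pressure with respect to Feldman-Katok pseudo-orbits equals the classical topological pressure: PFKPO(X,T,f) = P(X,T,f). -/
open Filter Metric Set Topology

variable {X : Type*}

noncomputable def spanPress [MetricSpace X] (T : X → X) (f : X → ℝ) (n : ℕ) (ε : ℝ) : ℝ :=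
  sInf { r : ℝ | ∃ F : Finset X,
      (∀ x : X, ∃ y ∈ F, ∀ i < n, dist (T^[i] x) (T^[i] y) ≤ ε) ∧
      r = ∑ y ∈ F, Real.exp (∑ i ∈ Finset.range n, f (T^[i] y)) }

noncomputable def Pres [MetricSpace X] (T : X → X) (f : X → ℝ) : ℝ :=
  limsup (fun ε : ℝ => limsup (fun n : ℕ => Real.log (spanPress T f n ε) / n) atTop)
    (nhdsWithin 0 (Set.Ioi 0))

theorem exists_finset_representatives {A C : Type*} (S : Set A) (K : Finset C)
    (R : A → C → Prop) (φ : A → ℝ) (w : C → ℝ) (hw : ∀ c ∈ K, 0 ≤ w c)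
    (h : ∀ a ∈ S, ∃ c ∈ K, R a c ∧ φ a ≤ w c) :
    ∃ F : Finset A, ↑F ⊆ S ∧ (∀ a ∈ S, ∃ b ∈ F, ∃ c, R a c ∧ R b c) ∧
      ∑ a ∈ F, φ a ≤ ∑ c ∈ K, w c := by
  classical
  rcases S.eq_empty_or_nonempty with rfl | ⟨a₀, ha₀⟩
  · exact ⟨∅, by simp, by simp, by simpa using Finset.sum_nonneg hw⟩
  have : Nonempty C := ⟨(h a₀ ha₀).choose⟩
  choose! code hK hR hφ using h
  obtain ⟨S', hS', hbij⟩ := Set.SurjOn.exists_bijOn_subset (Set.surjOn_image code S)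
  have hfin : S'.Finite := by
    refine Set.Finite.of_finite_image (K.finite_toSet.subset ?_) hbij.injOn
    rintro _ ⟨a, ha, rfl⟩
    exact hK a (hS' ha)
  refine ⟨hfin.toFinset, by simpa using hS', ?_, ?_⟩
  · intro a ha
    obtain ⟨b, hb, hab⟩ := hbij.surjOn (Set.mem_image_of_mem code ha)
    exact ⟨b, by simpa using hb, code a, hR a ha, hab ▸ hR b (hS' hb)⟩
  · calc ∑ a ∈ hfin.toFinset, φ a ≤ ∑ a ∈ hfin.toFinset, w (code a) :=
          Finset.sum_le_sum fun a ha => hφ a (hS' (by simpa using ha))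
      _ = ∑ c ∈ hfin.toFinset.image code, w c := by
          rw [Finset.sum_image]
          intro a ha b hb hab
          exact hbij.injOn (by simpa using ha) (by simpa using hb) hab
      _ ≤ ∑ c ∈ K, w c := by
          refine Finset.sum_le_sum_of_subset_of_nonneg ?_ fun c hc _ => hw c hc
          intro c hc
          obtain ⟨a, ha, rfl⟩ := Finset.mem_image.1 hc
          exact hK a (hS' (by simpa using ha))

theorem exists_finset_net [MetricSpace X] [CompactSpace X] {ε : ℝ} (hε : 0 < ε) :
    ∃ Q : Finset X, ∀ x : X, ∃ q ∈ Q, dist x q ≤ ε := by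
  obtain ⟨t, -, ht, hcov⟩ := finite_cover_balls_of_compact (isCompact_univ (X := X)) hε
  refine ⟨ht.toFinset, fun x => ?_⟩
  obtain ⟨q, hq, hx⟩ := mem_iUnion₂.1 (hcov (mem_univ x))
  exact ⟨q, by simpa using hq, (mem_ball.1 hx).le⟩

theorem exists_forall_iterate_dist_le [MetricSpace X] [CompactSpace X] {T : X → X}
    (hT : Continuous T) (M : ℕ) {ε : ℝ} (hε : 0 < ε) :
    ∃ ρ > 0, ∀ r ≤ M, ∀ a b : X, dist a b ≤ ρ → dist (T^[r] a) (T^[r] b) ≤ ε := by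
  induction M with
  | zero => exact ⟨ε, hε, fun r hr a b hab => by simpa [Nat.le_zero.1 hr] using hab⟩
  | succ M ih =>
    obtain ⟨ρ, hρ, h⟩ := ih
    obtain ⟨σ, hσ, h'⟩ := Metric.uniformContinuous_iff.1
      (CompactSpace.uniformContinuous_of_continuous (hT.iterate (M + 1))) ε hε
    refine ⟨min ρ (σ / 2), by positivity, fun r hr a b hab => ?_⟩
    rcases Nat.le_succ_iff.1 hr with hr | rfl
    · exact h r hr a b (hab.trans (min_le_left _ _))
    · exact (h' (lt_of_le_of_lt (hab.trans (min_le_right _ _)) (by linarith))).le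

theorem exists_shadowing_of_steps_le [MetricSpace X] [CompactSpace X] {T : X → X}
    (hT : Continuous T) (M m : ℕ) {ε : ℝ} (hε : 0 < ε) :
    ∃ α > 0, ∀ (p : ℕ → X) (j : ℕ → ℕ) (a s : ℕ), s ≤ m →
      (∀ t, a ≤ t → t < a + s → j t ≤ j (t + 1)) → j (a + s) - j a ≤ M →
      (∀ t, a ≤ t → t < a + s → dist (T^[j (t + 1) - j t] (p t)) (p (t + 1)) ≤ α) →
      dist (T^[j (a + s) - j a] (p a)) (p (a + s)) ≤ ε := by
  induction m generalizing ε with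
  | zero =>
    refine ⟨1, one_pos, fun p j a s hs _ _ _ => ?_⟩
    obtain rfl := Nat.le_zero.1 hs
    simpa using hε.le
  | succ m ih =>
    obtain ⟨ρ, hρ, hT'⟩ := exists_forall_iterate_dist_le hT M (half_pos hε)
    obtain ⟨α, hα, h⟩ := ih hρ
    refine ⟨min α (ε / 2), by positivity, fun p j a s hs hj hM hd => ?_⟩
    cases s with
    | zero => simpa using hε.le
    | succ s =>
      have hmono : j a ≤ j (a + s) := by
        clear hd hM
        have : ∀ r ≤ s, j a ≤ j (a + r) := by
          intro r hr
          induction r with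
          | zero => simp
          | succ r ih => exact (ih (by omega)).trans (hj (a + r) (by omega) (by omega))
        exact this s le_rfl
      have hlast : j (a + s) ≤ j (a + s + 1) := hj (a + s) (by omega) (by omega)
      have hM' : j (a + s + 1) - j a ≤ M := hM
      have h1 := h p j a s (by omega) (fun t h1 h2 => hj t h1 (by omega)) (by omega)
        (fun t h1 h2 => (hd t h1 (by omega)).trans (min_le_left _ _))
      have h2 := hT' (j (a + s + 1) - j (a + s)) (by omega) _ _ h1
      rw [← Function.iterate_add_apply] at h2
      have h3 := (hd (a + s) (by omega) (by omega)).trans (min_le_right _ _)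
      have h4 : j (a + s + 1) - j (a + s) + (j (a + s) - j a) = j (a + s + 1) - j a := by omega
      rw [h4] at h2
      calc _ ≤ _ := dist_triangle _ _ _
        _ ≤ ε / 2 + ε / 2 := add_le_add h2 h3
        _ = ε := by ring

theorem exists_shadowing [MetricSpace X] [CompactSpace X] {T : X → X}
    (hT : Continuous T) (M : ℕ) {ε : ℝ} (hε : 0 < ε) :
    ∃ α > 0, ∀ (p : ℕ → X) (j : ℕ → ℕ) (k : ℕ), StrictMonoOn j (Set.Iio k) →
      (∀ t, t + 1 < k → dist (T^[j (t + 1) - j t] (p t)) (p (t + 1)) ≤ α) →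
      ∀ a b, a ≤ b → b < k → j b - j a ≤ M → dist (T^[j b - j a] (p a)) (p b) ≤ ε := by
  obtain ⟨α, hα, h⟩ := exists_shadowing_of_steps_le hT M M hε
  refine ⟨α, hα, fun p j k hj hd a b hab hb hM => ?_⟩
  obtain ⟨s, rfl⟩ := Nat.exists_eq_add_of_le hab
  have hgrow : ∀ r ≤ s, j a + r ≤ j (a + r) := by
    intro r hr
    induction r with
    | zero => simp
    | succ r ih =>
      have h1 := ih (by omega)
      have h2 : j (a + r) < j (a + (r + 1)) :=
        hj (show a + r < k by omega) (show a + (r + 1) < k by omega) (by omega)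
      omega
  have := hgrow s le_rfl
  exact h p j a s (by omega)
    (fun t h1 h2 => (hj (show t < k by omega) (show t + 1 < k by omega) (by omega)).le) hM
    (fun t h1 h2 => hd t (by omega))

theorem FKPO_exists_long_chain [MetricSpace X] {T : X → X} {α δ : ℝ} {N : ℕ} (hδ : 0 ≤ δ)
    {x : ℕ → X} (hx : x ∈ FKPO T α δ N) {n : ℕ} (hn : N < n) :
    ∃ (k : ℕ) (i j : ℕ → ℕ), StrictMonoOn i (Set.Iio k) ∧ StrictMonoOn j (Set.Iio k) ∧
      (∀ t < k, i t < n + N ∧ j t < n + N) ∧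
      ((n + N : ℕ) : ℝ) ≤ k + (2 * N + δ * (n + N : ℕ)) ∧
      ∀ t, t + 1 < k → dist (T^[j (t + 1) - j t] (x (i t))) (x (i (t + 1))) ≤ α := by
  obtain ⟨s, hs, hs0, hsN, hchain⟩ := hx
  have hex : ∃ m, n ≤ s m := ⟨n, hs.id_le n⟩
  classical
  obtain ⟨m, hm, hmin⟩ : ∃ m, n ≤ s m ∧ ∀ m' < m, s m' < n :=
    ⟨Nat.find hex, Nat.find_spec hex, fun m' h => not_le.1 (Nat.find_min hex h)⟩
  obtain ⟨m, rfl⟩ : ∃ m', m = m' + 1 := by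
    refine Nat.exists_eq_succ_of_ne_zero ?_
    rintro rfl
    omega
  have h1 := hmin m (by omega)
  have h2 := hsN m
  obtain ⟨k, hk, hkL, i, j, hi, hj, hij, hd⟩ := hchain (m + 1) 0 (by omega)
  refine ⟨k, fun t => s 0 + i t, j, ?_, hj, ?_, ?_, hd⟩
  · intro a ha b hb hab
    have := hi ha hb hab
    simp only
    omega
  · intro t ht
    have := hij t ht
    simp only
    omega
  · have h3 : ((s (m + 1) - s 0 : ℕ) : ℝ) ≤ (n + N : ℕ) := by
      exact_mod_cast (by omega : s (m + 1) - s 0 ≤ n + N)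
    have h4 : ((n + N : ℕ) : ℝ) ≤ (s (m + 1) - s 0 : ℕ) + 2 * N := by
      exact_mod_cast (by omega : n + N ≤ s (m + 1) - s 0 + 2 * N)
    nlinarith [mul_le_mul_of_nonneg_left h3 hδ]

theorem orbit_mem_FKPO [MetricSpace X] {T : X → X} {α δ : ℝ} {N : ℕ} (hα : 0 ≤ α) (hδ : 0 < δ)
    (hN : 1 ≤ N) (x : X) : (fun i => T^[i] x) ∈ FKPO T α δ N := by
  refine ⟨id, strictMono_id, by simp, by simpa using hN, fun m n hmn => ?_⟩
  refine ⟨m - n, ?_, le_rfl, id, id, strictMono_id.strictMonoOn _, strictMono_id.strictMonoOn _,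
    by simp, ?_⟩
  · have : (0 : ℝ) < (m - n : ℕ) := by exact_mod_cast Nat.sub_pos_of_lt hmn
    simp only [id]
    nlinarith
  · intro t ht
    simp [← Function.iterate_succ_apply' T, hα, add_assoc]

theorem Nat.count_strictMonoOn_image {k : ℕ} {i : ℕ → ℕ} (hi : StrictMonoOn i (Set.Iio k))
    {p : ℕ → Prop} [DecidablePred p] (hp : ∀ q, p q ↔ ∃ t < k, i t = q) {t : ℕ} (ht : t < k) :
    Nat.count p (i t) = t := by
  have : (Finset.range (i t)).filter p = (Finset.range t).image i := by
    ext q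
    simp only [Finset.mem_filter, Finset.mem_range, Finset.mem_image, hp]
    constructor
    · rintro ⟨hq, s, hs, rfl⟩
      exact ⟨s, (hi.lt_iff_lt hs ht).1 hq, rfl⟩
    · rintro ⟨s, hs, rfl⟩
      exact ⟨hi (show s < k by omega) ht hs, s, by omega, rfl⟩
  rw [Nat.count_eq_card_filter_range, this, Finset.card_image_of_injOn, Finset.card_range]
  intro a ha b hb hab
  simp only [Finset.coe_range, Set.mem_Iio] at ha hb
  exact hi.injOn (show a < k by omega) (show b < k by omega) hab

theorem StrictMonoOn.eq_of_image_Iio_subset {k k' : ℕ} {i i' : ℕ → ℕ}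
    (hi : StrictMonoOn i (Set.Iio k)) (hi' : StrictMonoOn i' (Set.Iio k'))
    (h : ∀ q, (∃ t < k, i t = q) ↔ ∃ t < k', i' t = q) {t : ℕ} (ht : t < k) :
    t < k' ∧ i' t = i t := by
  classical
  obtain ⟨t', ht', htt'⟩ := (h (i t)).1 ⟨t, ht, rfl⟩
  have h1 := Nat.count_strictMonoOn_image hi (p := fun q => ∃ t < k, i t = q) (fun q => Iff.rfl) ht
  have h2 := Nat.count_strictMonoOn_image hi' (p := fun q => ∃ t < k, i t = q) h ht'
  rw [htt', h1] at h2
  subst h2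
  exact ⟨ht', htt'⟩

/-- The least index below `k` at which `j` enters the window `[w * M, (w + 1) * M)`. -/
noncomputable def firstIndex (j : ℕ → ℕ) (k M w : ℕ) : ℕ :=
  sInf {t | t < k ∧ j t / M = w}

theorem firstIndex_spec {j : ℕ → ℕ} {k M t : ℕ} (ht : t < k) :
    firstIndex j k M (j t / M) ≤ t ∧ j (firstIndex j k M (j t / M)) / M = j t / M := by
  have h : t ∈ {s | s < k ∧ j s / M = j t / M} := ⟨ht, rfl⟩
  exact ⟨Nat.sInf_le h, (Nat.sInf_mem ⟨t, h⟩).2⟩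

/-- A code `(u, v, z)` describes the first `P` entries of `x`: the positions with `u p = none` and
the times with `v p = true` are matched increasingly, each matched entry is followed by the orbit of
the point that `z` assigns to its window, and the other entries are near the points listed by `u`. -/
def Encodes [MetricSpace X] (T : X → X) (M : ℕ) (ε : ℝ) {P W : ℕ} (x : ℕ → X)
    (c : (Fin P → Option X) × (Fin P → Bool) × (Fin W → X)) : Prop :=
  ∃ (k : ℕ) (i j : ℕ → ℕ), StrictMonoOn i (Set.Iio k) ∧ StrictMonoOn j (Set.Iio k) ∧
    (∀ t < k, i t < P ∧ j t < P ∧ j t / M < W) ∧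
    (∀ p : Fin P, c.1 p = none ↔ ∃ t < k, i t = p) ∧
    (∀ p : Fin P, c.2.1 p = true ↔ ∃ t < k, j t = p) ∧
    (∀ p q, c.1 p = some q → dist (x p) q ≤ ε) ∧
    ∀ t < k, ∀ w : Fin W, (w : ℕ) = j t / M →
      dist (x (i t)) (T^[j t - j (firstIndex j k M w)] (c.2.2 w)) ≤ 2 * ε

theorem Encodes.dist_le [MetricSpace X] {T : X → X} {M : ℕ} {ε : ℝ} {P W : ℕ} {x y : ℕ → X}
    {c : (Fin P → Option X) × (Fin P → Bool) × (Fin W → X)} (hε : 0 ≤ ε)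
    (hx : Encodes T M ε x c) (hy : Encodes T M ε y c) {p : ℕ} (hp : p < P) :
    dist (x p) (y p) ≤ 4 * ε := by
  obtain ⟨k, i, j, hi, hj, hb, hu, hv, hbad, hgood⟩ := hx
  obtain ⟨k', i', j', hi', hj', hb', hu', hv', hbad', hgood'⟩ := hy
  have himg : ∀ q, (∃ t < k, i t = q) ↔ ∃ t < k', i' t = q := by
    intro q
    by_cases hq : q < P
    · exact (hu ⟨q, hq⟩).symm.trans (hu' ⟨q, hq⟩)
    · constructor
      · rintro ⟨t, ht, rfl⟩
        exact absurd (hb t ht).1 hq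
      · rintro ⟨t, ht, rfl⟩
        exact absurd (hb' t ht).1 hq
  have hjmg : ∀ q, (∃ t < k, j t = q) ↔ ∃ t < k', j' t = q := by
    intro q
    by_cases hq : q < P
    · exact (hv ⟨q, hq⟩).symm.trans (hv' ⟨q, hq⟩)
    · constructor
      · rintro ⟨t, ht, rfl⟩
        exact absurd (hb t ht).2.1 hq
      · rintro ⟨t, ht, rfl⟩
        exact absurd (hb' t ht).2.1 hq
  have hjj : ∀ t < k, t < k' ∧ j' t = j t :=
    fun t ht => StrictMonoOn.eq_of_image_Iio_subset hj hj' hjmg ht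
  have hjj' : ∀ t < k', t < k ∧ j t = j' t :=
    fun t ht => StrictMonoOn.eq_of_image_Iio_subset hj' hj (fun q => (hjmg q).symm) ht
  rcases hc : c.1 ⟨p, hp⟩ with _ | q
  · obtain ⟨t, ht, hit⟩ := (hu ⟨p, hp⟩).1 hc
    obtain ⟨ht', hit'⟩ := StrictMonoOn.eq_of_image_Iio_subset hi hi' himg ht
    have hfirst : ∀ w, firstIndex j' k' M w = firstIndex j k M w := by
      intro w
      unfold firstIndex
      congr 1
      ext s
      constructor
      · rintro ⟨hs, hw⟩
        exact ⟨(hjj' s hs).1, (hjj' s hs).2 ▸ hw⟩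
      · rintro ⟨hs, hw⟩
        exact ⟨(hjj s hs).1, (hjj s hs).2 ▸ hw⟩
    have hspec := firstIndex_spec (j := j) (M := M) ht
    have hW := (hb t ht).2.2
    have h1 := hgood t ht ⟨j t / M, hW⟩ rfl
    have h2 := hgood' t ht' ⟨j t / M, hW⟩ (by rw [(hjj t ht).2])
    rw [hfirst, (hjj t ht).2, (hjj _ (hspec.1.trans_lt ht)).2, hit', hit] at h2
    rw [hit] at h1
    calc dist (x p) (y p) ≤ _ := dist_triangle_right _ _ _
      _ ≤ 2 * ε + 2 * ε := add_le_add h1 h2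
      _ = 4 * ε := by ring
  · have h1 := hbad _ _ hc
    have h2 := hbad' _ _ hc
    calc dist (x p) (y p) ≤ _ := dist_triangle_right _ _ _
      _ ≤ ε + ε := add_le_add h1 h2
      _ ≤ 4 * ε := by linarith

theorem Fin.prod_ite_mem_one {P : ℕ} {I : Finset ℕ} (hI : I ⊆ Finset.range P) (a : ℝ) :
    ∏ p : Fin P, (if (p : ℕ) ∈ I then 1 else a) = a ^ (P - I.card) := by
  rw [Fin.prod_univ_eq_prod_range (fun p => if p ∈ I then (1 : ℝ) else a) P,
    Finset.prod_ite, Finset.prod_const_one, one_mul, Finset.prod_const]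
  congr 1
  rw [← Finset.sdiff_eq_filter, Finset.card_sdiff_of_subset hI, Finset.card_range]

/-- The set of codes with bad labels in `Q` and window points in `E`. -/
noncomputable def codeFinset (Q E : Finset X) (P W : ℕ) :
    Finset ((Fin P → Option X) × (Fin P → Bool) × (Fin W → X)) := by
  classical
  exact Fintype.piFinset (fun _ => Q.insertNone) ×ˢ Finset.univ ×ˢ Fintype.piFinset (fun _ => E)

/-- The weight of a code: each unmatched position or time costs `exp (-l)`, and each window
contributes the Birkhoff sum of its point. -/
noncomputable def codeWeight (T : X → X) (f : X → ℝ) (M : ℕ) (l : ℝ) {P W : ℕ}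
    (c : (Fin P → Option X) × (Fin P → Bool) × (Fin W → X)) : ℝ :=
  (∏ p, if c.1 p = none then 1 else Real.exp (-l)) *
    ((∏ p, if c.2.1 p = true then 1 else Real.exp (-l)) *
      ∏ w, Real.exp (∑ m ∈ Finset.range M, f (T^[m] (c.2.2 w))))

theorem codeWeight_nonneg (T : X → X) (f : X → ℝ) (M : ℕ) (l : ℝ) {P W : ℕ}
    (c : (Fin P → Option X) × (Fin P → Bool) × (Fin W → X)) : 0 ≤ codeWeight T f M l c := by
  unfold codeWeight
  refine mul_nonneg (Finset.prod_nonneg fun p _ => ?_)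
    (mul_nonneg (Finset.prod_nonneg fun p _ => ?_) (Finset.prod_nonneg fun w _ => ?_))
  · split_ifs <;> positivity
  · split_ifs <;> positivity
  · positivity

theorem Finset.sum_product_mul_mul {A B C : Type*} (s : Finset A) (t : Finset B) (u : Finset C)
    (a : A → ℝ) (b : B → ℝ) (g : C → ℝ) :
    ∑ c ∈ s ×ˢ t ×ˢ u, a c.1 * (b c.2.1 * g c.2.2) =
      (∑ x ∈ s, a x) * ((∑ y ∈ t, b y) * ∑ z ∈ u, g z) := by
  simp_rw [Finset.sum_product, ← Finset.mul_sum, ← Finset.sum_mul]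

theorem sum_codeWeight (T : X → X) (f : X → ℝ) (M : ℕ) (l : ℝ) (P W : ℕ) (Q E : Finset X) :
    ∑ c ∈ codeFinset Q E P W, codeWeight T f M l c =
      (1 + Q.card * Real.exp (-l)) ^ P * ((1 + Real.exp (-l)) ^ P *
        (∑ y ∈ E, Real.exp (∑ m ∈ Finset.range M, f (T^[m] y))) ^ W) := by
  classical
  unfold codeFinset codeWeight
  refine (Finset.sum_product_mul_mul _ _ _
    (fun u : Fin P → Option X => ∏ p, if u p = none then 1 else Real.exp (-l))
    (fun v : Fin P → Bool => ∏ p, if v p = true then 1 else Real.exp (-l))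
    (fun z : Fin W → X =>
      ∏ w, Real.exp (∑ m ∈ Finset.range M, f (T^[m] (z w))))).trans ?_
  rw [← Finset.prod_univ_sum (fun _ : Fin P => Q.insertNone)
      (fun _ a => if a = none then (1 : ℝ) else Real.exp (-l)),
    ← Finset.prod_univ_sum (fun _ : Fin W => E)
      (fun _ y => Real.exp (∑ m ∈ Finset.range M, f (T^[m] y)))]
  have : (Finset.univ : Finset (Fin P → Bool)) = Fintype.piFinset fun _ => Finset.univ :=
    Fintype.piFinset_univ.symm
  rw [this, ← Finset.prod_univ_sum (fun _ : Fin P => (Finset.univ : Finset Bool))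
      (fun _ b => if b = true then (1 : ℝ) else Real.exp (-l))]
  simp

theorem sum_le_of_windows {T : X → X} {f : X → ℝ} (hf0 : ∀ a, 0 ≤ f a) {M k W : ℕ} (hM : 0 < M)
    {j : ℕ → ℕ} (hj : StrictMonoOn j (Set.Iio k)) (hW : ∀ t < k, j t / M < W) (z : ℕ → X) :
    ∑ t ∈ Finset.range k, f (T^[j t - j (firstIndex j k M (j t / M))] (z (j t / M))) ≤
      ∑ w ∈ Finset.range W, ∑ m ∈ Finset.range M, f (T^[m] (z w)) := by
  classical
  set φ : ℕ → ℕ × ℕ := fun t => (j t / M, j t - j (firstIndex j k M (j t / M))) with hφ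
  have hle : ∀ t < k, j (firstIndex j k M (j t / M)) ≤ j t := by
    intro t ht
    have h := (firstIndex_spec (j := j) (M := M) ht).1
    exact hj.monotoneOn (show _ < k from h.trans_lt ht) ht h
  have hinj : Set.InjOn φ (Finset.range k) := by
    intro a ha b hb hab
    simp only [Finset.coe_range, Set.mem_Iio] at ha hb
    simp only [hφ, Prod.mk.injEq] at hab
    obtain ⟨h1, h2⟩ := hab
    have h3 := hle a ha
    have h4 := hle b hb
    rw [h1] at h2 h3
    exact hj.injOn ha hb (by omega)
  calc _ = ∑ c ∈ (Finset.range k).image φ, f (T^[c.2] (z c.1)) := by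
        rw [Finset.sum_image hinj]
    _ ≤ ∑ c ∈ Finset.range W ×ˢ Finset.range M, f (T^[c.2] (z c.1)) := by
        refine Finset.sum_le_sum_of_subset_of_nonneg ?_ fun c _ _ => hf0 _
        intro c hc
        obtain ⟨t, ht, rfl⟩ := Finset.mem_image.1 hc
        have ht := Finset.mem_range.1 ht
        simp only [hφ, Finset.mem_product, Finset.mem_range]
        refine ⟨hW t ht, ?_⟩
        have h2 := (firstIndex_spec (j := j) (M := M) ht).2
        have h3 := Nat.div_add_mod (j t) M
        have h4 := Nat.div_add_mod (j (firstIndex j k M (j t / M))) M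
        have h5 := Nat.mod_lt (j t) hM
        rw [h2] at h4
        omega
    _ = _ := Finset.sum_product _ _ _

theorem exists_encoding [MetricSpace X] {T : X → X} {f : X → ℝ} {B κ ε α l D : ℝ} {M n P k : ℕ}
    (hM : 0 < M) (hf0 : ∀ a, 0 ≤ f a) (hfB : ∀ a, f a ≤ B) (hκ : 0 ≤ κ)
    (hl : 0 ≤ l) (hosc : ∀ a b, dist a b ≤ 2 * ε → f a ≤ f b + κ) {Q E : Finset X}
    (hQ : ∀ a, ∃ q ∈ Q, dist a q ≤ ε)
    (hE : ∀ a, ∃ y ∈ E, ∀ m < M, dist (T^[m] a) (T^[m] y) ≤ ε)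
    (hα : ∀ (p : ℕ → X) (j : ℕ → ℕ) (k : ℕ), StrictMonoOn j (Set.Iio k) →
      (∀ t, t + 1 < k → dist (T^[j (t + 1) - j t] (p t)) (p (t + 1)) ≤ α) →
      ∀ a b, a ≤ b → b < k → j b - j a ≤ M → dist (T^[j b - j a] (p a)) (p b) ≤ ε)
    {x : ℕ → X} {i j : ℕ → ℕ} (hnP : n ≤ P) (hi : StrictMonoOn i (Set.Iio k))
    (hj : StrictMonoOn j (Set.Iio k)) (hij : ∀ t < k, i t < P ∧ j t < P)
    (hk : (P : ℝ) ≤ k + D)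
    (hd : ∀ t, t + 1 < k → dist (T^[j (t + 1) - j t] (x (i t))) (x (i (t + 1))) ≤ α) :
    ∃ c ∈ codeFinset Q E P (P / M + 1), Encodes T M ε x c ∧
      Real.exp (∑ p ∈ Finset.range n, f (x p)) ≤
        Real.exp (2 * D * l + B * D + P * κ) * codeWeight T f M l c := by
  classical
  choose q hqQ hq using hQ
  choose e heE he using hE
  set I := (Finset.range k).image i with hI
  set J := (Finset.range k).image j with hJ
  set z : ℕ → X := fun w => e (x (i (firstIndex j k M w)))
  have hmemI : ∀ p, p ∈ I ↔ ∃ t < k, i t = p := by simp [hI]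
  have hmemJ : ∀ p, p ∈ J ↔ ∃ t < k, j t = p := by simp [hJ]
  have hIP : I ⊆ Finset.range P := by
    intro p hp
    obtain ⟨t, ht, rfl⟩ := (hmemI p).1 hp
    simpa using (hij t ht).1
  have hJP : J ⊆ Finset.range P := by
    intro p hp
    obtain ⟨t, ht, rfl⟩ := (hmemJ p).1 hp
    simpa using (hij t ht).2
  have hiInj : Set.InjOn i (Finset.range k) := by simpa using hi.injOn
  have hjInj : Set.InjOn j (Finset.range k) := by simpa using hj.injOn
  have hIcard : I.card = k := by rw [hI, Finset.card_image_of_injOn hiInj, Finset.card_range]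
  have hJcard : J.card = k := by rw [hJ, Finset.card_image_of_injOn hjInj, Finset.card_range]
  have hkP : k ≤ P := by simpa [hIcard] using Finset.card_le_card hIP
  have hW : ∀ t < k, j t / M < P / M + 1 := fun t ht =>
    Nat.lt_succ_of_le (Nat.div_le_div_right (hij t ht).2.le)
  have hclose : ∀ t < k,
      dist (x (i t)) (T^[j t - j (firstIndex j k M (j t / M))] (z (j t / M))) ≤ 2 * ε := by
    intro t ht
    obtain ⟨h1, h2⟩ := firstIndex_spec (j := j) (M := M) ht
    have hlt : j t - j (firstIndex j k M (j t / M)) < M := by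
      have h3 := Nat.div_add_mod (j t) M
      have h4 := Nat.div_add_mod (j (firstIndex j k M (j t / M))) M
      have h5 := Nat.mod_lt (j t) hM
      rw [h2] at h4
      omega
    have h6 := hα (fun t => x (i t)) j k hj hd _ t h1 ht hlt.le
    have h7 := he (x (i (firstIndex j k M (j t / M)))) _ hlt
    calc _ ≤ _ := dist_triangle_left _ _ _
      _ ≤ ε + ε := add_le_add h6 h7
      _ = 2 * ε := by ring
  set c : (Fin P → Option X) × (Fin P → Bool) × (Fin (P / M + 1) → X) :=
    (fun p => if (p : ℕ) ∈ I then none else some (q (x p)), fun p => decide ((p : ℕ) ∈ J),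
      fun w => z w) with hc
  refine ⟨c, ?_, ⟨k, i, j, hi, hj, fun t ht => ⟨(hij t ht).1, (hij t ht).2, hW t ht⟩, ?_, ?_,
    ?_, ?_⟩, ?_⟩
  · simp only [codeFinset, hc, Finset.mem_product, Fintype.mem_piFinset, Finset.mem_univ, true_and]
    refine ⟨fun p => ?_, fun w => heE _⟩
    split_ifs
    · exact Finset.none_mem_insertNone
    · exact Finset.some_mem_insertNone.2 (hqQ _)
  · intro p
    simp [hc, hmemI]
  · intro p
    simp [hc, hmemJ]
  · intro p a ha
    simp only [hc] at ha
    split_ifs at ha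
    cases ha
    exact hq _
  · intro t ht w hw
    simpa [hc, hw] using hclose t ht
  · have hbirk : ∑ p ∈ Finset.range n, f (x p) ≤ B * D + P * κ +
        ∑ w ∈ Finset.range (P / M + 1), ∑ m ∈ Finset.range M, f (T^[m] (z w)) := by
      have hB : 0 ≤ B := (hf0 (x 0)).trans (hfB _)
      calc ∑ p ∈ Finset.range n, f (x p) ≤ ∑ p ∈ Finset.range P, f (x p) :=
            Finset.sum_le_sum_of_subset_of_nonneg (Finset.range_mono hnP) fun _ _ _ => hf0 _
        _ = ∑ p ∈ Finset.range P \ I, f (x p) + ∑ p ∈ I, f (x p) :=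
            (Finset.sum_sdiff hIP).symm
        _ ≤ B * D + ∑ t ∈ Finset.range k, f (x (i t)) := by
            rw [hI, Finset.sum_image hiInj, ← hI]
            gcongr
            calc _ ≤ (Finset.range P \ I).card • B := Finset.sum_le_card_nsmul _ _ _ fun _ _ => hfB _
              _ = B * ((P : ℝ) - k) := by
                rw [Finset.card_sdiff_of_subset hIP, hIcard, Finset.card_range, nsmul_eq_mul,
                  Nat.cast_sub hkP, mul_comm]
              _ ≤ B * D := by gcongr; linarith
        _ ≤ B * D + ∑ t ∈ Finset.range k,
              (f (T^[j t - j (firstIndex j k M (j t / M))] (z (j t / M))) + κ) := by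
            gcongr with t ht
            exact hosc _ _ (hclose t (Finset.mem_range.1 ht))
        _ ≤ B * D + (∑ w ∈ Finset.range (P / M + 1), ∑ m ∈ Finset.range M, f (T^[m] (z w)) +
              P * κ) := by
            rw [Finset.sum_add_distrib, Finset.sum_const, Finset.card_range, nsmul_eq_mul]
            gcongr
            exact sum_le_of_windows hf0 hM hj hW z
        _ = _ := by ring
    have hu : (∏ p, if c.1 p = none then 1 else Real.exp (-l)) = Real.exp (-l) ^ (P - k) := by
      rw [← hIcard, ← Fin.prod_ite_mem_one hIP]
      refine Finset.prod_congr rfl fun p _ => ?_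
      by_cases hp : (p : ℕ) ∈ I <;> simp [hc, hp]
    have hv : (∏ p, if c.2.1 p = true then 1 else Real.exp (-l)) = Real.exp (-l) ^ (P - k) := by
      rw [← hJcard, ← Fin.prod_ite_mem_one hJP]
      refine Finset.prod_congr rfl fun p _ => ?_
      by_cases hp : (p : ℕ) ∈ J <;> simp [hc, hp]
    rw [codeWeight, hu, hv, ← Real.exp_sum,
      Fin.sum_univ_eq_sum_range (fun w => ∑ m ∈ Finset.range M, f (T^[m] (z w))),
      ← Real.exp_nat_mul, ← Real.exp_add, ← Real.exp_add, ← Real.exp_add, Nat.cast_sub hkP]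
    refine Real.exp_le_exp.2 ?_
    nlinarith [mul_le_mul_of_nonneg_right hk hl]

theorem exists_spanning_FKPO [MetricSpace X] {T : X → X} {f : X → ℝ} {B κ ε α δ l : ℝ}
    {M N n : ℕ} (hε : 0 < ε) (hδ : 0 ≤ δ)
    (hM : 0 < M) (hf0 : ∀ a, 0 ≤ f a) (hfB : ∀ a, f a ≤ B) (hκ : 0 ≤ κ)
    (hl : 0 ≤ l) (hosc : ∀ a b, dist a b ≤ 2 * ε → f a ≤ f b + κ) {Q E : Finset X}
    (hQ : ∀ a, ∃ q ∈ Q, dist a q ≤ ε)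
    (hE : ∀ a, ∃ y ∈ E, ∀ m < M, dist (T^[m] a) (T^[m] y) ≤ ε)
    (hα : ∀ (p : ℕ → X) (j : ℕ → ℕ) (k : ℕ), StrictMonoOn j (Set.Iio k) →
      (∀ t, t + 1 < k → dist (T^[j (t + 1) - j t] (p t)) (p (t + 1)) ≤ α) →
      ∀ a b, a ≤ b → b < k → j b - j a ≤ M → dist (T^[j b - j a] (p a)) (p b) ≤ ε)
    (hn : N < n) :
    ∃ F : Finset (ℕ → X), ↑F ⊆ FKPO T α δ N ∧
      (∀ x ∈ FKPO T α δ N, ∃ y ∈ F, ∀ i < n, dist (x i) (y i) < 5 * ε) ∧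
      ∑ y ∈ F, Real.exp (∑ i ∈ Finset.range n, f (y i)) ≤
        Real.exp (2 * (2 * N + δ * (n + N : ℕ)) * l + B * (2 * N + δ * (n + N : ℕ)) +
            (n + N : ℕ) * κ) *
          ((1 + Q.card * Real.exp (-l)) ^ (n + N) * ((1 + Real.exp (-l)) ^ (n + N) *
            (∑ y ∈ E, Real.exp (∑ m ∈ Finset.range M, f (T^[m] y))) ^ ((n + N) / M + 1))) := by
  obtain ⟨F, hF, hspan, hsum⟩ := exists_finset_representatives (FKPO T α δ N)
    (codeFinset Q E (n + N) ((n + N) / M + 1)) (fun x c => Encodes T M ε x c)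
    (fun x => Real.exp (∑ i ∈ Finset.range n, f (x i)))
    (fun c => Real.exp (2 * (2 * N + δ * (n + N : ℕ)) * l + B * (2 * N + δ * (n + N : ℕ)) +
            (n + N : ℕ) * κ) * codeWeight T f M l c)
    (fun c _ => mul_nonneg (Real.exp_pos _).le (codeWeight_nonneg _ _ _ _ _))
    (by
      intro x hx
      obtain ⟨k, i, j, hi, hj, hij, hk, hd⟩ := FKPO_exists_long_chain hδ hx hn
      exact exists_encoding hM hf0 hfB hκ hl hosc hQ hE hα (Nat.le_add_right n N) hi hj hij hk hd)
  refine ⟨F, hF, fun x hx => ?_, ?_⟩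
  · obtain ⟨y, hy, c, hxc, hyc⟩ := hspan x hx
    refine ⟨y, hy, fun i hi => ?_⟩
    have := hxc.dist_le hε.le hyc (show i < n + N by omega)
    linarith
  · rwa [← Finset.mul_sum, sum_codeWeight] at hsum

theorem exists_spanning_of_net [MetricSpace X] {A : Type*} (S : Set A) (o : A → ℕ → X)
    {f : X → ℝ} {B r : ℝ} (hfB : ∀ a, |f a| ≤ B) {Q : Finset X}
    (hQ : ∀ a, ∃ q ∈ Q, dist a q ≤ r) (n : ℕ) :
    ∃ F : Finset A, ↑F ⊆ S ∧ (∀ a ∈ S, ∃ b ∈ F, ∀ i < n, dist (o a i) (o b i) ≤ 2 * r) ∧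
      ∑ b ∈ F, Real.exp (∑ i ∈ Finset.range n, f (o b i)) ≤ (Q.card : ℝ) ^ n * Real.exp (n * B) := by
  choose q hqQ hq using hQ
  obtain ⟨F, hF, hspan, hsum⟩ := exists_finset_representatives S
    (Fintype.piFinset fun _ : Fin n => Q) (fun a c => ∀ i : Fin n, dist (o a i) (c i) ≤ r)
    (fun a => Real.exp (∑ i ∈ Finset.range n, f (o a i))) (fun _ => Real.exp (n * B))
    (fun _ _ => (Real.exp_pos _).le) (by
      refine fun a _ => ⟨fun i => q (o a i), by simp [hqQ], fun i => hq _, ?_⟩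
      refine Real.exp_le_exp.2 ?_
      calc _ ≤ (Finset.range n).card • B :=
            Finset.sum_le_card_nsmul _ _ _ fun i _ => (le_abs_self _).trans (hfB _)
        _ = n * B := by simp)
  refine ⟨F, hF, fun a ha => ?_, by simpa using hsum⟩
  obtain ⟨b, hb, c, hac, hbc⟩ := hspan a ha
  refine ⟨b, hb, fun i hi => ?_⟩
  calc _ ≤ _ := dist_triangle_right _ _ _
    _ ≤ r + r := add_le_add (hac ⟨i, hi⟩) (hbc ⟨i, hi⟩)
    _ = 2 * r := by ring

theorem exp_neg_le_sum_exp {A : Type*} {o : A → ℕ → X} {f : X → ℝ} {B : ℝ}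
    (hfB : ∀ a, |f a| ≤ B) {F : Finset A} (hF : F.Nonempty) (n : ℕ) :
    Real.exp (-(n * B)) ≤ ∑ b ∈ F, Real.exp (∑ i ∈ Finset.range n, f (o b i)) := by
  obtain ⟨b, hb⟩ := hF
  refine le_trans (Real.exp_le_exp.2 ?_)
    (Finset.single_le_sum (f := fun b => Real.exp (∑ i ∈ Finset.range n, f (o b i)))
      (fun _ _ => (Real.exp_pos _).le) hb)
  calc -(n * B) = (Finset.range n).card • (-B) := by simp
    _ ≤ _ := Finset.card_nsmul_le_sum _ _ _ fun i _ => (abs_le.1 (hfB _)).1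

theorem abs_log_div_le {v B c : ℝ} {n : ℕ} (hB : 0 ≤ B) (hc : 1 ≤ c)
    (h1 : Real.exp (-(n * B)) ≤ v) (h2 : v ≤ c ^ n * Real.exp (n * B)) :
    |Real.log v / n| ≤ Real.log c + B := by
  have hlc : 0 ≤ Real.log c := Real.log_nonneg hc
  have hv : 0 < v := (Real.exp_pos _).trans_le h1
  rcases Nat.eq_zero_or_pos n with rfl | hn
  · simpa using add_nonneg hlc hB
  have hn' : (0 : ℝ) < n := by exact_mod_cast hn
  have h3 := (Real.le_log_iff_exp_le hv).2 h1
  have h4 := Real.log_le_log hv h2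
  rw [Real.log_mul (by positivity) (by positivity), Real.log_exp, Real.log_pow] at h4
  rw [abs_le]
  constructor
  · rw [le_div_iff₀ hn']
    nlinarith
  · rw [div_le_iff₀ hn']
    nlinarith

theorem FKPOsp_le [MetricSpace X] {T : X → X} {f : X → ℝ} {n : ℕ} {ε α δ : ℝ} {N : ℕ}
    {F : Finset (ℕ → X)} (hF : ↑F ⊆ FKPO T α δ N)
    (hspan : ∀ x ∈ FKPO T α δ N, ∃ y ∈ F, ∀ i < n, dist (x i) (y i) < ε) :
    FKPOsp T f n ε α δ N ≤ ∑ y ∈ F, Real.exp (∑ i ∈ Finset.range n, f (y i)) := by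
  refine csInf_le ⟨0, ?_⟩ ⟨F, hF, hspan, rfl⟩
  rintro _ ⟨F, -, -, rfl⟩
  positivity

theorem spanPress_le [MetricSpace X] {T : X → X} {f : X → ℝ} {n : ℕ} {ε : ℝ} {F : Finset X}
    (hspan : ∀ x : X, ∃ y ∈ F, ∀ i < n, dist (T^[i] x) (T^[i] y) ≤ ε) :
    spanPress T f n ε ≤ ∑ y ∈ F, Real.exp (∑ i ∈ Finset.range n, f (T^[i] y)) := by
  refine csInf_le ⟨0, ?_⟩ ⟨F, hspan, rfl⟩
  rintro _ ⟨F, -, rfl⟩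
  positivity

theorem FKPOsp_set_nonempty [MetricSpace X] [CompactSpace X] {T : X → X} {f : X → ℝ} {B : ℝ}
    (hfB : ∀ a, |f a| ≤ B) {n : ℕ} {ε α δ : ℝ} {N : ℕ} (hε : 0 < ε) :
    { r : ℝ | ∃ F : Finset (ℕ → X), ↑F ⊆ FKPO T α δ N ∧
      (∀ x ∈ FKPO T α δ N, ∃ y ∈ F, ∀ i < n, dist (x i) (y i) < ε) ∧
      r = ∑ y ∈ F, Real.exp (∑ i ∈ Finset.range n, f (y i)) }.Nonempty := by
  obtain ⟨Q, hQ⟩ := exists_finset_net (X := X) (ε := ε / 3) (by positivity)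
  obtain ⟨F, hF, hspan, -⟩ := exists_spanning_of_net (FKPO T α δ N) id hfB hQ n
  refine ⟨_, F, hF, fun x hx => ?_, rfl⟩
  obtain ⟨y, hy, h⟩ := hspan x hx
  exact ⟨y, hy, fun i hi => (h i hi).trans_lt (by linarith)⟩

theorem exists_abs_log_FKPOsp_le [MetricSpace X] [CompactSpace X] [Nonempty X] {T : X → X}
    {f : X → ℝ} {B : ℝ} (hfB : ∀ a, |f a| ≤ B) {ε : ℝ} (hε : 0 < ε) :
    ∃ C : ℝ, ∀ (α δ : ℝ) (N n : ℕ), 0 < α → 0 < δ → 1 ≤ N →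
      0 < FKPOsp T f n ε α δ N ∧ |Real.log (FKPOsp T f n ε α δ N) / n| ≤ C := by
  obtain ⟨a₀⟩ := ‹Nonempty X›
  obtain ⟨Q, hQ⟩ := exists_finset_net (X := X) (ε := ε / 3) (by positivity)
  have hQ1 : (1 : ℝ) ≤ Q.card := by
    obtain ⟨q, hq, -⟩ := hQ a₀
    exact_mod_cast Finset.card_pos.2 ⟨q, hq⟩
  refine ⟨Real.log Q.card + B, fun α δ N n hα hδ hN => ?_⟩
  have hlow : Real.exp (-(n * B)) ≤ FKPOsp T f n ε α δ N := by
    refine le_csInf (FKPOsp_set_nonempty hfB hε) ?_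
    rintro _ ⟨F, -, hspan, rfl⟩
    obtain ⟨y, hy, -⟩ := hspan _ (orbit_mem_FKPO hα.le hδ hN a₀)
    exact exp_neg_le_sum_exp (o := id) hfB ⟨y, hy⟩ n
  refine ⟨(Real.exp_pos _).trans_le hlow,
    abs_log_div_le ((abs_nonneg _).trans (hfB a₀)) hQ1 hlow ?_⟩
  obtain ⟨F, hF, hspan, hsum⟩ := exists_spanning_of_net (FKPO T α δ N) id hfB hQ n
  refine (FKPOsp_le hF fun x hx => ?_).trans hsum
  obtain ⟨y, hy, h⟩ := hspan x hx
  exact ⟨y, hy, fun i hi => (h i hi).trans_lt (by linarith)⟩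

theorem spanPress_set_nonempty [MetricSpace X] [CompactSpace X] {T : X → X} {f : X → ℝ} {B : ℝ}
    (hfB : ∀ a, |f a| ≤ B) {n : ℕ} {ε : ℝ} (hε : 0 < ε) :
    { r : ℝ | ∃ F : Finset X,
      (∀ x : X, ∃ y ∈ F, ∀ i < n, dist (T^[i] x) (T^[i] y) ≤ ε) ∧
      r = ∑ y ∈ F, Real.exp (∑ i ∈ Finset.range n, f (T^[i] y)) }.Nonempty := by
  obtain ⟨Q, hQ⟩ := exists_finset_net (X := X) (ε := ε / 2) (by positivity)
  obtain ⟨F, -, hspan, -⟩ :=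
    exists_spanning_of_net (Set.univ : Set X) (fun x i => T^[i] x) hfB hQ n
  refine ⟨_, F, fun x => ?_, rfl⟩
  obtain ⟨y, hy, h⟩ := hspan x (mem_univ x)
  exact ⟨y, hy, fun i hi => (h i hi).trans (by linarith)⟩

theorem exists_abs_log_spanPress_le [MetricSpace X] [CompactSpace X] [Nonempty X] {T : X → X}
    {f : X → ℝ} {B : ℝ} (hfB : ∀ a, |f a| ≤ B) {ε : ℝ} (hε : 0 < ε) :
    ∃ C : ℝ, ∀ n : ℕ, 0 < spanPress T f n ε ∧ |Real.log (spanPress T f n ε) / n| ≤ C := by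
  obtain ⟨a₀⟩ := ‹Nonempty X›
  obtain ⟨Q, hQ⟩ := exists_finset_net (X := X) (ε := ε / 2) (by positivity)
  have hQ1 : (1 : ℝ) ≤ Q.card := by
    obtain ⟨q, hq, -⟩ := hQ a₀
    exact_mod_cast Finset.card_pos.2 ⟨q, hq⟩
  refine ⟨Real.log Q.card + B, fun n => ?_⟩
  have hlow : Real.exp (-(n * B)) ≤ spanPress T f n ε := by
    refine le_csInf (spanPress_set_nonempty hfB hε) ?_
    rintro _ ⟨F, hspan, rfl⟩
    obtain ⟨y, hy, -⟩ := hspan a₀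
    exact exp_neg_le_sum_exp (o := fun x i => T^[i] x) hfB ⟨y, hy⟩ n
  refine ⟨(Real.exp_pos _).trans_le hlow,
    abs_log_div_le ((abs_nonneg _).trans (hfB a₀)) hQ1 hlow ?_⟩
  obtain ⟨F, -, hspan, hsum⟩ :=
    exists_spanning_of_net (Set.univ : Set X) (fun x i => T^[i] x) hfB hQ n
  refine (spanPress_le fun x => ?_).trans hsum
  obtain ⟨y, hy, h⟩ := hspan x (mem_univ x)
  exact ⟨y, hy, fun i hi => (h i hi).trans (by linarith)⟩

theorem spanPress_le_FKPOsp [MetricSpace X] [CompactSpace X] {T : X → X} {f : X → ℝ} {B : ℝ}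
    (hfB : ∀ a, |f a| ≤ B) {n : ℕ} {ε α δ κ : ℝ} {N : ℕ} (hε : 0 < ε) (hα : 0 ≤ α) (hδ : 0 < δ)
    (hN : 1 ≤ N) (hosc : ∀ a b, dist a b ≤ ε → f a ≤ f b + κ) :
    spanPress T f n (2 * ε) ≤ Real.exp (n * κ) * FKPOsp T f n ε α δ N := by
  rw [← div_le_iff₀' (Real.exp_pos _)]
  refine le_csInf (FKPOsp_set_nonempty hfB hε) ?_
  rintro _ ⟨F, -, hspan, rfl⟩
  rw [div_le_iff₀' (Real.exp_pos _), Finset.mul_sum]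
  obtain ⟨E, -, hE, hsum⟩ := exists_finset_representatives (Set.univ : Set X) F
    (fun x y => ∀ i < n, dist (T^[i] x) (y i) < ε)
    (fun x => Real.exp (∑ i ∈ Finset.range n, f (T^[i] x)))
    (fun y => Real.exp (n * κ) * Real.exp (∑ i ∈ Finset.range n, f (y i)))
    (fun _ _ => by positivity) (by
      intro x _
      obtain ⟨y, hy, hxy⟩ := hspan _ (orbit_mem_FKPO hα hδ hN x)
      refine ⟨y, hy, hxy, ?_⟩
      rw [← Real.exp_add]
      refine Real.exp_le_exp.2 ?_
      calc ∑ i ∈ Finset.range n, f (T^[i] x) ≤ ∑ i ∈ Finset.range n, (f (y i) + κ) :=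
            Finset.sum_le_sum fun i hi => hosc _ _ (hxy i (Finset.mem_range.1 hi)).le
        _ = _ := by simp [Finset.sum_add_distrib, add_comm])
  refine (spanPress_le fun x => ?_).trans hsum
  obtain ⟨y, hy, c, hxc, hyc⟩ := hE x (mem_univ x)
  refine ⟨y, hy, fun i hi => ?_⟩
  calc _ ≤ _ := dist_triangle_right _ _ _
    _ ≤ ε + ε := add_le_add (hxc i hi).le (hyc i hi).le
    _ = 2 * ε := by ring

theorem isBoundedUnder_le_of_abs_le {ι : Type*} {F : Filter ι} {u : ι → ℝ} {C : ℝ}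
    (h : ∀ᶠ n in F, |u n| ≤ C) : F.IsBoundedUnder (· ≤ ·) u :=
  ⟨C, Filter.eventually_map.2 (h.mono fun _ hn => (abs_le.1 hn).2)⟩

theorem isCoboundedUnder_le_of_abs_le {ι : Type*} {F : Filter ι} [F.NeBot] {u : ι → ℝ} {C : ℝ}
    (h : ∀ᶠ n in F, |u n| ≤ C) : F.IsCoboundedUnder (· ≤ ·) u :=
  Filter.IsBoundedUnder.isCoboundedUnder_le
    ⟨-C, Filter.eventually_map.2 (h.mono fun _ hn => (abs_le.1 hn).1)⟩

theorem abs_limsup_le {ι : Type*} {F : Filter ι} [F.NeBot] {u : ι → ℝ} {C : ℝ}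
    (h : ∀ᶠ n in F, |u n| ≤ C) : |limsup u F| ≤ C :=
  abs_le.2 ⟨Filter.le_limsup_of_frequently_le (h.mono fun _ hn => (abs_le.1 hn).1).frequently
      (isBoundedUnder_le_of_abs_le h),
    Filter.limsup_le_of_le (isCoboundedUnder_le_of_abs_le h) (h.mono fun _ hn => (abs_le.1 hn).2)⟩

theorem limsup_spanPress_le [MetricSpace X] [CompactSpace X] [Nonempty X] {T : X → X} {f : X → ℝ}
    {B : ℝ} (hfB : ∀ a, |f a| ≤ B) {ε α δ κ : ℝ} {N : ℕ} (hε : 0 < ε) (hα : 0 < α) (hδ : 0 < δ)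
    (hN : 1 ≤ N) (hosc : ∀ a b, dist a b ≤ ε → f a ≤ f b + κ) :
    limsup (fun n : ℕ => Real.log (spanPress T f n (2 * ε)) / n) atTop ≤
      limsup (fun n : ℕ => Real.log (FKPOsp T f n ε α δ N) / n) atTop + κ := by
  obtain ⟨C, hC⟩ := exists_abs_log_FKPOsp_le (T := T) hfB hε
  obtain ⟨C', hC'⟩ := exists_abs_log_spanPress_le (T := T) hfB (show 0 < 2 * ε by positivity)
  have hb : ∀ᶠ n : ℕ in atTop, |Real.log (FKPOsp T f n ε α δ N) / n| ≤ C :=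
    .of_forall fun n => (hC α δ N n hα hδ hN).2
  rw [← limsup_add_const _ _ _ (isBoundedUnder_le_of_abs_le hb) (isCoboundedUnder_le_of_abs_le hb)]
  refine Filter.limsup_le_limsup ?_
    (isCoboundedUnder_le_of_abs_le (.of_forall fun n => (hC' n).2))
    ⟨C + κ, Filter.eventually_map.2 (hb.mono fun n hn => by linarith [(abs_le.1 hn).2])⟩
  filter_upwards [eventually_gt_atTop 0] with n hn
  have hn' : (0 : ℝ) < n := by exact_mod_cast hn
  have h := Real.log_le_log (hC' n).1
    (spanPress_le_FKPOsp (T := T) (n := n) hfB hε hα.le hδ hN hosc)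
  rw [Real.log_mul (by positivity) (hC α δ N n hα hδ hN).1.ne', Real.log_exp] at h
  rw [div_add' _ _ _ hn'.ne']
  gcongr
  linarith

theorem sum_exp_shift {A : Type*} (o : A → ℕ → X) (f : X → ℝ) (B : ℝ) (F : Finset A) (n : ℕ) :
    ∑ y ∈ F, Real.exp (∑ i ∈ Finset.range n, (f (o y i) + B)) =
      Real.exp (n * B) * ∑ y ∈ F, Real.exp (∑ i ∈ Finset.range n, f (o y i)) := by
  rw [Finset.mul_sum]
  refine Finset.sum_congr rfl fun y _ => ?_
  rw [← Real.exp_add, Finset.sum_add_distrib]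
  simp [add_comm]

theorem exists_limsup_FKPOsp_le [MetricSpace X] [CompactSpace X] [Nonempty X] {T : X → X}
    (hT : Continuous T) {f : X → ℝ} {B : ℝ} (hfB : ∀ a, |f a| ≤ B) {ε κ θ : ℝ} (hε : 0 < ε)
    (hθ : 0 < θ) (hκ : 0 ≤ κ) (hosc : ∀ a b, dist a b ≤ 2 * ε → f a ≤ f b + κ) :
    ∃ δ₀ > 0, ∀ δ, 0 < δ → δ < δ₀ → ∀ N : ℕ, 1 ≤ N → ∃ α > 0,
      limsup (fun n : ℕ => Real.log (FKPOsp T f n (5 * ε) α δ N) / n) atTop ≤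
        limsup (fun n : ℕ => Real.log (spanPress T f n ε) / n) atTop + κ + 5 * θ := by
  have ⟨a₀⟩ := ‹Nonempty X›
  have hB : 0 ≤ B := (abs_nonneg _).trans (hfB a₀)
  obtain ⟨Q, hQ⟩ := exists_finset_net (X := X) hε
  obtain ⟨l, hl0, hl1, hl2⟩ : ∃ l : ℝ, 0 ≤ l ∧ Q.card * Real.exp (-l) ≤ θ ∧ Real.exp (-l) ≤ θ := by
    have h1 : Tendsto (fun l : ℝ => Real.exp (-l)) atTop (𝓝 0) :=
      Real.tendsto_exp_neg_atTop_nhds_zero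
    have h2 : Tendsto (fun l : ℝ => Q.card * Real.exp (-l)) atTop (𝓝 0) := by
      simpa using h1.const_mul (Q.card : ℝ)
    obtain ⟨l, h3, h4, h5⟩ := ((eventually_ge_atTop 0).and
      ((h2.eventually_le_const hθ).and (h1.eventually_le_const hθ))).exists
    exact ⟨l, h3, h4, h5⟩
  refine ⟨θ / (2 * l + 2 * B + 1), by positivity, fun δ hδ hδ' N hN => ?_⟩
  rw [lt_div_iff₀ (by positivity)] at hδ'
  obtain ⟨C', hC'⟩ := exists_abs_log_spanPress_le (T := T) hfB hε
  set G := limsup (fun n : ℕ => Real.log (spanPress T f n ε) / n) atTop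
  set A := G + θ with hA
  obtain ⟨M, hM, hM'⟩ := ((eventually_gt_atTop 0).and
    (Filter.eventually_lt_of_limsup_lt (show G < A by linarith)
      (isBoundedUnder_le_of_abs_le (.of_forall fun n => (hC' n).2)))).exists
  have hMr : (0 : ℝ) < M := by exact_mod_cast hM
  rw [div_lt_iff₀ hMr, Real.log_lt_iff_lt_exp (hC' M).1] at hM'
  obtain ⟨_, ⟨E, hE, rfl⟩, hEsum⟩ := exists_lt_of_csInf_lt (spanPress_set_nonempty hfB hε) hM'
  have hEsum' : ∑ y ∈ E, Real.exp (∑ m ∈ Finset.range M, (f (T^[m] y) + B)) ≤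
      Real.exp (M * (A + B)) := by
    rw [sum_exp_shift (fun x i => T^[i] x)]
    calc _ ≤ Real.exp (M * B) * Real.exp (A * M) := by gcongr
      _ = _ := by rw [← Real.exp_add]; ring_nf
  have hf0 : ∀ a, 0 ≤ f a + B := fun a => by linarith [(abs_le.1 (hfB a)).1]
  have hfB' : ∀ a, f a + B ≤ 2 * B := fun a => by linarith [(abs_le.1 (hfB a)).2]
  have hAB : 0 ≤ A + B := by
    obtain ⟨y, hy, -⟩ := hE a₀
    have h1 : (1 : ℝ) ≤ Real.exp (M * (A + B)) := by
      refine le_trans ?_ hEsum'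
      refine le_trans ?_ (Finset.single_le_sum
        (f := fun y => Real.exp (∑ m ∈ Finset.range M, (f (T^[m] y) + B)))
        (fun _ _ => (Real.exp_pos _).le) hy)
      exact Real.one_le_exp (Finset.sum_nonneg fun _ _ => hf0 _)
    have h2 := Real.one_le_exp_iff.1 h1
    exact nonneg_of_mul_nonneg_right h2 hMr
  obtain ⟨α, hα, hshadow⟩ := exists_shadowing hT M hε
  refine ⟨α, hα, ?_⟩
  obtain ⟨C, hC⟩ := exists_abs_log_FKPOsp_le (T := T) hfB (show 0 < 5 * ε by positivity)
  refine Filter.limsup_le_of_le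
    (isCoboundedUnder_le_of_abs_le (.of_forall fun n => (hC α δ N n hα hδ hN).2)) ?_
  set K : ℝ := 2 * (2 * N + δ * N) * l + 2 * B * (2 * N + δ * N) + N * κ + 2 * N * θ +
    (N + M) * (A + B) with hK
  have hKn : ∀ᶠ n : ℕ in atTop, K / n ≤ θ :=
    (tendsto_const_div_atTop_nhds_zero_nat K).eventually_le_const hθ
  filter_upwards [hKn, eventually_gt_atTop N] with n hn hNn
  have hn0 : (0 : ℝ) < n := by exact_mod_cast (by omega : 0 < n)
  obtain ⟨F, hF, hspan, hsum⟩ := exists_spanning_FKPO (f := fun a => f a + B) hε hδ.le hM hf0 hfB'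
    hκ hl0 (fun a b hab => by linarith [hosc a b hab]) hQ hE hshadow hNn
  rw [sum_exp_shift (fun (x : ℕ → X) i => x i) f B F n] at hsum
  have h1 := (mul_le_mul_of_nonneg_left (FKPOsp_le (f := f) hF hspan) (Real.exp_pos (n * B)).le).trans
    hsum
  have h2 : (1 + Q.card * Real.exp (-l)) ^ (n + N) ≤ Real.exp ((n + N : ℕ) * θ) := by
    rw [Real.exp_nat_mul]
    gcongr
    linarith [Real.add_one_le_exp θ]
  have h3 : (1 + Real.exp (-l)) ^ (n + N) ≤ Real.exp ((n + N : ℕ) * θ) := by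
    rw [Real.exp_nat_mul]
    gcongr
    linarith [Real.add_one_le_exp θ]
  have h4 : (∑ y ∈ E, Real.exp (∑ m ∈ Finset.range M, (f (T^[m] y) + B))) ^ ((n + N) / M + 1) ≤
      Real.exp (((n + N : ℕ) + M) * (A + B)) := by
    calc _ ≤ Real.exp (M * (A + B)) ^ ((n + N) / M + 1) := by gcongr
      _ ≤ _ := by
        rw [← Real.exp_nat_mul, ← mul_assoc]
        refine Real.exp_le_exp.2 (mul_le_mul_of_nonneg_right ?_ hAB)
        have : ((n + N) / M + 1) * M ≤ n + N + M := by
          rw [add_mul, one_mul]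
          exact Nat.add_le_add_right (Nat.div_mul_le_self _ _) _
        exact_mod_cast this
  have h5 := h1.trans (mul_le_mul_of_nonneg_left
    (mul_le_mul h2 (mul_le_mul h3 h4 (by positivity) (by positivity)) (by positivity)
      (by positivity)) (by positivity))
  rw [← Real.exp_add, ← Real.exp_add, ← Real.exp_add] at h5
  have hpos := (hC α δ N n hα hδ hN).1
  have h6 := Real.log_le_log (by positivity) h5
  rw [Real.log_mul (by positivity) hpos.ne', Real.log_exp, Real.log_exp] at h6
  rw [div_le_iff₀ hn0] at hn ⊢
  push_cast at h6
  have h7 : n * (δ * (2 * l + 2 * B + 1)) ≤ n * θ := by gcongr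
  have h8 : 0 ≤ n * δ := by positivity
  have h9 : Real.log (FKPOsp T f n (5 * ε) α δ N) ≤
      n * (δ * (2 * l + 2 * B)) + n * (κ + 2 * θ + A) + K := by
    rw [hK]
    linear_combination h6
  rw [hA] at h9
  linear_combination h9 + h7 + h8 + hn

theorem csInf_eq_of_forall_add_mem {S S' : Set ℝ} (h : ∀ η > 0, ∀ a ∈ S, a + η ∈ S')
    (h' : ∀ η > 0, ∀ a ∈ S', a + η ∈ S) : sInf S = sInf S' := by
  have key : ∀ {U V : Set ℝ}, (∀ η > 0, ∀ a ∈ U, a + η ∈ V) → BddBelow V → BddBelow U :=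
    fun hUV ⟨b, hb⟩ => ⟨b - 1, fun a ha => by linarith [hb (hUV 1 one_pos a ha)]⟩
  have key' : ∀ {U V : Set ℝ}, (∀ η > 0, ∀ a ∈ U, a + η ∈ V) → BddBelow V → U.Nonempty →
      sInf V ≤ sInf U := fun hUV hV hU =>
    le_csInf hU fun a ha => le_of_forall_pos_le_add fun η hη => csInf_le hV (hUV η hη a ha)
  by_cases hS : BddBelow S
  · have hS' := key h' hS
    rcases S.eq_empty_or_nonempty with rfl | ⟨a, ha⟩
    · have : S' = ∅ := Set.eq_empty_of_forall_notMem fun a ha => h' 1 one_pos a ha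
      rw [this]
    · exact le_antisymm (key' h' hS ⟨_, h 1 one_pos a ha⟩) (key' h hS' ⟨a, ha⟩)
  · have hS' : ¬ BddBelow S' := fun hb => hS (key h hb)
    rw [Real.sInf_of_not_bddBelow hS, Real.sInf_of_not_bddBelow hS']

theorem eventually_nhdsGT_zero_const_mul {p : ℝ → Prop} {c : ℝ} (hc : 0 < c)
    (h : ∀ᶠ ε in 𝓝[>] 0, p (c * ε)) : ∀ᶠ ε in 𝓝[>] (0 : ℝ), p ε := by
  have ht : Tendsto (fun ε : ℝ => c⁻¹ * ε) (𝓝[>] 0) (𝓝[>] 0) := by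
    refine tendsto_nhdsWithin_iff.2 ⟨?_, ?_⟩
    · have : Tendsto (fun ε : ℝ => c⁻¹ * ε) (𝓝 0) (𝓝 (c⁻¹ * 0)) := tendsto_id.const_mul _
      rw [mul_zero] at this
      exact this.mono_left nhdsWithin_le_nhds
    · filter_upwards [self_mem_nhdsWithin] with ε hε
      exact mul_pos (inv_pos.2 hc) hε
  refine (ht.eventually h).mono fun ε hε => ?_
  rwa [mul_inv_cancel_left₀ hc.ne'] at hε

theorem limsup_nhdsGT_zero_eq_of_const_mul_le {u v : ℝ → ℝ} {c c' : ℝ} (hc : 0 < c) (hc' : 0 < c')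
    (h : ∀ η > 0, ∀ᶠ ε in 𝓝[>] 0, u (c * ε) ≤ v ε + η)
    (h' : ∀ η > 0, ∀ᶠ ε in 𝓝[>] 0, v (c' * ε) ≤ u ε + η) :
    limsup u (𝓝[>] 0) = limsup v (𝓝[>] 0) := by
  rw [Filter.limsup_eq, Filter.limsup_eq]
  refine csInf_eq_of_forall_add_mem (fun η hη a ha => ?_) fun η hη a ha => ?_
  · exact eventually_nhdsGT_zero_const_mul hc'
      (((h' η hη).and ha).mono fun ε hε => hε.1.trans (by linarith [hε.2]))
  · exact eventually_nhdsGT_zero_const_mul hc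
      (((h η hη).and ha).mono fun ε hε => hε.1.trans (by linarith [hε.2]))

theorem eventually_oscillation_le [MetricSpace X] [CompactSpace X] {f : X → ℝ} (hf : Continuous f)
    {κ : ℝ} (hκ : 0 < κ) :
    ∀ᶠ ε in 𝓝[>] (0 : ℝ), ∀ a b, dist a b ≤ 2 * ε → f a ≤ f b + κ := by
  obtain ⟨ρ, hρ, h⟩ := Metric.uniformContinuous_iff.1
    (CompactSpace.uniformContinuous_of_continuous hf) κ hκ
  filter_upwards [Ioo_mem_nhdsGT (show (0 : ℝ) < ρ / 2 by positivity)] with ε hε a b hab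
  have := h (show dist a b < ρ by linarith [hε.2])
  rw [Real.dist_eq] at this
  linarith [(abs_lt.1 this).2]

theorem abs_sInf_rate_le {v : ℝ → ℝ} {C : ℝ} (h : ∀ α > 0, |v α| ≤ C) :
    BddBelow {r | ∃ α : ℝ, 0 < α ∧ r = v α} ∧ |sInf {r | ∃ α : ℝ, 0 < α ∧ r = v α}| ≤ C := by
  have hb : BddBelow {r | ∃ α : ℝ, 0 < α ∧ r = v α} := by
    refine ⟨-C, ?_⟩
    rintro _ ⟨α, hα, rfl⟩
    exact (abs_le.1 (h α hα)).1
  refine ⟨hb, abs_le.2 ⟨le_csInf ⟨_, 1, one_pos, rfl⟩ ?_,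
    (csInf_le hb ⟨1, one_pos, rfl⟩).trans (abs_le.1 (h 1 one_pos)).2⟩⟩
  rintro _ ⟨α, hα, rfl⟩
  exact (abs_le.1 (h α hα)).1

theorem PFKPO_eq_pressure_of_isEmpty [MetricSpace X] [IsEmpty X] (T : X → X) (f : X → ℝ)
    (N : ℝ → ℕ) : PFKPO T f N = Pres T f := by
  have h1 : ∀ n ε, spanPress T f n ε = 0 := by
    intro n ε
    have : { r : ℝ | ∃ F : Finset X,
      (∀ x : X, ∃ y ∈ F, ∀ i < n, dist (T^[i] x) (T^[i] y) ≤ ε) ∧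
      r = ∑ y ∈ F, Real.exp (∑ i ∈ Finset.range n, f (T^[i] y)) } = {0} := by
      ext r
      constructor
      · rintro ⟨F, -, rfl⟩
        simp [Finset.eq_empty_of_isEmpty F]
      · rintro rfl
        exact ⟨∅, fun x => isEmptyElim x, by simp⟩
    rw [spanPress, this, csInf_singleton]
  have h2 : ∀ n ε α δ N, FKPOsp T f n ε α δ N = 0 := by
    intro n ε α δ N
    have : { r : ℝ | ∃ F : Finset (ℕ → X), ↑F ⊆ FKPO T α δ N ∧
      (∀ x ∈ FKPO T α δ N, ∃ y ∈ F, ∀ i < n, dist (x i) (y i) < ε) ∧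
      r = ∑ y ∈ F, Real.exp (∑ i ∈ Finset.range n, f (y i)) } = {0} := by
      ext r
      constructor
      · rintro ⟨F, -, -, rfl⟩
        simp [Finset.eq_empty_of_isEmpty F]
      · rintro rfl
        exact ⟨∅, by simp, fun x => isEmptyElim x, by simp⟩
    rw [FKPOsp, this, csInf_singleton]
  have h3 : {r : ℝ | ∃ α : ℝ, 0 < α ∧ r = 0} = {0} := by
    ext r
    exact ⟨fun ⟨_, _, h⟩ => h, fun h => ⟨1, one_pos, h⟩⟩
  simp only [PFKPO, Pres, h1, h2, h3, Real.log_zero, zero_div, limsup_const, csInf_singleton]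

/-- the topological pressure with respect to Feldman-Katok pseudo-orbits
equals the classical topological pressure. -/
theorem PFKPO_eq_pressure [MetricSpace X] [CompactSpace X] (T : X → X)
    (hT : Continuous T) (f : X → ℝ) (hf : Continuous f)
    (N : ℝ → ℕ) (hN : ∀ δ : ℝ, 0 < δ → 1 ≤ N δ) :
    PFKPO T f N = Pres T f := by
  rcases isEmpty_or_nonempty X with hX | hX
  · exact PFKPO_eq_pressure_of_isEmpty T f N
  obtain ⟨B, hB⟩ := isCompact_univ.exists_bound_of_continuousOn hf.continuousOn
  have hfB : ∀ a, |f a| ≤ B := fun a => hB a (mem_univ a)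
  have hbound : ∀ ε > 0, ∃ C : ℝ, ∀ δ > 0,
      (∀ α > 0, |limsup (fun n : ℕ => Real.log (FKPOsp T f n ε α δ (N δ)) / n) atTop| ≤ C) := by
    intro ε hε
    obtain ⟨C, hC⟩ := exists_abs_log_FKPOsp_le (T := T) hfB hε
    exact ⟨C, fun δ hδ α hα =>
      abs_limsup_le (.of_forall fun n => (hC α δ (N δ) n hα hδ (hN δ hδ)).2)⟩
  symm
  refine limsup_nhdsGT_zero_eq_of_const_mul_le (c := 2) (c' := 5) (by norm_num) (by norm_num) ?_ ?_
  · intro η hη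
    filter_upwards [eventually_oscillation_le hf hη, self_mem_nhdsWithin] with ε hosc hε
    obtain ⟨C, hC⟩ := hbound ε hε
    rw [← sub_le_iff_le_add]
    refine Filter.le_limsup_of_frequently_le (Filter.Eventually.frequently ?_)
      (isBoundedUnder_le_of_abs_le (C := C) ?_)
    · filter_upwards [self_mem_nhdsWithin] with δ hδ
      refine le_csInf ⟨_, 1, one_pos, rfl⟩ ?_
      rintro _ ⟨α, hα, rfl⟩
      rw [sub_le_iff_le_add]
      exact limsup_spanPress_le hfB hε hα hδ (hN δ hδ)
        fun a b hab => hosc a b (hab.trans (by linarith [mem_Ioi.1 hε]))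
    · filter_upwards [self_mem_nhdsWithin] with δ hδ
      exact (abs_sInf_rate_le (hC δ hδ)).2
  · intro η hη
    filter_upwards [eventually_oscillation_le hf (show 0 < η / 6 by positivity),
      self_mem_nhdsWithin] with ε hosc hε
    obtain ⟨C, hC⟩ := hbound (5 * ε) (mul_pos (by norm_num) hε)
    obtain ⟨δ₀, hδ₀, h⟩ := exists_limsup_FKPOsp_le hT hfB hε (show 0 < η / 6 by positivity)
      (show 0 ≤ η / 6 by positivity) hosc
    refine Filter.limsup_le_of_le (isCoboundedUnder_le_of_abs_le (C := C) ?_) ?_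
    · filter_upwards [self_mem_nhdsWithin] with δ hδ
      exact (abs_sInf_rate_le (hC δ hδ)).2
    · filter_upwards [Ioo_mem_nhdsGT hδ₀] with δ hδ
      obtain ⟨α, hα, hle⟩ := h δ hδ.1 hδ.2 (N δ) (hN δ hδ.1)
      refine (csInf_le (abs_sInf_rate_le (hC δ hδ.1)).1 ⟨α, hα, rfl⟩).trans (hle.trans ?_)
      linarith
end

section
/- Let (X,d) be a compact metric space, T : X → X a continuous map, f : X → ℝ continuous, and S a scale function. Then the scaled pressure equals the scaled pressure with respect to pseudo-orbits: Sdim(X,T,f,S) = PSdim(X,T,f,S). (In particular, no Lipschitz continuity assumption on T is needed.) -/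
open Filter Metric Set Topology

variable {X : Type*}

def PO [MetricSpace X] (T : X → X) (α : ℝ) : Set (ℕ → X) :=
  { x | ∀ i, dist (T (x i)) (x (i + 1)) ≤ α }

noncomputable def Spa [MetricSpace X] (T : X → X) (f : X → ℝ) (S : ℝ → ℝ) (n : ℕ)
    (ε : ℝ) : ℝ :=
  sInf { r : ℝ | ∃ F : Finset X,
      (∀ x : X, ∃ y ∈ F, ∀ i < n, dist (T^[i] x) (T^[i] y) ≤ ε) ∧
      r = ∑ y ∈ F, Real.exp (S ε * ∑ i ∈ Finset.range n, f (T^[i] y)) }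

noncomputable def Sdim [MetricSpace X] (T : X → X) (f : X → ℝ) (S : ℝ → ℝ) : ℝ :=
  limsup (fun ε : ℝ =>
      (limsup (fun n : ℕ => Real.log (Spa T f S n ε) / n) atTop) / S ε)
    (nhdsWithin 0 (Set.Ioi 0))

noncomputable def POSpa [MetricSpace X] (T : X → X) (f : X → ℝ) (S : ℝ → ℝ) (n : ℕ)
    (ε α : ℝ) : ℝ :=
  sInf { r : ℝ | ∃ F : Finset (ℕ → X), ↑F ⊆ PO T α ∧
      (∀ x ∈ PO T α, ∃ y ∈ F, ∀ i < n, dist (x i) (y i) < ε) ∧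
      r = ∑ y ∈ F, Real.exp (S ε * ∑ i ∈ Finset.range n, f (y i)) }

noncomputable def PSdim [MetricSpace X] (T : X → X) (f : X → ℝ) (S : ℝ → ℝ) : ℝ :=
  limsup (fun ε : ℝ =>
      (limsup (fun α : ℝ =>
          limsup (fun n : ℕ => Real.log (POSpa T f S n ε α) / n) atTop)
        (nhdsWithin 0 (Set.Ioi 0))) / S ε)
    (nhdsWithin 0 (Set.Ioi 0))

/-- Replace the centres of a cover of `Y` by points of `Y`, controlling the total weight. -/
lemma exists_finset_subset_sum_le {ι β : Type*} (F : Finset ι) (w : ι → ℝ)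
    (hw : ∀ i ∈ F, 0 ≤ w i) (Y : Set β) (R : ι → β → Prop) (hR : ∀ x ∈ Y, ∃ i ∈ F, R i x)
    (g : β → ℝ) (hg0 : ∀ x, 0 ≤ g x) (hg : ∀ i ∈ F, ∀ x ∈ Y, R i x → g x ≤ w i) :
    ∃ G : Finset β, ↑G ⊆ Y ∧ (∀ x ∈ Y, ∃ y ∈ G, ∃ i ∈ F, R i x ∧ R i y) ∧
      ∑ y ∈ G, g y ≤ ∑ i ∈ F, w i := by
  classical
  rcases Y.eq_empty_or_nonempty with rfl | ⟨b, hb⟩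
  · exact ⟨∅, by simp, by simp, by simpa using Finset.sum_nonneg hw⟩
  have key : ∀ i, ∃ p ∈ Y, (∃ x ∈ Y, R i x) → R i p := by
    intro i
    by_cases h : ∃ x ∈ Y, R i x
    · obtain ⟨x, hx, hr⟩ := h
      exact ⟨x, hx, fun _ => hr⟩
    · exact ⟨b, hb, fun h' => absurd h' h⟩
  choose p hpY hp using key
  refine ⟨(F.filter fun i => ∃ x ∈ Y, R i x).image p, ?_, ?_, ?_⟩
  · intro y hy
    obtain ⟨i, -, rfl⟩ := Finset.mem_image.1 (Finset.mem_coe.1 hy)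
    exact hpY i
  · intro x hx
    obtain ⟨i, hi, hr⟩ := hR x hx
    exact ⟨p i, Finset.mem_image_of_mem _ (Finset.mem_filter.2 ⟨hi, x, hx, hr⟩), i, hi, hr,
      hp i ⟨x, hx, hr⟩⟩
  · calc ∑ y ∈ (F.filter fun i => ∃ x ∈ Y, R i x).image p, g y
        ≤ ∑ i ∈ F.filter (fun i => ∃ x ∈ Y, R i x), g (p i) :=
          Finset.sum_image_le_of_nonneg fun u _ => hg0 u
      _ ≤ ∑ i ∈ F.filter (fun i => ∃ x ∈ Y, R i x), w i := by
          refine Finset.sum_le_sum fun i hi => ?_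
          obtain ⟨hiF, h⟩ := Finset.mem_filter.1 hi
          exact hg i hiF _ (hpY i) (hp i h)
      _ ≤ ∑ i ∈ F, w i :=
          Finset.sum_le_sum_of_subset_of_nonneg (Finset.filter_subset _ _) fun i hi _ => hw i hi

lemma mul_le_mul_add_of_abs_sub_le {s t a b δ M : ℝ} (hs : 0 ≤ s) (hab : |a - b| ≤ δ)
    (ha : |a| ≤ M) : t * a ≤ s * b + (s * δ + |t - s| * M) := by
  have h1 : s * (a - b) ≤ s * δ := mul_le_mul_of_nonneg_left ((le_abs_self _).trans hab) hs
  have h2 : (t - s) * a ≤ |t - s| * M :=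
    (le_abs_self _).trans (by rw [abs_mul]; exact mul_le_mul_of_nonneg_left ha (abs_nonneg _))
  linarith

lemma mul_sum_le_mul_sum_add {s t δ M : ℝ} (hs : 0 ≤ s) (n : ℕ) (u v : ℕ → ℝ)
    (huv : ∀ i < n, |u i - v i| ≤ δ) (hu : ∀ i, |u i| ≤ M) :
    t * ∑ i ∈ Finset.range n, u i ≤
      s * ∑ i ∈ Finset.range n, v i + n * (s * δ + |t - s| * M) := by
  rw [Finset.mul_sum, Finset.mul_sum]
  calc ∑ i ∈ Finset.range n, t * u i
      ≤ ∑ i ∈ Finset.range n, (s * v i + (s * δ + |t - s| * M)) :=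
        Finset.sum_le_sum fun i hi =>
          mul_le_mul_add_of_abs_sub_le hs (huv i (Finset.mem_range.1 hi)) (hu i)
    _ = _ := by simp [Finset.sum_add_distrib, mul_add]

lemma sum_range_mul_eq_sum_fin (k m : ℕ) (u : ℕ → ℝ) :
    ∑ i ∈ Finset.range (k * m), u i =
      ∑ j : Fin k, ∑ i ∈ Finset.range m, u (j * m + i) := by
  induction k with
  | zero => simp
  | succ k ih => rw [Nat.succ_mul, Finset.sum_range_add, ih, Fin.sum_univ_castSucc]; simp

lemma neg_le_mul_sum {s M : ℝ} (n : ℕ) (u : ℕ → ℝ) (hu : ∀ i, |u i| ≤ M) :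
    -(|s| * (n * M)) ≤ s * ∑ i ∈ Finset.range n, u i := by
  have h : |∑ i ∈ Finset.range n, u i| ≤ n * M :=
    (Finset.abs_sum_le_sum_abs _ _).trans <| by
      simpa using Finset.sum_le_sum (s := Finset.range n) fun i _ => hu i
  have h' : |s * ∑ i ∈ Finset.range n, u i| ≤ |s| * (n * M) := by
    rw [abs_mul]
    exact mul_le_mul_of_nonneg_left h (abs_nonneg _)
  exact (abs_le.1 h').1

section Orbits

variable [MetricSpace X]

lemma orbit_mem_PO (T : X → X) {α : ℝ} (hα : 0 ≤ α) (x : X) : (fun i => T^[i] x) ∈ PO T α := by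
  intro i
  simpa [Function.iterate_succ_apply'] using hα

lemma shift_mem_PO {T : X → X} {α : ℝ} {x : ℕ → X} (hx : x ∈ PO T α) (k : ℕ) :
    (fun i => x (k + i)) ∈ PO T α := fun i => hx (k + i)

lemma eventually_shadow_apply [CompactSpace X] {T : X → X} (hT : Continuous T) (i : ℕ) :
    ∀ ε : ℝ, 0 < ε → ∀ᶠ α in 𝓝[>] (0 : ℝ), ∀ x ∈ PO T α, dist (x i) (T^[i] (x 0)) ≤ ε := by
  induction i with
  | zero => intro ε hε; simp [hε.le]
  | succ i ih =>
    intro ε hε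
    obtain ⟨δ, hδ, hTδ⟩ := Metric.uniformContinuous_iff.1
      (CompactSpace.uniformContinuous_of_continuous hT) (ε / 2) (by positivity)
    filter_upwards [ih (δ / 2) (by positivity), Ioo_mem_nhdsGT (half_pos hε)] with α h hα x hx
    have h1 := hTδ ((h x hx).trans_lt (half_lt_self hδ))
    have h2 := hx i
    rw [dist_comm] at h2
    rw [Function.iterate_succ_apply']
    linarith [dist_triangle (x (i + 1)) (T (x i)) (T (T^[i] (x 0))), hα.2]

lemma eventually_shadow [CompactSpace X] {T : X → X} (hT : Continuous T) (m : ℕ) {ε : ℝ}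
    (hε : 0 < ε) :
    ∀ᶠ α in 𝓝[>] (0 : ℝ), ∀ x ∈ PO T α, ∀ i < m, dist (x i) (T^[i] (x 0)) ≤ ε := by
  have := (eventually_all_finset (Finset.range m)).2
    fun i _ => eventually_shadow_apply hT i ε hε
  filter_upwards [this] with α h x hx i hi
  exact h i (Finset.mem_range.2 hi) x hx

/-- Concatenating spanning sets of blocks of length `m`. -/
lemma exists_PO_spanning_sum_le {T : X → X} {f : X → ℝ} {s t M δ ε ε' α : ℝ} {m : ℕ}
    (hM : ∀ x, |f x| ≤ M) (hδ : ∀ x y, dist x y ≤ 2 * ε → |f x - f y| ≤ δ) (hs : 0 ≤ s)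
    (hεε' : 4 * ε < ε') (hm : 0 < m)
    (hsh : ∀ x ∈ PO T α, ∀ i < m, dist (x i) (T^[i] (x 0)) ≤ ε) {F : Finset X}
    (hF : ∀ x : X, ∃ y ∈ F, ∀ i < m, dist (T^[i] x) (T^[i] y) ≤ ε) {c : ℝ}
    (hc : ∑ y ∈ F, Real.exp (s * ∑ i ∈ Finset.range m, f (T^[i] y)) ≤ Real.exp c) (n : ℕ) :
    ∃ G : Finset (ℕ → X), ↑G ⊆ PO T α ∧
      (∀ x ∈ PO T α, ∃ y ∈ G, ∀ i < n, dist (x i) (y i) < ε') ∧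
      ∑ y ∈ G, Real.exp (t * ∑ i ∈ Finset.range n, f (y i)) ≤
        Real.exp (n * (s * δ + |t - s| * M + c / m) +
          (|m * (s * δ + |t - s| * M) + c| + |t| * (m * M))) := by
  classical
  set E := s * δ + |t - s| * M with hE
  set k := n / m + 1 with hk
  have hkm : k * m = m * (n / m) + m := by rw [hk]; ring
  have hdm := Nat.div_add_mod n m
  have hmod := Nat.mod_lt n hm
  obtain ⟨r, hr⟩ : ∃ r, k * m = n + r := ⟨k * m - n, by omega⟩
  have hrm : r ≤ m := by omega
  let R : (Fin k → X) → (ℕ → X) → Prop := fun τ x =>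
    ∀ j : Fin k, ∀ i < m, dist (x (j * m + i)) (T^[i] (τ j)) ≤ 2 * ε
  let A : ℝ := k * (m * E) + |t| * (m * M)
  let w : (Fin k → X) → ℝ := fun τ =>
    Real.exp A * ∏ j, Real.exp (s * ∑ i ∈ Finset.range m, f (T^[i] (τ j)))
  have hcov : ∀ x ∈ PO T α, ∃ τ ∈ Fintype.piFinset fun _ : Fin k => F, R τ x := by
    intro x hx
    choose τ hτF hτ using fun j : Fin k => hF (x (j * m))
    refine ⟨τ, Fintype.mem_piFinset.2 hτF, fun j i hi => ?_⟩
    have h1 := hsh _ (shift_mem_PO hx (j * m)) i hi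
    simp only [Nat.add_zero] at h1
    linarith [dist_triangle (x (j * m + i)) (T^[i] (x (j * m))) (T^[i] (τ j)), hτ j i hi]
  have hwt : ∀ τ ∈ Fintype.piFinset (fun _ : Fin k => F), ∀ x ∈ PO T α, R τ x →
      Real.exp (t * ∑ i ∈ Finset.range n, f (x i)) ≤ w τ := by
    intro τ _ x _ hx
    simp only [w]
    rw [← Real.exp_sum, ← Real.exp_add, Real.exp_le_exp]
    have h1 := neg_le_mul_sum (s := t) r (fun i => f (x (n + i))) fun i => hM _
    have h2 : t * ∑ i ∈ Finset.range (k * m), f (x i) =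
        t * ∑ i ∈ Finset.range n, f (x i) + t * ∑ i ∈ Finset.range r, f (x (n + i)) := by
      rw [hr, Finset.sum_range_add, mul_add]
    have h3 : t * ∑ i ∈ Finset.range (k * m), f (x i) ≤
        ∑ j : Fin k, (s * ∑ i ∈ Finset.range m, f (T^[i] (τ j)) + m * E) := by
      rw [sum_range_mul_eq_sum_fin, Finset.mul_sum]
      exact Finset.sum_le_sum fun j _ => mul_sum_le_mul_sum_add hs m _ _
        (fun i hi => hδ _ _ (hx j i hi)) fun i => hM _
    have hM0 : 0 ≤ M := (abs_nonneg _).trans (hM (x 0))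
    have h4 : |t| * (r * M) ≤ |t| * (m * M) := by gcongr
    simp only [Finset.sum_add_distrib, Finset.sum_const, Finset.card_univ, Fintype.card_fin,
      nsmul_eq_mul] at h3
    simp only [A]
    linarith
  obtain ⟨G, hGY, hGR, hGs⟩ := exists_finset_subset_sum_le
    (Fintype.piFinset fun _ : Fin k => F) w (fun _ _ => by positivity) (PO T α) R hcov
    (fun x => Real.exp (t * ∑ i ∈ Finset.range n, f (x i))) (fun _ => by positivity) hwt
  refine ⟨G, hGY, ?_, hGs.trans ?_⟩
  · intro x hx
    obtain ⟨y, hy, τ, -, h1, h2⟩ := hGR x hx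
    refine ⟨y, hy, fun i hi => ?_⟩
    have hik : i / m < k := by
      rw [hk]; exact Nat.lt_succ_of_le (Nat.div_le_div_right hi.le)
    have him := Nat.mod_lt i hm
    have h1' := h1 ⟨i / m, hik⟩ (i % m) him
    have h2' := h2 ⟨i / m, hik⟩ (i % m) him
    simp only [Nat.div_add_mod'] at h1' h2'
    linarith [dist_triangle_right (x i) (y i) (T^[i % m] (τ ⟨i / m, hik⟩))]
  · have hW : ∑ τ ∈ Fintype.piFinset (fun _ : Fin k => F), w τ =
        Real.exp A *
          (∑ y ∈ F, Real.exp (s * ∑ i ∈ Finset.range m, f (T^[i] y))) ^ k := by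
      rw [Finset.sum_pow', Finset.mul_sum]
    rw [hW]
    calc _ ≤ Real.exp A * Real.exp c ^ k := by gcongr
      _ = Real.exp (A + k * c) := by rw [← Real.exp_nat_mul, ← Real.exp_add]
      _ ≤ _ := by
        rw [Real.exp_le_exp]
        have hm' : (0 : ℝ) < m := by exact_mod_cast hm
        have hr' : (k : ℝ) * m = n + r := by exact_mod_cast hr
        have hrm' : (r : ℝ) ≤ m := by exact_mod_cast hrm
        set B := m * E + c with hB
        have h1 : (k : ℝ) = n / m + r / m := by field_simp; linarith
        have h2 : (r : ℝ) / m * B ≤ |B| := by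
          have : (r : ℝ) / m ≤ 1 := (div_le_one hm').2 hrm'
          calc (r : ℝ) / m * B ≤ r / m * |B| := by gcongr; exact le_abs_self _
            _ ≤ 1 * |B| := by gcongr
            _ = |B| := one_mul _
        have h3 : (n : ℝ) / m * B = n * (E + c / m) := by rw [hB]; field_simp
        have h4 : A + k * c = k * B + |t| * (m * M) := by simp only [A, hB]; ring
        rw [h4, h1, add_mul, h3]
        linarith

/-- A spanning set of pseudo-orbits yields a spanning set of `X` at twice the scale. -/
lemma exists_spanning_sum_le {T : X → X} {f : X → ℝ} {s t M δ ε α : ℝ} (hα : 0 ≤ α)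
    (hM : ∀ x, |f x| ≤ M) (hδ : ∀ x y, dist x y ≤ ε → |f x - f y| ≤ δ) (hs : 0 ≤ s)
    (n : ℕ) {G : Finset (ℕ → X)}
    (hG : ∀ x ∈ PO T α, ∃ y ∈ G, ∀ i < n, dist (x i) (y i) < ε) :
    ∃ F : Finset X, (∀ x : X, ∃ y ∈ F, ∀ i < n, dist (T^[i] x) (T^[i] y) ≤ 2 * ε) ∧
      ∑ y ∈ F, Real.exp (t * ∑ i ∈ Finset.range n, f (T^[i] y)) ≤
        Real.exp (n * (s * δ + |t - s| * M)) *
          ∑ y ∈ G, Real.exp (s * ∑ i ∈ Finset.range n, f (y i)) := by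
  have hwt : ∀ y ∈ G, ∀ x ∈ (univ : Set X), (∀ i < n, dist (T^[i] x) (y i) < ε) →
      Real.exp (t * ∑ i ∈ Finset.range n, f (T^[i] x)) ≤
        Real.exp (n * (s * δ + |t - s| * M)) *
          Real.exp (s * ∑ i ∈ Finset.range n, f (y i)) := by
    intro y _ x _ h
    rw [← Real.exp_add, Real.exp_le_exp, add_comm]
    exact mul_sum_le_mul_sum_add hs n _ _ (fun i hi => hδ _ _ (h i hi).le) fun i => hM _
  obtain ⟨F, -, hFR, hFs⟩ := exists_finset_subset_sum_le G
    (fun y => Real.exp (n * (s * δ + |t - s| * M)) *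
      Real.exp (s * ∑ i ∈ Finset.range n, f (y i)))
    (fun _ _ => by positivity) (univ : Set X)
    (fun y x => ∀ i < n, dist (T^[i] x) (y i) < ε)
    (fun x _ => hG _ (orbit_mem_PO T hα x))
    (fun x => Real.exp (t * ∑ i ∈ Finset.range n, f (T^[i] x))) (fun _ => by positivity) hwt
  refine ⟨F, fun x => ?_, hFs.trans_eq (Finset.mul_sum ..).symm⟩
  obtain ⟨y, hy, z, -, h1, h2⟩ := hFR x (mem_univ x)
  refine ⟨y, hy, fun i hi => ?_⟩
  linarith [dist_triangle_right (T^[i] x) (T^[i] y) (z i), h1 i hi, h2 i hi]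

end Orbits

section GrowthRate

variable {p : ℕ → ℝ} {K b C : ℝ}

lemma eventually_neg_le_log_div (hlow : ∀ n : ℕ, Real.exp (-(n * K)) ≤ p n) :
    ∀ᶠ n : ℕ in atTop, -K ≤ Real.log (p n) / n := by
  filter_upwards [eventually_gt_atTop 0] with n hn
  have hn' : (0 : ℝ) < n := by exact_mod_cast hn
  rw [le_div_iff₀ hn', Real.le_log_iff_exp_le ((Real.exp_pos _).trans_le (hlow n))]
  exact (Real.exp_le_exp.2 (by linarith)).trans (hlow n)

lemma eventually_log_div_le (hlow : ∀ n : ℕ, Real.exp (-(n * K)) ≤ p n)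
    (hup : ∀ n : ℕ, p n ≤ Real.exp (n * b + C)) :
    ∀ᶠ n : ℕ in atTop, Real.log (p n) / n ≤ b + C / n := by
  filter_upwards [eventually_gt_atTop 0] with n hn
  have hn' : (0 : ℝ) < n := by exact_mod_cast hn
  rw [div_le_iff₀ hn', Real.log_le_iff_le_exp ((Real.exp_pos _).trans_le (hlow n))]
  refine (hup n).trans_eq ?_
  congr 1
  field_simp

lemma tendsto_const_add_div (b C : ℝ) :
    Tendsto (fun n : ℕ => b + C / (n : ℝ)) atTop (𝓝 b) := by
  simpa using (tendsto_const_div_atTop_nhds_zero_nat C).const_add b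

lemma isBoundedUnder_ge_log_div (hlow : ∀ n : ℕ, Real.exp (-(n * K)) ≤ p n) :
    IsBoundedUnder (· ≥ ·) atTop fun n : ℕ => Real.log (p n) / n :=
  isBoundedUnder_of_eventually_ge (eventually_neg_le_log_div hlow)

lemma isBoundedUnder_le_log_div (hlow : ∀ n : ℕ, Real.exp (-(n * K)) ≤ p n)
    (hup : ∀ n : ℕ, p n ≤ Real.exp (n * b + C)) :
    IsBoundedUnder (· ≤ ·) atTop fun n : ℕ => Real.log (p n) / n :=
  (tendsto_const_add_div b C).isBoundedUnder_le.mono_le (eventually_log_div_le hlow hup)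

lemma limsup_log_div_le (hlow : ∀ n : ℕ, Real.exp (-(n * K)) ≤ p n)
    (hup : ∀ n : ℕ, p n ≤ Real.exp (n * b + C)) :
    limsup (fun n : ℕ => Real.log (p n) / n) atTop ≤ b :=
  (limsup_le_limsup (eventually_log_div_le hlow hup)
    (isBoundedUnder_ge_log_div hlow).isCoboundedUnder_le
    (tendsto_const_add_div b C).isBoundedUnder_le).trans_eq (tendsto_const_add_div b C).limsup_eq

lemma neg_le_limsup_log_div (hlow : ∀ n : ℕ, Real.exp (-(n * K)) ≤ p n)
    (hup : ∀ n : ℕ, p n ≤ Real.exp (n * b + C)) :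
    -K ≤ limsup (fun n : ℕ => Real.log (p n) / n) atTop :=
  le_limsup_of_frequently_le (eventually_neg_le_log_div hlow).frequently
    (isBoundedUnder_le_log_div hlow hup)

end GrowthRate

section Pressure

variable [MetricSpace X] {T : X → X} {f : X → ℝ} {S : ℝ → ℝ} {M : ℝ}

lemma Spa_le {n : ℕ} {ε : ℝ} {F : Finset X}
    (hF : ∀ x : X, ∃ y ∈ F, ∀ i < n, dist (T^[i] x) (T^[i] y) ≤ ε) :
    Spa T f S n ε ≤ ∑ y ∈ F, Real.exp (S ε * ∑ i ∈ Finset.range n, f (T^[i] y)) := by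
  refine csInf_le ⟨0, ?_⟩ ⟨F, hF, rfl⟩
  rintro _ ⟨F, -, rfl⟩
  positivity

lemma POSpa_le {n : ℕ} {ε α : ℝ} {G : Finset (ℕ → X)} (hG : ↑G ⊆ PO T α)
    (hG' : ∀ x ∈ PO T α, ∃ y ∈ G, ∀ i < n, dist (x i) (y i) < ε) :
    POSpa T f S n ε α ≤ ∑ y ∈ G, Real.exp (S ε * ∑ i ∈ Finset.range n, f (y i)) := by
  refine csInf_le ⟨0, ?_⟩ ⟨G, hG, hG', rfl⟩
  rintro _ ⟨F, -, -, rfl⟩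
  positivity

/-- Spanning sets of pseudo-orbits exist, with weights growing at most exponentially in the
length, uniformly in the size of the jumps. -/
lemma exists_PO_spanning_uniform [CompactSpace X] (T : X → X) (hM : ∀ x, |f x| ≤ M) {ε : ℝ}
    (hε : 0 < ε) (t : ℝ) : ∃ b C : ℝ, ∀ (α : ℝ) (n : ℕ), ∃ G : Finset (ℕ → X), ↑G ⊆ PO T α ∧
      (∀ x ∈ PO T α, ∃ y ∈ G, ∀ i < n, dist (x i) (y i) < ε) ∧
      ∑ y ∈ G, Real.exp (t * ∑ i ∈ Finset.range n, f (y i)) ≤ Real.exp (n * b + C) := by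
  obtain ⟨F, -, hFfin, hF⟩ := finite_cover_balls_of_compact (isCompact_univ (X := X))
    (show 0 < ε / 5 by positivity)
  lift F to Finset X using hFfin
  refine ⟨_, _, fun α n => exists_PO_spanning_sum_le (T := T) (f := f) (s := 0) (t := t)
    (M := M) (δ := 2 * M) (ε := ε / 5) (ε' := ε) (α := α) (m := 1) (F := F)
    (c := (F.card : ℝ)) hM (fun x y _ => ?_) le_rfl (by linarith) one_pos ?_ ?_ ?_ n⟩
  · linarith [abs_sub (f x) (f y), hM x, hM y]
  · intro x _ i hi
    obtain rfl : i = 0 := by omega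
    simpa using (div_pos hε (by norm_num : (0 : ℝ) < 5)).le
  · intro x
    obtain ⟨y, hy, hxy⟩ := mem_iUnion₂.1 (hF (mem_univ x))
    refine ⟨y, hy, fun i hi => ?_⟩
    obtain rfl : i = 0 := by omega
    exact (mem_ball.1 hxy).le
  · simpa using (by linarith [Real.add_one_le_exp (F.card : ℝ)] :
      (F.card : ℝ) ≤ Real.exp F.card)

lemma exists_spanning_uniform [CompactSpace X] (T : X → X) (hM : ∀ x, |f x| ≤ M) {ε : ℝ}
    (hε : 0 < ε) (t : ℝ) : ∃ b C : ℝ, ∀ n : ℕ, ∃ F : Finset X,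
      (∀ x : X, ∃ y ∈ F, ∀ i < n, dist (T^[i] x) (T^[i] y) ≤ ε) ∧
      ∑ y ∈ F, Real.exp (t * ∑ i ∈ Finset.range n, f (T^[i] y)) ≤ Real.exp (n * b + C) := by
  obtain ⟨b, C, h⟩ := exists_PO_spanning_uniform T hM (half_pos hε) 0
  refine ⟨0 * (2 * M) + |t - 0| * M + b, C, fun n => ?_⟩
  obtain ⟨G, -, hG, hGs⟩ := h 0 n
  obtain ⟨F, hF, hFs⟩ := exists_spanning_sum_le (T := T) (f := f) (s := 0) (t := t) (M := M)
    (δ := 2 * M) le_rfl hM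
    (fun x y _ => by linarith [abs_sub (f x) (f y), hM x, hM y]) le_rfl n hG
  refine ⟨F, by simpa [mul_div_cancel₀] using hF, hFs.trans ?_⟩
  calc _ ≤ _ := mul_le_mul_of_nonneg_left hGs (Real.exp_pos _).le
    _ = _ := by rw [← Real.exp_add]; congr 1; ring

lemma exp_neg_le_Spa [CompactSpace X] [Nonempty X] (hM : ∀ x, |f x| ≤ M) {ε : ℝ} (hε : 0 < ε)
    (n : ℕ) : Real.exp (-(n * (|S ε| * M))) ≤ Spa T f S n ε := by
  obtain ⟨b, C, h⟩ := exists_spanning_uniform T hM hε (S ε)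
  obtain ⟨F, hF, -⟩ := h n
  refine le_csInf ⟨_, F, hF, rfl⟩ ?_
  rintro _ ⟨F, hF, rfl⟩
  obtain ⟨y, hy, -⟩ := hF (Classical.arbitrary X)
  refine le_trans ?_ (Finset.single_le_sum (fun _ _ => (Real.exp_pos _).le) hy)
  rw [Real.exp_le_exp]
  linarith [neg_le_mul_sum (s := S ε) n (fun i => f (T^[i] y)) fun i => hM _]

lemma exp_neg_le_POSpa [CompactSpace X] [Nonempty X] (hM : ∀ x, |f x| ≤ M) {ε α : ℝ}
    (hε : 0 < ε) (hα : 0 ≤ α) (n : ℕ) :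
    Real.exp (-(n * (|S ε| * M))) ≤ POSpa T f S n ε α := by
  obtain ⟨b, C, h⟩ := exists_PO_spanning_uniform T hM hε (S ε)
  obtain ⟨G, hG, hG', -⟩ := h α n
  refine le_csInf ⟨_, G, hG, hG', rfl⟩ ?_
  rintro _ ⟨G, -, hG', rfl⟩
  obtain ⟨y, hy, -⟩ := hG' _ (orbit_mem_PO T hα (Classical.arbitrary X))
  refine le_trans ?_ (Finset.single_le_sum (fun _ _ => (Real.exp_pos _).le) hy)
  rw [Real.exp_le_exp]
  linarith [neg_le_mul_sum (s := S ε) n (fun i => f (y i)) fun i => hM _]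

lemma exists_Spa_le_exp [CompactSpace X] (hM : ∀ x, |f x| ≤ M) {ε : ℝ} (hε : 0 < ε) :
    ∃ b C : ℝ, ∀ n : ℕ, Spa T f S n ε ≤ Real.exp (n * b + C) := by
  obtain ⟨b, C, h⟩ := exists_spanning_uniform T hM hε (S ε)
  refine ⟨b, C, fun n => ?_⟩
  obtain ⟨F, hF, hFs⟩ := h n
  exact (Spa_le hF).trans hFs

lemma exists_POSpa_le_exp [CompactSpace X] (hM : ∀ x, |f x| ≤ M) {ε : ℝ} (hε : 0 < ε) :
    ∃ b C : ℝ, ∀ (α : ℝ) (n : ℕ), POSpa T f S n ε α ≤ Real.exp (n * b + C) := by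
  obtain ⟨b, C, h⟩ := exists_PO_spanning_uniform T hM hε (S ε)
  refine ⟨b, C, fun α n => ?_⟩
  obtain ⟨G, hG, hG', hGs⟩ := h α n
  exact (POSpa_le hG hG').trans hGs

lemma Spa_le_exp_mul_POSpa [CompactSpace X] (hM : ∀ x, |f x| ≤ M) {ε δ α : ℝ} (hε : 0 < ε)
    (hα : 0 ≤ α) (hs : 0 ≤ S ε) (hδ : ∀ x y, dist x y ≤ ε → |f x - f y| ≤ δ) (n : ℕ) :
    Spa T f S n (2 * ε) ≤
      Real.exp (n * (S ε * δ + |S (2 * ε) - S ε| * M)) * POSpa T f S n ε α := by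
  obtain ⟨b, C, h⟩ := exists_PO_spanning_uniform T hM hε (S ε)
  obtain ⟨G, hG, hG', -⟩ := h α n
  rw [← div_le_iff₀' (Real.exp_pos _)]
  refine le_csInf ⟨_, G, hG, hG', rfl⟩ ?_
  rintro _ ⟨G, -, hG', rfl⟩
  rw [div_le_iff₀' (Real.exp_pos _)]
  obtain ⟨F, hF, hFs⟩ := exists_spanning_sum_le (t := S (2 * ε)) hα hM hδ hs n hG'
  exact (Spa_le hF).trans hFs

lemma limsup_Spa_le_limsup_POSpa [CompactSpace X] [Nonempty X] (hM : ∀ x, |f x| ≤ M) {ε δ : ℝ}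
    (hε : 0 < ε) (hs : 0 ≤ S ε) (hδ : ∀ x y, dist x y ≤ ε → |f x - f y| ≤ δ) :
    limsup (fun n : ℕ => Real.log (Spa T f S n (2 * ε)) / n) atTop ≤
      limsup (fun α : ℝ => limsup (fun n : ℕ => Real.log (POSpa T f S n ε α) / n) atTop)
        (𝓝[>] 0) + (S ε * δ + |S (2 * ε) - S ε| * M) := by
  set E := S ε * δ + |S (2 * ε) - S ε| * M with hE
  obtain ⟨b, C, hup⟩ := exists_POSpa_le_exp (T := T) (S := S) hM hε
  have hbdd : IsBoundedUnder (· ≤ ·) (𝓝[>] (0 : ℝ))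
      fun α : ℝ => limsup (fun n : ℕ => Real.log (POSpa T f S n ε α) / n) atTop := by
    refine isBoundedUnder_of_eventually_le (a := b) ?_
    filter_upwards [self_mem_nhdsWithin] with α hα
    exact limsup_log_div_le (exp_neg_le_POSpa hM hε (le_of_lt hα)) (hup α)
  rw [← sub_le_iff_le_add]
  refine le_limsup_of_frequently_le (Eventually.frequently ?_) hbdd
  filter_upwards [self_mem_nhdsWithin] with α (hα : 0 < α)
  have hlow := fun n => exp_neg_le_POSpa (T := T) (S := S) hM hε hα.le n
  have hlow' := fun n => exp_neg_le_Spa (T := T) (S := S) hM (show 0 < 2 * ε by positivity) n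
  have hb := isBoundedUnder_le_log_div hlow (hup α)
  have hb' := (isBoundedUnder_ge_log_div hlow).isCoboundedUnder_le
  obtain ⟨B, hB⟩ := hb.eventually_le
  have hEb := hB.mono fun n h => add_le_add_right h E
  rw [sub_le_iff_le_add', ← limsup_const_add atTop _ E hb hb']
  refine limsup_le_limsup ?_ (isBoundedUnder_ge_log_div hlow').isCoboundedUnder_le
    (isBoundedUnder_of_eventually_le hEb)
  filter_upwards [eventually_gt_atTop 0] with n hn
  have hn' : (0 : ℝ) < n := by exact_mod_cast hn
  have h1 := Real.log_le_log ((Real.exp_pos _).trans_le (hlow' n))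
    (Spa_le_exp_mul_POSpa (T := T) hM hε hα.le hs hδ n)
  rw [Real.log_mul (Real.exp_pos _).ne' ((Real.exp_pos _).trans_le (hlow n)).ne',
    Real.log_exp] at h1
  rw [div_le_iff₀ hn', add_mul, div_mul_cancel₀ _ hn'.ne']
  linarith

lemma limsup_POSpa_le_limsup_Spa [CompactSpace X] [Nonempty X] (hT : Continuous T)
    (hM : ∀ x, |f x| ≤ M) {ε ε' δ : ℝ} (hε : 0 < ε) (hεε' : 4 * ε < ε') (hs : 0 ≤ S ε)
    (hδ : ∀ x y, dist x y ≤ 2 * ε → |f x - f y| ≤ δ) :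
    limsup (fun α : ℝ => limsup (fun n : ℕ => Real.log (POSpa T f S n ε' α) / n) atTop)
        (𝓝[>] 0) ≤
      limsup (fun n : ℕ => Real.log (Spa T f S n ε) / n) atTop +
        (S ε * δ + |S ε' - S ε| * M) := by
  have hε' : 0 < ε' := by linarith
  set L := limsup (fun n : ℕ => Real.log (Spa T f S n ε) / n) atTop with hL
  refine le_of_forall_pos_le_add fun η hη => ?_
  obtain ⟨b, C, hup⟩ := exists_POSpa_le_exp (T := T) (S := S) hM hε'
  obtain ⟨b', C', hup'⟩ := exists_Spa_le_exp (T := T) (S := S) hM hε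
  have hlow' := fun n => exp_neg_le_Spa (T := T) (S := S) hM hε n
  obtain ⟨m, hLm, hm⟩ := ((eventually_lt_of_limsup_lt (lt_add_of_pos_right L hη)
    (isBoundedUnder_le_log_div hlow' hup')).and (eventually_gt_atTop 0)).exists
  have hm' : (0 : ℝ) < m := by exact_mod_cast hm
  rw [div_lt_iff₀ hm', Real.log_lt_iff_lt_exp ((Real.exp_pos _).trans_le (hlow' m))] at hLm
  obtain ⟨b₀, C₀, h₀⟩ := exists_spanning_uniform T hM hε (S ε)
  obtain ⟨F₀, hF₀, -⟩ := h₀ m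
  rw [Spa] at hLm
  obtain ⟨_, ⟨F, hF, rfl⟩, hFs⟩ := exists_lt_of_csInf_lt (by exact ⟨_, F₀, hF₀, rfl⟩) hLm
  have hbdd : IsBoundedUnder (· ≥ ·) (𝓝[>] (0 : ℝ))
      fun α : ℝ => limsup (fun n : ℕ => Real.log (POSpa T f S n ε' α) / n) atTop := by
    refine isBoundedUnder_of_eventually_ge (a := -(|S ε'| * M)) ?_
    filter_upwards [self_mem_nhdsWithin] with α hα
    exact neg_le_limsup_log_div (exp_neg_le_POSpa hM hε' (le_of_lt hα)) (hup α)
  refine limsup_le_of_le hbdd.isCoboundedUnder_le ?_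
  filter_upwards [eventually_shadow hT m hε, self_mem_nhdsWithin] with α hsh (hα : 0 < α)
  have key := fun n : ℕ =>
    exists_PO_spanning_sum_le (t := S ε') hM hδ hs hεε' hm hsh hF hFs.le n
  have hle := limsup_log_div_le (exp_neg_le_POSpa (S := S) hM hε' hα.le) fun n => by
    obtain ⟨G, hG, hG', hGs⟩ := key n
    exact (POSpa_le hG hG').trans hGs
  rw [mul_div_cancel_right₀ _ hm'.ne'] at hle
  linarith

end Pressure

lemma csInf_eq_of_forall_add_mem_s4 {A B : Set ℝ} (hAB : ∀ a ∈ A, ∀ δ > 0, a + δ ∈ B)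
    (hBA : ∀ b ∈ B, ∀ δ > 0, b + δ ∈ A) : sInf A = sInf B := by
  have aux : ∀ {A B : Set ℝ}, (∀ a ∈ A, ∀ δ > 0, a + δ ∈ B) →
      lowerBounds B ⊆ lowerBounds A := fun h b hb a ha =>
    le_of_forall_pos_le_add fun δ hδ => hb (h a ha δ hδ)
  have hlb : lowerBounds A = lowerBounds B := (aux hBA).antisymm (aux hAB)
  rcases A.eq_empty_or_nonempty with rfl | ⟨a, ha⟩
  · have hB : B = ∅ := eq_empty_of_forall_notMem fun b hb => by simpa using hBA b hb 1 one_pos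
    rw [hB]
  have hB : B.Nonempty := ⟨_, hAB a ha 1 one_pos⟩
  by_cases hbdd : BddBelow A
  · have hbdd' : BddBelow B := by rwa [BddBelow, ← hlb]
    exact (isGLB_csInf ⟨a, ha⟩ hbdd).unique (by
      rw [IsGLB, hlb]; exact isGLB_csInf hB hbdd')
  · have hbdd' : ¬BddBelow B := by rwa [BddBelow, ← hlb]
    rw [Real.sInf_of_not_bddBelow hbdd, Real.sInf_of_not_bddBelow hbdd']

/-- Comparison of growth rates at comparable scales, relative to a scale function. -/
lemma eventually_div_le_add {S g h : ℝ → ℝ} {l M : ℝ} (hl : 0 < l)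
    (hSpos : ∀ x : ℝ, 0 < x → x < 1 → 0 < S x)
    (hS : Tendsto (fun x => S (l * x) / S x) (𝓝[>] 0) (𝓝 1))
    (hgh : ∀ δ > 0, ∀ᶠ u in 𝓝[>] (0 : ℝ),
      g u ≤ h (l * u) + (S (l * u) * δ + |S u - S (l * u)| * M))
    {a : ℝ} (ha : ∀ᶠ u in 𝓝[>] (0 : ℝ), h u / S u ≤ a) {δ : ℝ} (hδ : 0 < δ) :
    ∀ᶠ u in 𝓝[>] (0 : ℝ), g u / S u ≤ a + δ := by
  have hlu : Tendsto (fun u => l * u) (𝓝[>] (0 : ℝ)) (𝓝[>] 0) := by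
    refine tendsto_nhdsWithin_iff.2 ⟨?_, ?_⟩
    · simpa using ((continuous_const_mul l).tendsto 0).mono_left nhdsWithin_le_nhds
    · filter_upwards [self_mem_nhdsWithin] with u hu using mul_pos hl hu
  have hlim : Tendsto (fun u => S (l * u) / S u * a + (S (l * u) / S u * (δ / 2) +
      |1 - S (l * u) / S u| * M)) (𝓝[>] 0) (𝓝 (1 * a + (1 * (δ / 2) + |1 - 1| * M))) :=
    (hS.mul_const a).add ((hS.mul_const _).add (((tendsto_const_nhds.sub hS).abs).mul_const M))
  have hlt : 1 * a + (1 * (δ / 2) + |(1 : ℝ) - 1| * M) < a + δ := by simp; linarith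
  have hI : ∀ᶠ u in 𝓝[>] (0 : ℝ), u ∈ Ioo (0 : ℝ) 1 := Ioo_mem_nhdsGT one_pos
  filter_upwards [hgh (δ / 2) (half_pos hδ), hlu.eventually ha, hlim.eventually (gt_mem_nhds hlt),
    hI, hlu.eventually hI] with u h1 h2 h3 h4 h5
  have hSu := hSpos u h4.1 h4.2
  have hSlu := hSpos _ h5.1 h5.2
  rw [div_le_iff₀ hSlu] at h2
  refine le_trans ?_ h3.le
  rw [div_le_iff₀ hSu]
  have h6 : |1 - S (l * u) / S u| * S u = |S u - S (l * u)| := by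
    rw [← abs_of_pos hSu, ← abs_mul, abs_of_pos hSu, sub_mul, div_mul_cancel₀ _ hSu.ne', one_mul]
  have h7 : (S (l * u) / S u * a + (S (l * u) / S u * (δ / 2) +
      |1 - S (l * u) / S u| * M)) * S u =
      S (l * u) * a + (S (l * u) * (δ / 2) + |S u - S (l * u)| * M) := by
    rw [← h6]; field_simp
  rw [h7]
  linarith

lemma exists_forall_abs_sub_le [MetricSpace X] [CompactSpace X] {f : X → ℝ} (hf : Continuous f)
    {δ : ℝ} (hδ : 0 < δ) : ∃ ρ > 0, ∀ x y, dist x y ≤ ρ → |f x - f y| ≤ δ := by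
  obtain ⟨ρ, hρ, h⟩ := Metric.uniformContinuous_iff.1
    (CompactSpace.uniformContinuous_of_continuous hf) δ hδ
  exact ⟨ρ / 2, half_pos hρ, fun x y hxy => (h (hxy.trans_lt (half_lt_self hρ))).le⟩

/-- the scaled pressure equals the scaled pressure with respect to
pseudo-orbits (no Lipschitz assumption on `T`). -/
theorem Sdim_eq_PSdim [MetricSpace X] [CompactSpace X] (T : X → X) (hT : Continuous T)
    (f : X → ℝ) (hf : Continuous f) (S : ℝ → ℝ)
    (hSpos : ∀ x : ℝ, 0 < x → x < 1 → 0 < S x)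
    (hSscale : ∀ l : ℝ, 0 < l →
      Tendsto (fun x => S (l * x) / S x) (nhdsWithin 0 (Set.Ioi 0)) (nhds 1)) :
    Sdim T f S = PSdim T f S := by
  rcases isEmpty_or_nonempty X with hX | hX
  · have h1 : ∀ n ε, Spa T f S n ε = 0 := fun n ε => by simp [Spa, Finset.eq_empty_of_isEmpty]
    have h2 : ∀ n ε α, POSpa T f S n ε α = 0 := fun n ε α => by
      simp [POSpa, Finset.eq_empty_of_isEmpty]
    simp [Sdim, PSdim, h1, h2]
  obtain ⟨M, hM⟩ : ∃ M, ∀ x, |f x| ≤ M := by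
    obtain ⟨M, hM⟩ := isCompact_univ.exists_bound_of_continuousOn hf.continuousOn
    exact ⟨M, fun x => hM x (mem_univ x)⟩
  rw [Sdim, PSdim, limsup_eq, limsup_eq]
  refine csInf_eq_of_forall_add_mem_s4 (fun a ha δ hδ => ?_) (fun a ha δ hδ => ?_)
  · refine eventually_div_le_add (l := 1 / 5) (M := M) (by norm_num) hSpos
      (hSscale _ (by norm_num)) (fun δ hδ => ?_) ha hδ
    obtain ⟨ρ, hρ, hfρ⟩ := exists_forall_abs_sub_le hf hδ
    filter_upwards [Ioo_mem_nhdsGT one_pos, Ioo_mem_nhdsGT hρ] with u hu hu'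
    exact limsup_POSpa_le_limsup_Spa hT hM (by linarith [hu.1]) (by linarith [hu.1])
      (hSpos _ (by linarith [hu.1]) (by linarith [hu.1, hu.2])).le
      fun x y hxy => hfρ x y (by linarith [hu'.1, hu'.2])
  · refine eventually_div_le_add (l := 1 / 2) (M := M) (by norm_num) hSpos
      (hSscale _ (by norm_num)) (fun δ hδ => ?_) ha hδ
    obtain ⟨ρ, hρ, hfρ⟩ := exists_forall_abs_sub_le hf hδ
    filter_upwards [Ioo_mem_nhdsGT one_pos, Ioo_mem_nhdsGT hρ] with u hu hu'
    have h := limsup_Spa_le_limsup_POSpa (T := T) (S := S) (ε := 1 / 2 * u) hM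
      (by linarith [hu.1]) (hSpos _ (by linarith [hu.1]) (by linarith [hu.1, hu.2])).le
      fun x y hxy => hfρ x y (by linarith [hu'.1, hu'.2])
    rwa [show 2 * (1 / 2 * u) = u by ring] at h
end

section
/- Let (X,d) be a compact metric space, T : X → X a continuous map and f : X → ℝ continuous. Then PFK(X,T,f) = lim_{ε→0} limsup_{n→∞} (1/n) log FKsr_{n,ε}(f); that is, the topological pressure with respect to the Feldman-Katok metric defined via FK-spanning sets coincides with the quantity defined via FK-separated sets. -/
open Filter Metric Set Topology

variable {X : Type*}

noncomputable def matchMax [MetricSpace X] (T : X → X) (n : ℕ) (δ : ℝ) (x y : X) : ℕ :=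
  sSup { k : ℕ | ∃ a b : ℕ → ℕ,
      StrictMonoOn a (Set.Iio k) ∧ StrictMonoOn b (Set.Iio k) ∧
      (∀ t < k, a t < n ∧ b t < n) ∧
      ∀ t < k, dist (T^[a t] x) (T^[b t] y) < δ }

noncomputable def fbar [MetricSpace X] (T : X → X) (n : ℕ) (δ : ℝ) (x y : X) : ℝ :=
  1 - (matchMax T n δ x y : ℝ) / n

noncomputable def dFK [MetricSpace X] (T : X → X) (n : ℕ) (x y : X) : ℝ :=
  sInf { δ : ℝ | 0 < δ ∧ fbar T n δ x y < δ }

noncomputable def FKsp [MetricSpace X] (T : X → X) (f : X → ℝ) (n : ℕ) (ε : ℝ) : ℝ :=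
  sInf { r : ℝ | ∃ F : Finset X, (∀ x : X, ∃ y ∈ F, dFK T n x y ≤ ε) ∧
      r = ∑ y ∈ F, Real.exp (∑ i ∈ Finset.range n, f (T^[i] y)) }

noncomputable def FKsr [MetricSpace X] (T : X → X) (f : X → ℝ) (n : ℕ) (ε : ℝ) : ℝ :=
  sSup { r : ℝ | ∃ E : Finset X, (∀ x ∈ E, ∀ y ∈ E, x ≠ y → ε < dFK T n x y) ∧
      r = ∑ x ∈ E, Real.exp (∑ i ∈ Finset.range n, f (T^[i] x)) }

noncomputable def PFK [MetricSpace X] (T : X → X) (f : X → ℝ) : ℝ :=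
  limsup (fun ε : ℝ => limsup (fun n : ℕ => Real.log (FKsp T f n ε) / n) atTop)
    (nhdsWithin 0 (Set.Ioi 0))

namespace FeldmanKatok

variable {T : X → X} {n k : ℕ}

/-- The sum of the exponentials of the Birkhoff sums of `f` over a finite set. -/
noncomputable def expSum (T : X → X) (f : X → ℝ) (n : ℕ) (F : Finset X) : ℝ :=
  ∑ y ∈ F, Real.exp (∑ i ∈ Finset.range n, f (T^[i] y))

lemma expSum_nonneg (T : X → X) (f : X → ℝ) (n : ℕ) (F : Finset X) : 0 ≤ expSum T f n F :=
  Finset.sum_nonneg fun _ _ => (Real.exp_pos _).le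

lemma expSum_le {f : X → ℝ} {C : ℝ} (hC : ∀ x, |f x| ≤ C) (F : Finset X) :
    expSum T f n F ≤ F.card * Real.exp (n * C) := by
  rw [← nsmul_eq_mul]
  refine Finset.sum_le_card_nsmul _ _ _ fun x _ => Real.exp_le_exp.2 ?_
  simpa using Finset.sum_le_card_nsmul (Finset.range n) (fun i => f (T^[i] x)) C
    fun i _ => (abs_le.1 (hC _)).2

lemma le_expSum {f : X → ℝ} {C : ℝ} (hC : ∀ x, |f x| ≤ C) {F : Finset X} (hF : F.Nonempty) :
    Real.exp (n * -C) ≤ expSum T f n F := by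
  obtain ⟨x, hx⟩ := hF
  refine le_trans (Real.exp_le_exp.2 ?_) (Finset.single_le_sum
    (f := fun y => Real.exp (∑ i ∈ Finset.range n, f (T^[i] y)))
    (fun _ _ => (Real.exp_pos _).le) hx)
  simpa using Finset.card_nsmul_le_sum (Finset.range n) (fun i => f (T^[i] x)) (-C)
    fun i _ => (abs_le.1 (hC _)).1

variable [MetricSpace X] {x y z : X}

/-- There is an `(n, δ)`-match of `x` and `y` of size `k`. -/
def HasMatch (T : X → X) (n : ℕ) (δ : ℝ) (x y : X) (k : ℕ) : Prop :=
  ∃ a b : ℕ → ℕ, StrictMonoOn a (Set.Iio k) ∧ StrictMonoOn b (Set.Iio k) ∧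
    (∀ t < k, a t < n ∧ b t < n) ∧ ∀ t < k, dist (T^[a t] x) (T^[b t] y) < δ

lemma card_image_range {a : ℕ → ℕ} (ha : StrictMonoOn a (Set.Iio k)) :
    ((Finset.range k).image a).card = k := by
  rw [Finset.card_image_of_injOn, Finset.card_range]
  simpa using ha.injOn

lemma image_range_subset {a : ℕ → ℕ} (ha : ∀ t < k, a t < n) :
    (Finset.range k).image a ⊆ Finset.range n := by
  intro i hi
  obtain ⟨t, ht, rfl⟩ := Finset.mem_image.1 hi
  exact Finset.mem_range.2 (ha t (Finset.mem_range.1 ht))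

lemma HasMatch.le {δ : ℝ} (h : HasMatch T n δ x y k) : k ≤ n := by
  obtain ⟨a, b, ha, -, hn, -⟩ := h
  simpa [card_image_range ha] using
    Finset.card_le_card (image_range_subset fun t ht => (hn t ht).1)

lemma HasMatch.le_matchMax {δ : ℝ} (h : HasMatch T n δ x y k) : k ≤ matchMax T n δ x y :=
  le_csSup ⟨n, fun _ hk => HasMatch.le hk⟩ h

lemma hasMatch_matchMax (T : X → X) (n : ℕ) (δ : ℝ) (x y : X) :
    HasMatch T n δ x y (matchMax T n δ x y) := by
  have h : matchMax T n δ x y ∈ {k | HasMatch T n δ x y k} :=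
    Nat.sSup_mem ⟨0, id, id, by simp [StrictMonoOn], by simp [StrictMonoOn], by simp, by simp⟩
      ⟨n, fun _ hk => HasMatch.le hk⟩
  exact h

lemma HasMatch.mono {δ δ' : ℝ} (h : HasMatch T n δ x y k) (hδ : δ ≤ δ') :
    HasMatch T n δ' x y k := by
  obtain ⟨a, b, ha, hb, hn, hd⟩ := h
  exact ⟨a, b, ha, hb, hn, fun t ht => (hd t ht).trans_le hδ⟩

lemma HasMatch.symm {δ : ℝ} (h : HasMatch T n δ x y k) : HasMatch T n δ y x k := by
  obtain ⟨a, b, ha, hb, hn, hd⟩ := h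
  exact ⟨b, a, hb, ha, fun t ht => (hn t ht).symm, fun t ht => by
    rw [dist_comm]; exact hd t ht⟩

lemma hasMatch_of_forall_dist_lt {δ : ℝ} (h : ∀ i < n, dist (T^[i] x) (T^[i] y) < δ) :
    HasMatch T n δ x y n :=
  ⟨id, id, strictMono_id.strictMonoOn _, strictMono_id.strictMonoOn _, by simp, h⟩

lemma HasMatch.trans {δ₁ δ₂ : ℝ} {k₁ k₂ : ℕ} (h₁ : HasMatch T n δ₁ x y k₁)
    (h₂ : HasMatch T n δ₂ y z k₂) : ∃ k, k₁ + k₂ ≤ k + n ∧ HasMatch T n (δ₁ + δ₂) x z k := by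
  obtain ⟨a₁, b₁, ha₁, hb₁, hn₁, hd₁⟩ := h₁
  obtain ⟨a₂, b₂, ha₂, hb₂, hn₂, hd₂⟩ := h₂
  set I := (Finset.range k₁).image b₁ with hI
  set J := (Finset.range k₂).image a₂ with hJ
  have hcard : k₁ + k₂ ≤ (I ∩ J).card + n := by
    have hu : (I ∪ J).card ≤ n := by
      simpa using Finset.card_le_card (Finset.union_subset
        (image_range_subset fun t ht => (hn₁ t ht).2)
        (image_range_subset fun t ht => (hn₂ t ht).1))
    have := Finset.card_union_add_card_inter I J
    rw [hI, hJ, card_image_range hb₁, card_image_range ha₂, ← hI, ← hJ] at this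
    omega
  let e := (I ∩ J).orderEmbOfFin rfl
  have he : ∀ t : Fin (I ∩ J).card, ∃ p q, p < k₁ ∧ q < k₂ ∧ b₁ p = e t ∧ a₂ q = e t := by
    intro t
    have ht := Finset.orderEmbOfFin_mem (I ∩ J) rfl t
    obtain ⟨hp, hq⟩ := Finset.mem_inter.1 ht
    obtain ⟨p, hp, hp'⟩ := Finset.mem_image.1 hp
    obtain ⟨q, hq, hq'⟩ := Finset.mem_image.1 hq
    exact ⟨p, q, Finset.mem_range.1 hp, Finset.mem_range.1 hq, hp', hq'⟩
  choose p q hp hq hbp haq using he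
  have hpm : StrictMono p := fun s t hst => (hb₁.lt_iff_lt (hp s) (hp t)).1 (by
    rw [hbp, hbp]; exact e.strictMono hst)
  have hqm : StrictMono q := fun s t hst => (ha₂.lt_iff_lt (hq s) (hq t)).1 (by
    rw [haq, haq]; exact e.strictMono hst)
  refine ⟨_, hcard, fun t => if h : t < (I ∩ J).card then a₁ (p ⟨t, h⟩) else 0,
    fun t => if h : t < (I ∩ J).card then b₂ (q ⟨t, h⟩) else 0, ?_, ?_, ?_, ?_⟩
  · intro s hs t ht hst
    simp only [Set.mem_Iio] at hs ht
    simp only [hs, ht, dite_true]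
    exact ha₁ (hp _) (hp _) (hpm hst)
  · intro s hs t ht hst
    simp only [Set.mem_Iio] at hs ht
    simp only [hs, ht, dite_true]
    exact hb₂ (hq _) (hq _) (hqm hst)
  · intro t ht
    simp only [ht, dite_true]
    exact ⟨(hn₁ _ (hp _)).1, (hn₂ _ (hq _)).2⟩
  · intro t ht
    simp only [ht, dite_true]
    have h₁ := hd₁ _ (hp ⟨t, ht⟩)
    have h₂ := hd₂ _ (hq ⟨t, ht⟩)
    rw [hbp] at h₁
    rw [haq] at h₂
    exact (dist_triangle _ _ _).trans_lt (add_lt_add h₁ h₂)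

lemma HasMatch.dFK_le (hn : n ≠ 0) {δ : ℝ} (hδ : 0 < δ) (h : HasMatch T n δ x y k)
    (hk : (1 - δ) * n < k) : dFK T n x y ≤ δ := by
  refine csInf_le ⟨0, fun _ h => h.1.le⟩ ⟨hδ, ?_⟩
  have hn' : (0 : ℝ) < n := by positivity
  have h1 : (k : ℝ) ≤ matchMax T n δ x y := by exact_mod_cast h.le_matchMax
  have h2 : 1 - δ < (matchMax T n δ x y : ℝ) / n := by
    rw [lt_div_iff₀ hn']; linarith
  unfold fbar
  linarith

lemma exists_hasMatch_of_dFK_lt (hn : n ≠ 0) {δ : ℝ} (h : dFK T n x y < δ) :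
    ∃ k : ℕ, HasMatch T n δ x y k ∧ (1 - δ) * n < k := by
  have hn' : (0 : ℝ) < n := by positivity
  obtain ⟨δ', ⟨-, hδ'⟩, hlt⟩ := exists_lt_of_csInf_lt (by
    refine ⟨2, two_pos, ?_⟩
    have : 0 ≤ (matchMax T n 2 x y : ℝ) / n := by positivity
    unfold fbar
    linarith) h
  refine ⟨_, (hasMatch_matchMax T n δ' x y).mono hlt.le, ?_⟩
  unfold fbar at hδ'
  rw [← lt_div_iff₀ hn']
  linarith

lemma dFK_nonneg : 0 ≤ dFK T n x y := Real.sInf_nonneg fun _ h => h.1.le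

lemma dFK_symm (hn : n ≠ 0) : dFK T n x y = dFK T n y x := by
  have key : ∀ u v : X, dFK T n u v ≤ dFK T n v u := fun u v =>
    le_of_forall_gt_imp_ge_of_dense fun δ hδ => by
      obtain ⟨k, h, hk⟩ := exists_hasMatch_of_dFK_lt hn hδ
      exact h.symm.dFK_le hn (dFK_nonneg.trans_lt hδ) hk
  exact (key x y).antisymm (key y x)

lemma dFK_triangle (hn : n ≠ 0) : dFK T n x z ≤ dFK T n x y + dFK T n y z := by
  refine le_of_forall_pos_le_add fun η hη => ?_
  obtain ⟨k₁, h₁, hk₁⟩ := exists_hasMatch_of_dFK_lt hn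
    (lt_add_of_pos_right (dFK T n x y) (half_pos hη))
  obtain ⟨k₂, h₂, hk₂⟩ := exists_hasMatch_of_dFK_lt hn
    (lt_add_of_pos_right (dFK T n y z) (half_pos hη))
  obtain ⟨k, hk, h⟩ := h₁.trans h₂
  have hk' : (k₁ : ℝ) + k₂ ≤ k + n := by exact_mod_cast hk
  have h0 : 0 ≤ dFK T n x y := dFK_nonneg
  have h0' : 0 ≤ dFK T n y z := dFK_nonneg
  refine (h.dFK_le hn (by linarith) (by linarith)).trans (by linarith)

lemma dFK_le_of_forall_dist_lt (hn : n ≠ 0) {δ : ℝ} (hδ : 0 < δ)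
    (h : ∀ i < n, dist (T^[i] x) (T^[i] y) < δ) : dFK T n x y ≤ δ :=
  (hasMatch_of_forall_dist_lt h).dFK_le hn hδ (by
    have : (0 : ℝ) < n := by positivity
    nlinarith)

lemma dFK_self (hn : n ≠ 0) : dFK T n x x = 0 :=
  le_antisymm (le_of_forall_gt_imp_ge_of_dense fun δ hδ =>
    dFK_le_of_forall_dist_lt hn hδ (by simpa using fun _ _ => hδ)) dFK_nonneg

lemma abs_sum_sub_sum_le {g : ℕ → ℝ} {C : ℝ} (hg : ∀ i, |g i| ≤ C) {a : ℕ → ℕ}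
    (ha : StrictMonoOn a (Set.Iio k)) (hn : ∀ t < k, a t < n) :
    |∑ i ∈ Finset.range n, g i - ∑ t ∈ Finset.range k, g (a t)| ≤ (n - k) * C := by
  have hsub := image_range_subset hn
  have hinj : Set.InjOn a (Finset.range k) := by simpa using ha.injOn
  rw [← Finset.sum_image (f := g) hinj, ← Finset.sum_sdiff hsub, add_sub_cancel_right]
  refine (Finset.abs_sum_le_sum_abs _ _).trans ((Finset.sum_le_card_nsmul _ _ C
    fun i _ => hg i).trans_eq ?_)
  have hle := Finset.card_le_card hsub
  rw [Finset.card_sdiff_of_subset hsub, nsmul_eq_mul, Nat.cast_sub hle, card_image_range ha,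
    Finset.card_range]

/-- Points which are close in the Feldman-Katok metric have close Birkhoff averages. -/
lemma exists_birkhoff_le [CompactSpace X] (T : X → X) {f : X → ℝ} (hf : Continuous f) {η : ℝ}
    (hη : 0 < η) : ∃ ε₀ > 0, ∀ ε < ε₀, ∀ n : ℕ, n ≠ 0 → ∀ x y, dFK T n x y ≤ ε →
      ∑ i ∈ Finset.range n, f (T^[i] x) ≤ ∑ i ∈ Finset.range n, f (T^[i] y) + n * η := by
  obtain ⟨C₀, hC₀⟩ := isCompact_univ.exists_bound_of_continuousOn hf.continuousOn
  set C := max C₀ 1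
  have hC : ∀ x, |f x| ≤ C := fun x => (hC₀ x trivial).trans (le_max_left _ _)
  have hCpos : 0 < C := one_pos.trans_le (le_max_right _ _)
  obtain ⟨δ, hδ, hfδ⟩ := Metric.uniformContinuous_iff.1
    (CompactSpace.uniformContinuous_of_continuous hf) (η / 2) (half_pos hη)
  have hε₀ : 0 < min δ (η / (4 * C)) := by positivity
  refine ⟨_, hε₀, fun ε hε n hn x y hxy => ?_⟩
  obtain ⟨k, ⟨a, b, ha, hb, hab, hd⟩, hk⟩ := exists_hasMatch_of_dFK_lt hn (hxy.trans_lt hε)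
  have hkn : (k : ℝ) ≤ n := by
    exact_mod_cast HasMatch.le ⟨a, b, ha, hb, hab, hd⟩
  have h₁ := (abs_le.1 (abs_sum_sub_sum_le (g := fun i => f (T^[i] x)) (fun _ => hC _) ha
    fun t ht => (hab t ht).1)).2
  have h₂ := (abs_le.1 (abs_sum_sub_sum_le (g := fun i => f (T^[i] y)) (fun _ => hC _) hb
    fun t ht => (hab t ht).2)).1
  have h₃ : ∑ t ∈ Finset.range k, f (T^[a t] x) ≤
      ∑ t ∈ Finset.range k, f (T^[b t] y) + k * (η / 2) := by
    have : ∑ t ∈ Finset.range k, f (T^[a t] x) ≤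
        ∑ t ∈ Finset.range k, (f (T^[b t] y) + η / 2) := by
      refine Finset.sum_le_sum fun t ht => ?_
      have := hfδ ((hd t (Finset.mem_range.1 ht)).trans_le (min_le_left _ _))
      rw [Real.dist_eq] at this
      linarith [(abs_lt.1 this).2]
    simpa [Finset.sum_add_distrib] using this
  have h₄ : (n - k) * C ≤ n * (η / 4) := by
    have h : (n : ℝ) - k ≤ n * (η / (4 * C)) := by
      have := mul_le_mul_of_nonneg_left (min_le_right δ (η / (4 * C))) (Nat.cast_nonneg (α := ℝ) n)
      linarith
    calc (n - k) * C ≤ n * (η / (4 * C)) * C := mul_le_mul_of_nonneg_right h hCpos.le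
      _ = n * (η / 4) := by field_simp
  have h₅ : k * (η / 2) ≤ n * (η / 2) := by gcongr
  linarith

def IsSpanning (T : X → X) (n : ℕ) (ε : ℝ) (F : Finset X) : Prop :=
  ∀ x : X, ∃ y ∈ F, dFK T n x y ≤ ε

def IsSeparated (T : X → X) (n : ℕ) (ε : ℝ) (E : Finset X) : Prop :=
  ∀ x ∈ E, ∀ y ∈ E, x ≠ y → ε < dFK T n x y

/-- A cover by `N` small balls gives spanning sets of cardinality at most `N ^ n`. -/
lemma exists_isSpanning_card_le [CompactSpace X] (T : X → X) {ε : ℝ} (hε : 0 < ε) :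
    ∃ N : ℕ, ∀ n : ℕ, n ≠ 0 → ∃ F : Finset X, IsSpanning T n ε F ∧ F.card ≤ N ^ n := by
  classical
  obtain ⟨s, -, hsfin, hs⟩ := Metric.finite_approx_of_totallyBounded
    (isCompact_univ (X := X)).totallyBounded (ε / 2) (half_pos hε)
  have : Fintype s := hsfin.fintype
  refine ⟨Fintype.card s, fun n hn => ?_⟩
  have hcode : ∀ x : X, ∃ c : s, dist x c < ε / 2 := fun x => by
    simpa using hs (Set.mem_univ x)
  choose c hc using hcode
  let word : X → Fin n → s := fun x i => c (T^[i] x)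
  choose g hg using fun w : Set.range word => w.2
  have : Fintype (Set.range word) := (Set.toFinite _).fintype
  refine ⟨Finset.univ.image g, fun x => ⟨g ⟨word x, x, rfl⟩, by simp, ?_⟩, ?_⟩
  · refine dFK_le_of_forall_dist_lt hn hε fun i hi => ?_
    have h := congrFun (hg ⟨word x, x, rfl⟩) ⟨i, hi⟩
    simp only [word] at h
    have h₁ := hc (T^[i] x)
    have h₂ := hc (T^[i] (g ⟨word x, x, rfl⟩))
    simp only [word] at h₂
    rw [h] at h₂
    linarith [dist_triangle_right (T^[i] x) (T^[i] (g ⟨word x, x, rfl⟩)) (c (T^[i] x) : X)]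
  · refine Finset.card_image_le.trans ?_
    exact (Fintype.card_le_of_injective _ Subtype.val_injective).trans_eq
      (by rw [Fintype.card_fun, Fintype.card_fin])

lemma exists_injOn_of_isSeparated (hn : n ≠ 0) {ε : ℝ} {E F : Finset X}
    (hE : IsSeparated T n (2 * ε) E) (hF : IsSpanning T n ε F) :
    ∃ φ : X → X, (∀ x, φ x ∈ F) ∧ (∀ x, dFK T n x (φ x) ≤ ε) ∧ Set.InjOn φ E := by
  choose φ hφF hφ using hF
  refine ⟨φ, hφF, hφ, fun x hx y hy hxy => by_contra fun hne => ?_⟩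
  have h₁ := dFK_triangle (T := T) hn (x := x) (y := φ x) (z := y)
  have h₂ := hφ y
  rw [dFK_symm hn, ← hxy] at h₂
  linarith [hE x hx y hy hne, hφ x]

lemma card_le_of_isSeparated (hn : n ≠ 0) {ε : ℝ} {E F : Finset X}
    (hE : IsSeparated T n (2 * ε) E) (hF : IsSpanning T n ε F) : E.card ≤ F.card := by
  obtain ⟨φ, hφF, -, hinj⟩ := exists_injOn_of_isSeparated hn hE hF
  exact Finset.card_le_card_of_injOn φ (fun x _ => hφF x) hinj

lemma expSum_le_of_isSeparated (hn : n ≠ 0) {f : X → ℝ} {ε η : ℝ} {E F : Finset X}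
    (hη : ∀ x y, dFK T n x y ≤ ε →
      ∑ i ∈ Finset.range n, f (T^[i] x) ≤ ∑ i ∈ Finset.range n, f (T^[i] y) + n * η)
    (hE : IsSeparated T n (2 * ε) E) (hF : IsSpanning T n ε F) :
    expSum T f n E ≤ Real.exp (n * η) * expSum T f n F := by
  classical
  obtain ⟨φ, hφF, hφ, hinj⟩ := exists_injOn_of_isSeparated hn hE hF
  calc expSum T f n E
      ≤ ∑ x ∈ E, Real.exp (n * η) * Real.exp (∑ i ∈ Finset.range n, f (T^[i] (φ x))) := by
        refine Finset.sum_le_sum fun x _ => ?_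
        rw [← Real.exp_add, Real.exp_le_exp]
        linarith [hη x (φ x) (hφ x)]
    _ = Real.exp (n * η) * expSum T f n (E.image φ) := by
        rw [expSum, Finset.sum_image hinj, Finset.mul_sum]
    _ ≤ Real.exp (n * η) * expSum T f n F := by
        refine mul_le_mul_of_nonneg_left ?_ (Real.exp_pos _).le
        refine Finset.sum_le_sum_of_subset_of_nonneg ?_ fun _ _ _ => (Real.exp_pos _).le
        exact Finset.image_subset_iff.2 fun x _ => hφF x

lemma exists_isSeparated_isSpanning [CompactSpace X] (T : X → X) (hn : n ≠ 0) {ε : ℝ}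
    (hε : 0 < ε) : ∃ E : Finset X, IsSeparated T n ε E ∧ IsSpanning T n ε E := by
  classical
  obtain ⟨N, hN⟩ := exists_isSpanning_card_le T (half_pos hε)
  obtain ⟨F, hF, -⟩ := hN n hn
  let P : ℕ → Prop := fun m => ∃ E : Finset X, IsSeparated T n ε E ∧ E.card = m
  have hbdd : ∀ E, IsSeparated T n ε E → E.card ≤ F.card := fun E hE =>
    card_le_of_isSeparated hn (by rwa [mul_div_cancel₀ _ two_ne_zero]) hF
  obtain ⟨E, hE, hcard⟩ : P (Nat.findGreatest P F.card) :=
    Nat.findGreatest_spec (Nat.zero_le _) ⟨∅, by simp [IsSeparated], rfl⟩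
  refine ⟨E, hE, fun x => by_contra fun hx => ?_⟩
  push Not at hx
  have hxE : x ∉ E := fun h => by linarith [hx x h, dFK_self (T := T) (x := x) hn]
  have hsep : IsSeparated T n ε (insert x E) := by
    intro u hu v hv huv
    rcases Finset.mem_insert.1 hu with rfl | huE <;>
      rcases Finset.mem_insert.1 hv with rfl | hvE
    · exact absurd rfl huv
    · exact hx v hvE
    · rw [dFK_symm hn]; exact hx u huE
    · exact hE u huE v hvE huv
  have := Nat.le_findGreatest (P := P) (hbdd _ hsep) ⟨_, hsep, rfl⟩
  rw [Finset.card_insert_of_notMem hxE] at this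
  omega

lemma FKsp_le {f : X → ℝ} {ε : ℝ} {F : Finset X} (hF : IsSpanning T n ε F) :
    FKsp T f n ε ≤ expSum T f n F :=
  csInf_le ⟨0, by rintro _ ⟨F, -, rfl⟩; exact expSum_nonneg T f n F⟩ ⟨F, hF, rfl⟩

lemma le_FKsp [CompactSpace X] (hn : n ≠ 0) {f : X → ℝ} {ε r : ℝ} (hε : 0 < ε)
    (h : ∀ F, IsSpanning T n ε F → r ≤ expSum T f n F) : r ≤ FKsp T f n ε := by
  obtain ⟨E, -, hE⟩ := exists_isSeparated_isSpanning T hn hε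
  exact le_csInf ⟨_, E, hE, rfl⟩ (by rintro _ ⟨F, hF, rfl⟩; exact h F hF)

lemma FKsr_le {f : X → ℝ} {ε r : ℝ}
    (h : ∀ E, IsSeparated T n ε E → expSum T f n E ≤ r) : FKsr T f n ε ≤ r :=
  csSup_le ⟨_, ∅, by simp, rfl⟩ (by rintro _ ⟨F, hF, rfl⟩; exact h F hF)

lemma bddAbove_expSum_isSeparated [CompactSpace X] (hn : n ≠ 0) {f : X → ℝ}
    (hf : Continuous f) {ε : ℝ} (hε : 0 < ε) :
    BddAbove {r : ℝ | ∃ E : Finset X, IsSeparated T n ε E ∧ r = expSum T f n E} := by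
  obtain ⟨C, hC⟩ := isCompact_univ.exists_bound_of_continuousOn hf.continuousOn
  obtain ⟨N, hN⟩ := exists_isSpanning_card_le T (half_pos hε)
  obtain ⟨F, hF, -⟩ := hN n hn
  refine ⟨F.card * Real.exp (n * C), ?_⟩
  rintro _ ⟨E, hE, rfl⟩
  refine (expSum_le (fun x => hC x trivial) E).trans ?_
  have : E.card ≤ F.card :=
    card_le_of_isSeparated hn (by rwa [mul_div_cancel₀ _ two_ne_zero]) hF
  gcongr

lemma FKsp_le_FKsr [CompactSpace X] (hn : n ≠ 0) {f : X → ℝ} (hf : Continuous f) {ε : ℝ}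
    (hε : 0 < ε) : FKsp T f n ε ≤ FKsr T f n ε := by
  obtain ⟨E, hE, hE'⟩ := exists_isSeparated_isSpanning T hn hε
  exact (FKsp_le hE').trans (le_csSup (bddAbove_expSum_isSeparated hn hf hε) ⟨E, hE, rfl⟩)

lemma FKsr_le_exp_mul_FKsp [CompactSpace X] (hn : n ≠ 0) {f : X → ℝ} {ε η : ℝ} (hε : 0 < ε)
    (hη : ∀ x y, dFK T n x y ≤ ε →
      ∑ i ∈ Finset.range n, f (T^[i] x) ≤ ∑ i ∈ Finset.range n, f (T^[i] y) + n * η) :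
    FKsr T f n (2 * ε) ≤ Real.exp (n * η) * FKsp T f n ε := by
  refine FKsr_le fun E hE => ?_
  rw [← div_le_iff₀' (Real.exp_pos _)]
  refine le_FKsp hn hε fun F hF => ?_
  rw [div_le_iff₀' (Real.exp_pos _)]
  exact expSum_le_of_isSeparated hn hη hE hF

lemma exp_le_FKsp [CompactSpace X] [Nonempty X] (hn : n ≠ 0) {f : X → ℝ} {C ε : ℝ}
    (hC : ∀ x, |f x| ≤ C) (hε : 0 < ε) : Real.exp (n * -C) ≤ FKsp T f n ε :=
  le_FKsp hn hε fun _ hF => le_expSum hC (let ⟨y, hy, _⟩ := hF (Classical.arbitrary X); ⟨y, hy⟩)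

lemma neg_le_log_FKsp_div [CompactSpace X] [Nonempty X] (hn : n ≠ 0) {f : X → ℝ} {C ε : ℝ}
    (hC : ∀ x, |f x| ≤ C) (hε : 0 < ε) : -C ≤ Real.log (FKsp T f n ε) / n := by
  have hn' : (0 : ℝ) < n := by positivity
  rw [le_div_iff₀' hn', ← Real.log_exp (n * -C)]
  exact Real.log_le_log (Real.exp_pos _) (exp_le_FKsp hn hC hε)

lemma FKsp_pos [CompactSpace X] [Nonempty X] (hn : n ≠ 0) {f : X → ℝ} (hf : Continuous f)
    {ε : ℝ} (hε : 0 < ε) : 0 < FKsp T f n ε := by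
  obtain ⟨C, hC⟩ := isCompact_univ.exists_bound_of_continuousOn hf.continuousOn
  exact (Real.exp_pos _).trans_le (exp_le_FKsp hn (fun x => hC x trivial) hε)

lemma log_FKsp_div_le_log_FKsr_div [CompactSpace X] [Nonempty X] (hn : n ≠ 0) {f : X → ℝ}
    (hf : Continuous f) {ε : ℝ} (hε : 0 < ε) :
    Real.log (FKsp T f n ε) / n ≤ Real.log (FKsr T f n ε) / n := by
  gcongr
  · exact FKsp_pos hn hf hε
  · exact FKsp_le_FKsr hn hf hε

lemma log_FKsr_div_le [CompactSpace X] [Nonempty X] (hn : n ≠ 0) {f : X → ℝ}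
    (hf : Continuous f) {ε η : ℝ} (hε : 0 < ε) (hη : ∀ x y, dFK T n x y ≤ ε →
      ∑ i ∈ Finset.range n, f (T^[i] x) ≤ ∑ i ∈ Finset.range n, f (T^[i] y) + n * η) :
    Real.log (FKsr T f n (2 * ε)) / n ≤ Real.log (FKsp T f n ε) / n + η := by
  have hn' : (0 : ℝ) < n := by positivity
  have h2 : 0 < 2 * ε := by positivity
  have h := Real.log_le_log ((FKsp_pos hn hf h2).trans_le (FKsp_le_FKsr hn hf h2))
    (FKsr_le_exp_mul_FKsp hn hε hη)
  rw [Real.log_mul (Real.exp_pos _).ne' (FKsp_pos hn hf hε).ne', Real.log_exp] at h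
  rw [div_add' _ _ _ hn'.ne']
  gcongr
  linarith

lemma exists_log_FKsr_div_le [CompactSpace X] [Nonempty X] (T : X → X) {f : X → ℝ} {C : ℝ}
    (hf : Continuous f) (hC : ∀ x, |f x| ≤ C) {ε : ℝ} (hε : 0 < ε) :
    ∃ B : ℝ, ∀ n : ℕ, n ≠ 0 → Real.log (FKsr T f n ε) / n ≤ B := by
  obtain ⟨N, hN⟩ := exists_isSpanning_card_le T (half_pos hε)
  refine ⟨Real.log N + C, fun n hn => ?_⟩
  have hn' : (0 : ℝ) < n := by positivity
  obtain ⟨F, hF, hcard⟩ := hN n hn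
  have hN0 : N ≠ 0 := by
    rintro rfl
    obtain ⟨y, hy, -⟩ := hF (Classical.arbitrary X)
    rw [zero_pow hn, Nat.le_zero, Finset.card_eq_zero] at hcard
    simp [hcard] at hy
  have hle : FKsr T f n ε ≤ (N : ℝ) ^ n * Real.exp (n * C) := by
    refine FKsr_le fun E hE => (expSum_le hC E).trans ?_
    have : E.card ≤ N ^ n :=
      (card_le_of_isSeparated hn (by rwa [mul_div_cancel₀ _ two_ne_zero]) hF).trans hcard
    gcongr
    exact_mod_cast this
  have h := Real.log_le_log ((FKsp_pos hn hf hε).trans_le (FKsp_le_FKsr hn hf hε)) hle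
  rw [Real.log_mul (by positivity) (Real.exp_pos _).ne', Real.log_exp, Real.log_pow] at h
  rw [div_le_iff₀' hn']
  linarith

/-- Comparison of real `limsup`s that needs no boundedness from above: if `u` is eventually
unbounded above then so is `v`, and both sides take the same default value. -/
lemma limsup_eq_limsup_of_forall_pos {ι : Type*} {l : Filter ι} [l.NeBot] {u v : ι → ℝ} {c : ℝ}
    (hc : ∀ᶠ i in l, c ≤ u i) (huv : ∀ᶠ i in l, u i ≤ v i)
    (hvu : ∀ M η : ℝ, 0 < η → (∀ᶠ i in l, u i ≤ M) → ∀ᶠ i in l, v i ≤ M + η) :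
    limsup u l = limsup v l := by
  simp only [limsup_eq]
  have hsub : {a | ∀ᶠ i in l, v i ≤ a} ⊆ {a | ∀ᶠ i in l, u i ≤ a} := fun a ha => by
    filter_upwards [ha, huv] with i h₁ h₂ using h₂.trans h₁
  have hbdd : BddBelow {a | ∀ᶠ i in l, u i ≤ a} := ⟨c, fun a ha => by
    obtain ⟨i, h₁, h₂⟩ := (hc.and ha).exists
    exact h₁.trans h₂⟩
  rcases Set.eq_empty_or_nonempty {a | ∀ᶠ i in l, u i ≤ a} with h | ⟨M, hM⟩
  · rw [h, Set.subset_empty_iff.1 (hsub.trans h.subset)]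
  · refine (csInf_le_csInf hbdd ⟨M + 1, hvu M 1 one_pos hM⟩ hsub).antisymm ?_
    refine le_csInf ⟨M, hM⟩ fun a ha => le_of_forall_pos_le_add fun η hη => ?_
    exact csInf_le (hbdd.mono hsub) (hvu a η hη ha)

lemma eventually_nhdsGT_zero_comp_half {p : ℝ → Prop} (h : ∀ᶠ ε in 𝓝[>] (0 : ℝ), p ε) :
    ∀ᶠ ε in 𝓝[>] (0 : ℝ), p (ε / 2) := by
  refine Tendsto.eventually (tendsto_nhdsWithin_iff.2 ⟨?_, ?_⟩) h
  · have : Tendsto (fun ε : ℝ => ε / 2) (𝓝 0) (𝓝 (0 / 2)) := tendsto_id.div_const 2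
    rw [zero_div] at this
    exact this.mono_left nhdsWithin_le_nhds
  · filter_upwards [self_mem_nhdsWithin] with ε hε
    exact half_pos (Set.mem_Ioi.1 hε)

end FeldmanKatok

open FeldmanKatok in
/-- the Feldman-Katok pressure via FK-spanning sets coincides with the
quantity defined via FK-separated sets. -/
theorem PFK_eq_separated_version [MetricSpace X] [CompactSpace X] (T : X → X)
    (hT : Continuous T) (f : X → ℝ) (hf : Continuous f) :
    PFK T f =
      limsup (fun ε : ℝ => limsup (fun n : ℕ => Real.log (FKsr T f n ε) / n) atTop)
        (nhdsWithin 0 (Set.Ioi 0)) := by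
  rcases isEmpty_or_nonempty X with hX | hX
  · have h : FKsp T f = FKsr T f := by
      funext n ε
      simp [FKsp, FKsr, Finset.eq_empty_of_isEmpty]
    rw [PFK, h]
  obtain ⟨C, hC⟩ := isCompact_univ.exists_bound_of_continuousOn hf.continuousOn
  replace hC : ∀ x, |f x| ≤ C := fun x => hC x trivial
  have hne : ∀ᶠ n : ℕ in atTop, n ≠ 0 := eventually_ne_atTop 0
  have hsr : ∀ ε : ℝ, 0 < ε →
      IsBoundedUnder (· ≤ ·) atTop fun n : ℕ => Real.log (FKsr T f n ε) / n := fun ε hε => by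
    obtain ⟨B, hB⟩ := exists_log_FKsr_div_le T hf hC hε
    exact isBoundedUnder_of_eventually_le (hne.mono hB)
  have hsp : ∀ ε : ℝ, 0 < ε →
      IsBoundedUnder (· ≤ ·) atTop fun n : ℕ => Real.log (FKsp T f n ε) / n := fun ε hε =>
    (hsr ε hε).mono_le (hne.mono fun n hn => log_FKsp_div_le_log_FKsr_div hn hf hε)
  have hspge : ∀ ε : ℝ, 0 < ε →
      IsBoundedUnder (· ≥ ·) atTop fun n : ℕ => Real.log (FKsp T f n ε) / n := fun ε hε =>
    isBoundedUnder_of_eventually_ge (hne.mono fun n hn => neg_le_log_FKsp_div hn hC hε)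
  have hsrge : ∀ ε : ℝ, 0 < ε →
      IsBoundedUnder (· ≥ ·) atTop fun n : ℕ => Real.log (FKsr T f n ε) / n := fun ε hε =>
    (hspge ε hε).mono_ge (hne.mono fun n hn => log_FKsp_div_le_log_FKsr_div hn hf hε)
  refine limsup_eq_limsup_of_forall_pos (c := -C) ?_ ?_ fun M η hη hM => ?_
  · filter_upwards [self_mem_nhdsWithin] with ε hε
    exact le_limsup_of_frequently_le
      (hne.mono fun n hn => neg_le_log_FKsp_div hn hC hε).frequently (hsp ε hε)
  · filter_upwards [self_mem_nhdsWithin] with ε hε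
    exact limsup_le_limsup (hne.mono fun n hn => log_FKsp_div_le_log_FKsr_div hn hf hε)
      (hspge ε hε).isCoboundedUnder_le (hsr ε hε)
  · obtain ⟨ε₀, hε₀, hclose⟩ := exists_birkhoff_le T hf (half_pos hη)
    have hlt : ∀ᶠ ε in 𝓝[>] (0 : ℝ), ε < ε₀ := (eventually_lt_nhds hε₀).filter_mono
      nhdsWithin_le_nhds
    filter_upwards [self_mem_nhdsWithin, eventually_nhdsGT_zero_comp_half hM,
      eventually_nhdsGT_zero_comp_half hlt] with ε hε hMε hltε
    have hε2 : 0 < ε / 2 := half_pos hε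
    refine limsup_le_of_le (hsrge ε hε).isCoboundedUnder_le ?_
    have hlim := eventually_lt_of_limsup_lt
      (hMε.trans_lt (lt_add_of_pos_right M (half_pos hη))) (hsp _ hε2)
    filter_upwards [hlim, hne] with n h₁ hn
    have h₂ := log_FKsr_div_le hn hf hε2 (hclose _ hltε n hn)
    rw [mul_div_cancel₀ _ two_ne_zero] at h₂
    linarith
end
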